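/- Let f : X → Y be a UV^{n−1}-map of n-dimensional Nöbeling spaces X and Y and let A ⊂ Y be a Z-set in Y. Then the adjunction space X' = X ∪_f A is an n-dimensional Nöbeling space, A is a Z-set in X', and the induced map f' : X' → Y is UV^{n−1}. -/

import Mathlib

open Set Topology

noncomputable section

namespace NobelingPaper

/-- Two maps into `Y` are `𝒰`-close: for every point some element of `𝒰` contains
both of its images. -/
def UClose {A Y : Type*} (𝒰 : Set (Set Y)) (f g : A → Y) : Prop :=
  ∀ a : A, ∃ u ∈ 𝒰, f a ∈ u ∧ g a ∈ u

/-- `𝒰` is a cover of the whole space by open sets. -/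
def IsOpenCover {Y : Type*} [TopologicalSpace Y] (𝒰 : Set (Set Y)) : Prop :=
  (∀ u ∈ 𝒰, IsOpen u) ∧ ⋃₀ 𝒰 = univ

/-- Covering dimension at most `n`: every open cover admits an open refinement of
order at most `n + 1`. -/
def CovDimLE (X : Type*) [TopologicalSpace X] (n : ℕ) : Prop :=
  ∀ 𝒰 : Set (Set X), IsOpenCover 𝒰 →
    ∃ 𝒱 : Set (Set X), IsOpenCover 𝒱 ∧ (∀ v ∈ 𝒱, ∃ u ∈ 𝒰, v ⊆ u) ∧
      ∀ x : X, {v ∈ 𝒱 | x ∈ v}.Finite ∧ {v ∈ 𝒱 | x ∈ v}.ncard ≤ n + 1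

/-- Covering dimension equal to `n`. -/
def CovDimEq (X : Type*) [TopologicalSpace X] (n : ℕ) : Prop :=
  CovDimLE X n ∧ ∀ m : ℕ, CovDimLE X m → n ≤ m

/-- `X` is an absolute extensor in dimension `n`: every map into `X` from a closed
subset of a (separable metrizable) space of covering dimension at most `n` extends
over the whole space. -/
def IsAbsExtensorInDim (n : ℕ) (X : Type*) [TopologicalSpace X] : Prop :=
  ∀ (Y : Type) [TopologicalSpace Y] [TopologicalSpace.SeparableSpace Y]
    [TopologicalSpace.MetrizableSpace Y], CovDimLE Y n →
    ∀ A : Set Y, IsClosed A → ∀ f : C(A, X), ∃ g : C(Y, X), ∀ a : A, g ↑a = f a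

/-- `X` is an `n`-dimensional Nöbeling space: a complete separable metrizable
(i.e. Polish) space of covering dimension `n` which is an absolute extensor in
dimension `n` and in which every map from a complete (separable metrizable) space of
dimension at most `n` can be arbitrarily closely approximated by a closed embedding. -/
def IsNobeling (n : ℕ) (X : Type*) [TopologicalSpace X] : Prop :=
  PolishSpace X ∧ CovDimEq X n ∧ IsAbsExtensorInDim n X ∧
    ∀ (Y : Type) [TopologicalSpace Y] [PolishSpace Y], CovDimLE Y n →
      ∀ f : C(Y, X), ∀ 𝒰 : Set (Set X), IsOpenCover 𝒰 →
        ∃ g : C(Y, X), IsClosedEmbedding ⇑g ∧ UClose 𝒰 ⇑g ⇑f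

/-- `A` is a `Z`-set in `X`. -/
def IsZSet {X : Type*} [TopologicalSpace X] (A : Set X) : Prop :=
  IsClosed A ∧ ∀ 𝒰 : Set (Set X), IsOpenCover 𝒰 →
    ∃ f : C(X, X), UClose 𝒰 ⇑f id ∧ range ⇑f ∩ A = ∅

/-- A `σ-Z`-set is a countable union of `Z`-sets. -/
def IsSigmaZSet {X : Type*} [TopologicalSpace X] (A : Set X) : Prop :=
  ∃ F : ℕ → Set X, (∀ i, IsZSet (F i)) ∧ A = ⋃ i, F i

/-- A `Z`-embedding is a closed embedding whose image is a `Z`-set. -/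
def IsZEmbedding {X Y : Type*} [TopologicalSpace X] [TopologicalSpace Y]
    (f : X → Y) : Prop :=
  IsClosedEmbedding f ∧ IsZSet (range f)

/-- The `k`-dimensional sphere. -/
abbrev Sph (k : ℕ) : Type := ↥(Metric.sphere (0 : EuclideanSpace ℝ (Fin (k + 1))) 1)

/-- The inclusion of `V` into `U` as a continuous map. -/
def inclCM {X : Type*} [TopologicalSpace X] {V U : Set X} (h : V ⊆ U) : C(V, U) :=
  ⟨Set.inclusion h, continuous_inclusion h⟩

/-- The inclusion `V ⊆ U` induces the zero homomorphism of homotopy groups in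
dimensions `≤ n − 1` (i.e. `< n`): every map of a sphere of dimension `< n` into `V`
becomes nullhomotopic in `U`. -/
def InclusionNullInDimLT {X : Type*} [TopologicalSpace X] (n : ℕ) (V U : Set X) : Prop :=
  ∃ h : V ⊆ U, ∀ k, k < n → ∀ f : C(Sph k, V), ((inclCM h).comp f).Nullhomotopic

/-- `f : X → Y` is a `UV^{n−1}`-map. -/
def IsUVMap (n : ℕ) {X Y : Type*} [TopologicalSpace X] [TopologicalSpace Y]
    (f : X → Y) : Prop :=
  Continuous f ∧ Dense (range f) ∧
    ∀ y : Y, ∀ U : Set Y, IsOpen U → y ∈ U →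
      ∃ V : Set Y, IsOpen V ∧ y ∈ V ∧ V ⊆ U ∧
        InclusionNullInDimLT n (f ⁻¹' V) (f ⁻¹' U)

/-- `X` is `(n−1)`-connected: nonempty, and every map of a sphere of dimension `< n`
into `X` is nullhomotopic. -/
def IsConnectedBelow (X : Type*) [TopologicalSpace X] (n : ℕ) : Prop :=
  Nonempty X ∧ ∀ k, k < n → ∀ f : C(Sph k, X), f.Nullhomotopic

/-! ### Triangulated spaces, PL and rational notions -/

/-- A fixed separable metrizable ambient topological vector space in which all our
(locally finite, hence finite-dimensional) simplicial complexes live. -/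
abbrev Amb : Type := ℕ → ℝ

/-- Simplicial complexes in the ambient space. -/
abbrev SC : Type := Geometry.SimplicialComplex ℝ Amb

/-- The complex `K` has dimension at most `k`. -/
def DimLE (K : SC) (k : ℕ) : Prop := ∀ s ∈ K.faces, s.card ≤ k + 1

/-- The complex `K` is purely `m`-dimensional. -/
def PureDim (K : SC) (m : ℕ) : Prop :=
  (∀ s ∈ K.faces, s.card ≤ m + 1) ∧
    ∀ s ∈ K.faces, ∃ t ∈ K.faces, s ⊆ t ∧ t.card = m + 1

/-- The complex `K` is locally finite. -/
def LocFinite (K : SC) : Prop :=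
  ∀ x ∈ K.space, ∃ U : Set Amb, IsOpen U ∧ x ∈ U ∧
    {s : Finset Amb | s ∈ K.faces ∧ (convexHull ℝ (s : Set Amb) ∩ U).Nonempty}.Finite

/-- `K'` is a subdivision of `K`. -/
def Subdivides (K' K : SC) : Prop :=
  K'.space = K.space ∧
    ∀ s ∈ K'.faces, ∃ t ∈ K.faces, convexHull ℝ (s : Set Amb) ⊆ convexHull ℝ (t : Set Amb)

/-- `f` is a PL-map on the complex `K`: affine on each simplex of some
subdivision of `K`. -/
def IsPLMap (K : SC) (f : Amb → Amb) : Prop :=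
  ∃ K' : SC, Subdivides K' K ∧
    ∀ s ∈ K'.faces, ∃ g : Amb →ᵃ[ℝ] Amb, EqOn f ⇑g (convexHull ℝ (s : Set Amb))

/-- A point with rational barycentric coordinates with respect to the
triangulation `K`. -/
def IsRationalPoint (K : SC) (x : Amb) : Prop :=
  ∃ s ∈ K.faces, ∃ w : Amb → ℚ, (∀ v ∈ s, 0 ≤ w v) ∧
    (∑ v ∈ s, (w v : ℝ)) = 1 ∧ (∑ v ∈ s, (w v : ℝ) • v) = x

/-- A rational map from the triangulated space `K` into the triangulated space `M`:
a (continuous) PL-map sending points with rational barycentric coordinates to points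
with rational barycentric coordinates. -/
def IsRationalMapInto (K M : SC) (f : Amb → Amb) : Prop :=
  IsPLMap K f ∧ ContinuousOn f K.space ∧ MapsTo f K.space M.space ∧
    ∀ x, IsRationalPoint K x → IsRationalPoint M (f x)

/-- `A` is the underlying set of a triangulated space of dimension `≤ k`
rationally embedded in `M`. -/
def IsRationallyEmbedded (M : SC) (k : ℕ) (A : Set Amb) : Prop :=
  ∃ (K : SC) (f : Amb → Amb), DimLE K k ∧ IsRationalMapInto K M f ∧
    InjOn f K.space ∧ A = f '' K.space

/-- `M(k)`: the complement in `M` of the union of all triangulated spaces of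
dimension `≤ k` rationally embedded in `M`. -/
def MkSet (M : SC) (k : ℕ) : Set Amb :=
  M.space \ ⋃₀ {A : Set Amb | IsRationallyEmbedded M k A}

/-- The halfspace model for manifolds with boundary. -/
def HalfSpace (m : ℕ) : Set (EuclideanSpace ℝ (Fin m)) :=
  {y | ∀ i : Fin m, (i : ℕ) = 0 → 0 ≤ y i}

/-- `X` is an `m`-dimensional topological manifold with (possibly empty) boundary. -/
def IsTopManifoldWithBoundary (X : Type*) [TopologicalSpace X] (m : ℕ) : Prop :=
  ∀ x : X, ∃ U : Set X, IsOpen U ∧ x ∈ U ∧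
    ∃ V : Set (HalfSpace m), IsOpen V ∧ Nonempty (↥U ≃ₜ ↥V)

/-- `M` is a triangulated (combinatorial) `m`-dimensional manifold with possibly
empty boundary: a locally finite purely `m`-dimensional complex whose underlying
space is an `m`-manifold with boundary. -/
def IsTriManifold (M : SC) (m : ℕ) : Prop :=
  LocFinite M ∧ PureDim M m ∧ IsTopManifoldWithBoundary (↥M.space) m

/-- The manifold interior `Int M` of the triangulated manifold `M`. -/
def ManifoldInterior (M : SC) (m : ℕ) : Set Amb :=
  {x | ∃ hx : x ∈ M.space, ∃ U : Set (↥M.space), IsOpen U ∧ (⟨x, hx⟩ : ↥M.space) ∈ U ∧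
      ∃ V : Set (EuclideanSpace ℝ (Fin m)), IsOpen V ∧ Nonempty (↥U ≃ₜ ↥V)}

/-- `X` is (homeomorphic to) an `n`-dimensional Nöbeling space modeled on a
triangulated manifold: `X ≃ₜ M(k)` where `M` is an `(n−1)`-connected triangulated
`m`-dimensional manifold, `m ≥ 2n+1` and `k = m − n − 1`. -/
def IsModeledNobeling (n : ℕ) (X : Type*) [TopologicalSpace X] : Prop :=
  ∃ (M : SC) (m k : ℕ), m = n + k + 1 ∧ 2 * n + 1 ≤ m ∧ IsTriManifold M m ∧
    IsConnectedBelow (↥M.space) n ∧ Nonempty (X ≃ₜ ↥(MkSet M k))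

/-- `x` is a regular point of `f`: the preimages of the open sets around `f x`
form a neighborhood base at `x`. -/
def IsRegularPoint {X Y : Type*} [TopologicalSpace X] [TopologicalSpace Y]
    (f : X → Y) (x : X) : Prop :=
  (∀ U : Set Y, IsOpen U → f x ∈ U → f ⁻¹' U ∈ nhds x) ∧
    ∀ W ∈ nhds x, ∃ U : Set Y, IsOpen U ∧ f x ∈ U ∧ f ⁻¹' U ⊆ W

/-- `f` is PL on the set `A`: `A` carries a triangulation on each of whose
simplexes `f` is affine. -/
def IsPLOn (A : Set Amb) (f : Amb → Amb) : Prop :=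
  ∃ K : SC, K.space = A ∧
    ∀ s ∈ K.faces, ∃ g : Amb →ᵃ[ℝ] Amb, EqOn f ⇑g (convexHull ℝ (s : Set Amb))


/-! The adjunction space `X ∪_f A`. -/

/-- The carrier of `X ∪_f A`: the disjoint union of `X \ f⁻¹(A)` and `A`. -/
def AdjCarrier {X Y : Type} (f : X → Y) (A : Set Y) : Type :=
  ↥((f ⁻¹' A)ᶜ) ⊕ ↥A

/-- The copy of `A` inside `X ∪_f A`. -/
def adjInr {X Y : Type} (f : X → Y) (A : Set Y) : ↥A → AdjCarrier f A := Sum.inr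

/-- The copy of `X \ f⁻¹(A)` inside `X ∪_f A`. -/
def adjInl {X Y : Type} (f : X → Y) (A : Set Y) : ↥((f ⁻¹' A)ᶜ) → AdjCarrier f A :=
  Sum.inl

/-- The induced map `f' : X ∪_f A → Y`. -/
def adjMap {X Y : Type} (f : X → Y) (A : Set Y) : AdjCarrier f A → Y :=
  Sum.elim (fun x => f ↑x) (fun a => ↑a)

/-- For `U ⊆ Y`, the subset `(U ∩ A) ∪ f⁻¹(U \ A)` of `X ∪_f A`. -/
def adjBasic {X Y : Type} (f : X → Y) (A : Set Y) (U : Set Y) :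
    Set (AdjCarrier f A) :=
  fun p =>
    match p with
    | Sum.inl x => f ↑x ∈ U \ A
    | Sum.inr a => (↑a : Y) ∈ U ∩ A

/-- The topology of `X ∪_f A`: the topology of `X \ f⁻¹(A)` is preserved and for
every `U` open in `Y` the set `(U ∩ A) ∪ f⁻¹(U \ A)` is open. -/
instance adjTopology {X Y : Type} [TopologicalSpace X] [TopologicalSpace Y]
    (f : X → Y) (A : Set Y) : TopologicalSpace (AdjCarrier f A) :=
  TopologicalSpace.generateFrom
    ({S | ∃ V : Set ↥((f ⁻¹' A)ᶜ), IsOpen V ∧ S = adjInl f A '' V} ∪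
      {S | ∃ U : Set Y, IsOpen U ∧ S = adjBasic f A U})

/-- Order of a family at a point. -/
def OrdAt {ι Z : Type*} (V : ι → Set Z) (n : ℕ) (x : Z) : Prop :=
  ∀ s : Finset ι, (∀ i ∈ s, x ∈ V i) → s.card ≤ n + 1

theorem OrdAt.mono {ι Z : Type*} {V W : ι → Set Z} {n : ℕ} {x : Z} (h : OrdAt V n x)
    (hW : ∀ i, x ∈ W i → x ∈ V i) : OrdAt W n x :=
  fun s hs => h s fun i hi => hW i (hs i hi)

def DimOn {Z : Type} [TopologicalSpace Z] (F : Set Z) (n : ℕ) : Prop :=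
  ∀ (ι : Type) (U : ι → Set Z), (∀ i, IsOpen (U i)) → F ⊆ ⋃ i, U i →
    ∃ V : ι → Set Z, (∀ i, IsOpen (V i)) ∧ (∀ i, V i ⊆ U i) ∧ F ⊆ ⋃ i, V i ∧
      ∀ x ∈ F, OrdAt V n x

theorem covDimLE_iff {Z : Type} [TopologicalSpace Z] {n : ℕ} :
    CovDimLE Z n ↔ DimOn (univ : Set Z) n := by
  constructor
  · intro h ι U hU hc
    obtain ⟨𝒱, ⟨h1, h2⟩, h3, h4⟩ := h (range U)
      ⟨by rintro _ ⟨i, rfl⟩; exact hU i, by rw [sUnion_range]; exact univ_subset_iff.1 hc⟩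
    have h3' : ∀ v : 𝒱, ∃ i, v.1 ⊆ U i := by
      rintro ⟨v, hv⟩; obtain ⟨_, ⟨i, rfl⟩, hi⟩ := h3 v hv; exact ⟨i, hi⟩
    choose c hc' using h3'
    refine ⟨fun i => ⋃ v : {v : 𝒱 // c v = i}, v.1.1, fun i => isOpen_iUnion fun v => h1 _ v.1.2,
      fun i => iUnion_subset fun v => by have := hc' v.1; rwa [v.2] at this, ?_, ?_⟩
    · intro x _
      have : x ∈ ⋃₀ 𝒱 := by rw [h2]; trivial
      obtain ⟨v, hv, hx⟩ := this
      exact mem_iUnion.2 ⟨c ⟨v, hv⟩, mem_iUnion.2 ⟨⟨⟨v, hv⟩, rfl⟩, hx⟩⟩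
    · intro x _ s hs
      have : ∀ i : s, ∃ v : 𝒱, c v = i ∧ x ∈ v.1 := by
        rintro ⟨i, hi⟩
        obtain ⟨v, hv⟩ := mem_iUnion.1 (hs i hi)
        exact ⟨v.1, v.2, hv⟩
      choose w hw1 hw2 using this
      have hinj : Function.Injective (fun i : s => (w i).1) := by
        intro i j hij
        have : w i = w j := Subtype.ext hij
        apply Subtype.ext; rw [← hw1 i, ← hw1 j, this]
      have hle : (range (fun i : s => (w i).1)).ncard ≤ {v ∈ 𝒱 | x ∈ v}.ncard :=
        ncard_le_ncard (by rintro _ ⟨i, rfl⟩; exact ⟨(w i).2, hw2 i⟩) (h4 x).1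
      have he : (range (fun i : s => (w i).1)).ncard = s.card := by
        rw [← image_univ, ncard_image_of_injective _ hinj, ncard_univ]; simp
      have := (h4 x).2
      omega
  · intro h 𝒰 ⟨h1, h2⟩
    obtain ⟨V, hV1, hV2, hV3, hV4⟩ := h 𝒰 (fun u => u.1) (fun u => h1 _ u.2)
      (by rw [← sUnion_eq_iUnion, h2])
    refine ⟨range V, ⟨by rintro _ ⟨i, rfl⟩; exact hV1 i, by
      rw [sUnion_range]; exact univ_subset_iff.1 hV3⟩, ?_, ?_⟩
    · rintro _ ⟨i, rfl⟩; exact ⟨i.1, i.2, hV2 i⟩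
    · intro x
      have hx := hV4 x trivial
      have hfin : {i | x ∈ V i}.Finite := by
        by_contra hinf
        obtain ⟨s, hs, hcard⟩ := (Set.Infinite.exists_subset_card_eq hinf (n + 2))
        have := hx s (fun i hi => hs hi)
        omega
      have hc : {i | x ∈ V i}.ncard ≤ n + 1 := by
        rw [ncard_eq_toFinset_card _ hfin]
        apply hx; intro i hi; simpa using hi
      have hsub : {v ∈ range V | x ∈ v} = V '' {i | x ∈ V i} := by
        ext v; constructor
        · rintro ⟨⟨i, rfl⟩, hx⟩; exact ⟨i, hx, rfl⟩
        · rintro ⟨i, hx, rfl⟩; exact ⟨⟨i, rfl⟩, hx⟩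
      rw [hsub]
      exact ⟨hfin.image _, (ncard_image_le hfin).trans hc⟩

theorem dimOn_image {Z P : Type} [TopologicalSpace Z] [TopologicalSpace P] {e : Z → P}
    (he : IsEmbedding e) {S : Set Z} {n : ℕ} : DimOn (e '' S) n ↔ DimOn S n := by
  constructor
  · intro h ι U hU hc
    have : ∀ i, ∃ O, IsOpen O ∧ e ⁻¹' O = U i := fun i => by
      simpa using (he.isInducing.isOpen_iff).1 (hU i)
    choose O hO hOU using this
    obtain ⟨V, h1, h2, h3, h4⟩ := h ι O hO (by
      rintro _ ⟨x, hx, rfl⟩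
      obtain ⟨i, hi⟩ := mem_iUnion.1 (hc hx)
      rw [← hOU i] at hi
      exact mem_iUnion.2 ⟨i, hi⟩)
    refine ⟨fun i => e ⁻¹' V i, fun i => (h1 i).preimage he.continuous, fun i => ?_, ?_, ?_⟩
    · rw [← hOU i]; exact preimage_mono (h2 i)
    · intro x hx
      obtain ⟨i, hi⟩ := mem_iUnion.1 (h3 (mem_image_of_mem e hx))
      exact mem_iUnion.2 ⟨i, hi⟩
    · intro x hx s hs
      exact h4 _ (mem_image_of_mem e hx) s hs
  · intro h ι U hU hc
    obtain ⟨V, h1, h2, h3, h4⟩ := h ι (fun i => e ⁻¹' U i)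
      (fun i => (hU i).preimage he.continuous) (by
      intro x hx
      obtain ⟨i, hi⟩ := mem_iUnion.1 (hc (mem_image_of_mem e hx))
      exact mem_iUnion.2 ⟨i, hi⟩)
    have : ∀ i, ∃ O, IsOpen O ∧ e ⁻¹' O = V i := fun i => by
      simpa using (he.isInducing.isOpen_iff).1 (h1 i)
    choose O hO hOV using this
    have key : ∀ i x, e x ∈ O i ∩ U i ↔ x ∈ V i := fun i x => by
      have : x ∈ e ⁻¹' O i ↔ x ∈ V i := by rw [hOV i]
      exact ⟨fun hx => this.1 hx.1, fun hx => ⟨this.2 hx, h2 i hx⟩⟩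
    refine ⟨fun i => O i ∩ U i, fun i => (hO i).inter (hU i), fun i => inter_subset_right, ?_, ?_⟩
    · rintro _ ⟨x, hx, rfl⟩
      obtain ⟨i, hi⟩ := mem_iUnion.1 (h3 hx)
      exact mem_iUnion.2 ⟨i, (key i x).2 hi⟩
    · rintro _ ⟨x, hx, rfl⟩ s hs
      exact h4 x hx s fun i hi => (key i x).1 (hs i hi)

theorem covDimLE_subtype {Z : Type} [TopologicalSpace Z] {S : Set Z} {n : ℕ} :
    CovDimLE S n ↔ DimOn S n := by
  rw [covDimLE_iff, ← dimOn_image (IsEmbedding.subtypeVal), image_univ, Subtype.range_coe]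

theorem covDimLE_range {Z P : Type} [TopologicalSpace Z] [TopologicalSpace P] {e : Z → P}
    (he : IsEmbedding e) {n : ℕ} : DimOn (range e) n ↔ CovDimLE Z n := by
  rw [covDimLE_iff, ← dimOn_image he, image_univ]

theorem DimOn.inter_closed {Z : Type} [TopologicalSpace Z] {F C : Set Z} {n : ℕ}
    (h : DimOn F n) (hC : IsClosed C) : DimOn (F ∩ C) n := by
  intro ι U hU hc
  obtain ⟨V, h1, h2, h3, h4⟩ := h (Option ι) (fun o => o.elim Cᶜ U)
    (by rintro (_ | i); exacts [hC.isOpen_compl, hU i]) (by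
    intro x hx
    by_cases hxC : x ∈ C
    · obtain ⟨i, hi⟩ := mem_iUnion.1 (hc ⟨hx, hxC⟩)
      exact mem_iUnion.2 ⟨some i, hi⟩
    · exact mem_iUnion.2 ⟨none, hxC⟩)
  refine ⟨fun i => V (some i), fun i => h1 _, fun i => h2 _, ?_, ?_⟩
  · intro x hx
    obtain ⟨i, hi⟩ := mem_iUnion.1 (h3 hx.1)
    cases i with
    | none => exact absurd hx.2 (h2 _ hi)
    | some i => exact mem_iUnion.2 ⟨i, hi⟩
  · intro x hx s hs
    have := h4 x hx.1 (s.map Function.Embedding.some) (by simpa using hs)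
    simpa using this

theorem DimOn.closed_subset {Z : Type} [TopologicalSpace Z] {F C : Set Z} {n : ℕ}
    (h : DimOn F n) (hC : IsClosed C) (hCF : C ⊆ F) : DimOn C n := by
  have := h.inter_closed hC; rwa [inter_eq_self_of_subset_right hCF] at this

theorem CovDimLE.closed {Z : Type} [TopologicalSpace Z] {C : Set Z} {n : ℕ}
    (h : CovDimLE Z n) (hC : IsClosed C) : DimOn C n :=
  (covDimLE_iff.1 h).closed_subset hC (subset_univ _)

theorem DimOn.mono {Z : Type} [TopologicalSpace Z] {F : Set Z} {m n : ℕ}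
    (h : DimOn F m) (hmn : m ≤ n) : DimOn F n := by
  intro ι U hU hc
  obtain ⟨V, h1, h2, h3, h4⟩ := h ι U hU hc
  exact ⟨V, h1, h2, h3, fun x hx s hs => (h4 x hx s hs).trans (by omega)⟩

theorem DimOn.shrink {Z : Type} [TopologicalSpace Z] {F : Set Z} {n : ℕ}
    (h : DimOn F n) (hF : IsClosed F) {ι : Type} (U : ι → Set Z) (hU : ∀ i, IsOpen (U i))
    (hc : ⋃ i, U i = univ) : ∃ V : ι → Set Z, (∀ i, IsOpen (V i)) ∧ (∀ i, V i ⊆ U i) ∧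
      ⋃ i, V i = univ ∧ (∀ x ∈ F, OrdAt V n x) ∧ ∀ x ∉ F, ∀ i, x ∈ U i → x ∈ V i := by
  obtain ⟨V, h1, h2, h3, h4⟩ := h ι U hU (by rw [hc]; exact subset_univ _)
  refine ⟨fun i => (U i \ F) ∪ V i, fun i => ((hU i).sdiff hF).union (h1 i),
    fun i => union_subset sdiff_subset (h2 i), ?_, ?_, fun x hx i hi => Or.inl ⟨hi, hx⟩⟩
  · refine eq_univ_of_forall fun x => ?_
    by_cases hx : x ∈ F
    · obtain ⟨i, hi⟩ := mem_iUnion.1 (h3 hx)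
      exact mem_iUnion.2 ⟨i, Or.inr hi⟩
    · have : x ∈ ⋃ i, U i := by rw [hc]; trivial
      obtain ⟨i, hi⟩ := mem_iUnion.1 this
      exact mem_iUnion.2 ⟨i, Or.inl ⟨hi, hx⟩⟩
  · intro x hx
    exact (h4 x hx).mono fun i hi => hi.resolve_left fun h => h.2 hx

theorem covDimLE_of_locallyFinite {Z : Type} [TopologicalSpace Z] {n : ℕ} (F : ℕ → Set Z)
    (hF : ∀ j, IsClosed (F j)) (hd : ∀ j, DimOn (F j) n) (hcov : ∀ x, ∃ j, x ∈ F j)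
    (hlf : ∀ x, ∃ N, IsOpen N ∧ x ∈ N ∧ ∃ J, ∀ j ≥ J, ∀ y ∈ N, y ∉ F j) : CovDimLE Z n := by
  rw [covDimLE_iff]
  intro ι U hU hc
  let T := {U : ι → Set Z // (∀ i, IsOpen (U i)) ∧ ⋃ i, U i = univ}
  have step : ∀ (j : ℕ) (u : T), ∃ v : T, (∀ i, v.1 i ⊆ u.1 i) ∧ (∀ x ∈ F j, OrdAt v.1 n x) ∧
      ∀ x ∉ F j, ∀ i, x ∈ u.1 i → x ∈ v.1 i := by
    rintro j ⟨u, hu1, hu2⟩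
    obtain ⟨V, h1, h2, h3, h4, h5⟩ := (hd j).shrink (hF j) u hu1 hu2
    exact ⟨⟨V, h1, h3⟩, h2, h4, h5⟩
  choose nx hn1 hn2 hn3 using step
  let W : ℕ → T := fun j => Nat.rec ⟨U, hU, univ_subset_iff.1 hc⟩ (fun j u => nx j u) j
  have hW : ∀ j, W (j + 1) = nx j (W j) := fun j => rfl
  have hanti : ∀ i, Antitone fun j => (W j).1 i := fun i =>
    antitone_nat_of_succ_le fun j => by
      change (W (j+1)).1 i ⊆ (W j).1 i
      rw [hW]; exact hn1 j _ i
  have hstab : ∀ x, ∃ N, IsOpen N ∧ x ∈ N ∧ ∃ J, ∀ y ∈ N, ∀ i, y ∈ (W J).1 i → ∀ j,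
      y ∈ (W j).1 i := by
    intro x
    obtain ⟨N, hN, hxN, J, hJ⟩ := hlf x
    refine ⟨N, hN, hxN, J, fun y hy i hyi j => ?_⟩
    have : ∀ k, y ∈ (W (J + k)).1 i := by
      intro k
      induction k with
      | zero => exact hyi
      | succ k ih =>
        rw [← add_assoc, hW]
        exact hn3 _ _ _ (hJ _ (by omega) y hy) i ih
    exact hanti i (Nat.le_add_left j J) (this j)
  refine ⟨fun i => ⋂ j, (W j).1 i, fun i => ?_, fun i => iInter_subset (fun j => (W j).1 i) 0, ?_, ?_⟩
  · rw [isOpen_iff_forall_mem_open]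
    intro x hx
    obtain ⟨N, hN, hxN, J, hJ⟩ := hstab x
    refine ⟨N ∩ (W J).1 i, ?_, hN.inter ((W J).2.1 i), hxN, mem_iInter.1 hx J⟩
    rintro y ⟨hy, hyi⟩
    exact mem_iInter.2 (hJ y hy i hyi)
  · intro x _
    obtain ⟨N, hN, hxN, J, hJ⟩ := hstab x
    have : x ∈ ⋃ i, (W J).1 i := by rw [(W J).2.2]; trivial
    obtain ⟨i, hi⟩ := mem_iUnion.1 this
    exact mem_iUnion.2 ⟨i, mem_iInter.2 (hJ x hxN i hi)⟩
  · intro x _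
    obtain ⟨j, hj⟩ := hcov x
    have := hn2 j (W j) x hj
    rw [← hW] at this
    exact this.mono fun i hi => mem_iInter.1 hi (j + 1)

theorem CovDimLE.isOpen {Z : Type} [TopologicalSpace Z] [TopologicalSpace.MetrizableSpace Z]
    {O : Set Z} {n : ℕ} (h : CovDimLE Z n) (hO : IsOpen O) : CovDimLE O n := by
  letI := TopologicalSpace.metrizableSpaceMetric Z
  rcases eq_or_ne O univ with rfl | hne
  · exact covDimLE_subtype.2 (covDimLE_iff.1 h)
  have hne' : (Oᶜ).Nonempty := nonempty_compl.2 hne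
  let t : Z → ℝ := fun x => Metric.infDist x Oᶜ
  have ht : Continuous t := Metric.continuous_infDist_pt _
  have htpos : ∀ x ∈ O, 0 < t x := fun x hx =>
    (hO.isClosed_compl.notMem_iff_infDist_pos hne').1 (by simpa using hx)
  let F : ℕ → Set Z := fun j => {x | 1 ≤ t x * (j + 1) ∧ t x * j ≤ 1}
  have hFc : ∀ j, IsClosed (F j) := fun j =>
    (isClosed_le continuous_const (ht.mul continuous_const)).inter
      (isClosed_le (ht.mul continuous_const) continuous_const)
  have hFO : ∀ j, F j ⊆ O := by
    intro j x hx
    by_contra hxO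
    have : t x = 0 := Metric.infDist_zero_of_mem hxO
    have h1 := hx.1
    rw [this] at h1; norm_num at h1
  apply covDimLE_of_locallyFinite (fun j => ((↑) : O → Z) ⁻¹' F j)
  · exact fun j => (hFc j).preimage continuous_subtype_val
  · intro j
    rw [← dimOn_image IsEmbedding.subtypeVal, image_preimage_eq_inter_range, Subtype.range_coe,
      inter_eq_self_of_subset_left (hFO j)]
    exact h.closed (hFc j)
  · rintro ⟨x, hx⟩
    have hp := htpos x hx
    refine ⟨⌊1 / t x⌋₊, ?_, ?_⟩
    · have := Nat.lt_floor_add_one (1 / t x)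
      rw [div_lt_iff₀ hp] at this
      change 1 ≤ t x * _
      nlinarith
    · have := Nat.floor_le (a := 1 / t x) (by positivity)
      rw [le_div_iff₀ hp] at this
      change t x * _ ≤ 1
      nlinarith
  · rintro ⟨x, hx⟩
    have hp := htpos x hx
    refine ⟨{y | t x / 2 < t y.1}, isOpen_lt continuous_const (ht.comp continuous_subtype_val),
      by change t x / 2 < t x; linarith, ⌈2 / t x⌉₊ + 1, ?_⟩
    intro j hj y hy hyF
    have h1 : t y.1 * j ≤ 1 := hyF.2
    have h2 : t x / 2 < t y.1 := hy
    have h3 : 2 / t x < j := lt_of_le_of_lt (Nat.le_ceil _) (by exact_mod_cast hj)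
    rw [div_lt_iff₀ hp] at h3
    nlinarith

theorem covDimLE_of_closed_add {Z : Type} [MetricSpace Z] {A : Set Z} (hA : IsClosed A) {n : ℕ}
    (hAd : DimOn A n) (hCd : ∀ C, IsClosed C → Disjoint C A → DimOn C n) : CovDimLE Z n := by
  rw [covDimLE_iff]
  intro ι U hU hc
  obtain ⟨V, h1, h2, h3, h4⟩ := hAd ι U hU (fun x _ => hc trivial)
  let Ex : ι → Set Z := fun i => {x | Metric.infEDist x A < Metric.infEDist x (A \ V i)}
  have hEx : ∀ i, IsOpen (Ex i) := fun i =>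
    isOpen_lt Metric.continuous_infEDist Metric.continuous_infEDist
  have hExA : ∀ i, ∀ x ∈ A, x ∈ V i → x ∈ Ex i := by
    intro i x hx hxi
    change Metric.infEDist x A < Metric.infEDist x (A \ V i)
    rw [Metric.infEDist_zero_of_mem hx, pos_iff_ne_zero]
    intro h0
    have := (Metric.mem_iff_infEDist_zero_of_closed (hA.sdiff (h1 i))).2 h0
    exact this.2 hxi
  have hord : ∀ x, OrdAt Ex n x := by
    intro x s hs
    rcases s.eq_empty_or_nonempty with rfl | hne
    · simp
    have : Metric.infEDist x A < s.inf (fun i => Metric.infEDist x (A \ V i)) := by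
      obtain ⟨i, hi, he⟩ := Finset.exists_mem_eq_inf s hne (fun i => Metric.infEDist x (A \ V i))
      rw [he]; exact hs i hi
    obtain ⟨a, ha, hxa⟩ := Metric.infEDist_lt_iff.1 this
    apply h4 a ha s
    intro i hi
    by_contra hai
    have h5 : Metric.infEDist x (A \ V i) ≤ edist x a := Metric.infEDist_le_edist_of_mem ⟨ha, hai⟩
    have h6 := Finset.inf_le (f := fun i => Metric.infEDist x (A \ V i)) hi
    exact absurd hxa (not_lt.2 (h6.trans h5))
  let E : ι → Set Z := fun i => Ex i ∩ U i
  have hE : ∀ i, IsOpen (E i) := fun i => (hEx i).inter (hU i)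
  have hAG : A ⊆ ⋃ i, E i := by
    intro x hx
    obtain ⟨i, hi⟩ := mem_iUnion.1 (h3 hx)
    exact mem_iUnion.2 ⟨i, hExA i x hx hi, h2 i hi⟩
  obtain ⟨G, hG, hAG0, hclG⟩ := normal_exists_closure_subset hA (isOpen_iUnion hE) hAG
  obtain ⟨W, w1, w2, w3, w4, w5⟩ := (hCd Gᶜ hG.isClosed_compl
    (disjoint_left.2 fun x hx hxA => hx (hAG0 hxA))).shrink hG.isClosed_compl
    (fun i => E i ∪ (U i \ closure G)) (fun i => (hE i).union ((hU i).sdiff isClosed_closure)) (by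
      refine eq_univ_of_forall fun x => ?_
      by_cases hx : x ∈ closure G
      · obtain ⟨i, hi⟩ := mem_iUnion.1 (hclG hx)
        exact mem_iUnion.2 ⟨i, Or.inl hi⟩
      · obtain ⟨i, hi⟩ := mem_iUnion.1 (hc (mem_univ x))
        exact mem_iUnion.2 ⟨i, Or.inr ⟨hi, hx⟩⟩)
  refine ⟨W, w1, fun i => (w2 i).trans (union_subset inter_subset_right sdiff_subset), w3.ge, ?_⟩
  intro x _
  by_cases hx : x ∈ Gᶜ
  · exact w4 x hx
  · refine (hord x).mono fun i hi => ?_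
    rcases w2 i hi with h | h
    · exact h.1
    · exact absurd (subset_closure (not_not.1 hx)) h.2

theorem dimOn_compact_pi {m : ℕ} {K : Set (Fin m → ℝ)} (hK : IsCompact K) : DimOn K m := by
  intro ι U hU hc
  obtain ⟨δ, hδ, hleb⟩ := lebesgue_number_lemma_of_metric hK hU hc
  obtain ⟨N, hN⟩ := exists_nat_gt (1 / δ)
  have hN0 : (0:ℝ) < N := lt_trans (by positivity) hN
  have hNδ : 1 < δ * N := by rw [div_lt_iff₀ hδ] at hN; linarith
  let d : ℝ → ℝ := fun t => Metric.infDist t (range ((↑) : ℤ → ℝ))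
  have hd : Continuous d := Metric.continuous_infDist_pt _
  let B : Finset (Fin m) × (Fin m → ℤ) → Set (Fin m → ℝ) := fun p =>
    (⋂ i, {x | (i ∈ p.1 → |N * x i - p.2 i| < 1/2) ∧ (i ∉ p.1 → p.2 i < N * x i ∧ N * x i < p.2 i + 1)})
    ∩ ⋂ i ∈ p.1, ⋂ j ∈ p.1ᶜ, {x | d (N * x i) < d (N * x j)}
  have hB : ∀ p, IsOpen (B p) := by
    intro p
    refine (isOpen_iInter_of_finite fun i => ?_).inter
      (isOpen_biInter_finset fun i _ => isOpen_biInter_finset fun j _ => ?_)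
    · by_cases hi : i ∈ p.1
      · simp only [hi, not_true, false_imp_iff, and_true, true_imp_iff]
        exact isOpen_lt (by fun_prop) continuous_const
      · simp only [hi, not_false_iff, false_imp_iff, true_and, true_imp_iff]
        have hct : Continuous fun x : Fin m → ℝ => (N : ℝ) * x i := by fun_prop
        exact (isOpen_lt continuous_const hct).inter (isOpen_lt hct continuous_const)
    · exact isOpen_lt (by fun_prop) (by fun_prop)
  have hdisj : ∀ p q x, x ∈ B p → x ∈ B q → p.1.card = q.1.card → p = q := by
    rintro ⟨S, c⟩ ⟨S', c'⟩ x ⟨h1, h2⟩ ⟨h1', h2'⟩ hcard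
    have hS : S = S' := by
      by_contra hne
      have e1 : ∃ i ∈ S, i ∉ S' := by
        by_contra hcon; push Not at hcon
        exact hne (Finset.eq_of_subset_of_card_le hcon hcard.ge)
      have e2 : ∃ i ∈ S', i ∉ S := by
        by_contra hcon; push Not at hcon
        exact hne (Finset.eq_of_subset_of_card_le hcon hcard.le).symm
      obtain ⟨i, hi, hi'⟩ := e1
      obtain ⟨j, hj, hj'⟩ := e2
      simp only [mem_iInter, Finset.mem_compl, mem_ofPred_eq] at h2 h2'
      exact lt_asymm (h2 i hi j hj') (h2' j hj i hi')
    subst hS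
    congr 1
    funext i
    simp only [mem_iInter, mem_ofPred_eq] at h1 h1'
    by_cases hi : i ∈ S
    · have a := abs_lt.1 ((h1 i).1 hi)
      have b := abs_lt.1 ((h1' i).1 hi)
      have u1 : c i < c' i + 1 := by
        have : (c i : ℝ) < c' i + 1 := by linarith
        exact_mod_cast this
      have u2 : c' i < c i + 1 := by
        have : (c' i : ℝ) < c i + 1 := by linarith
        exact_mod_cast this
      omega
    · have a := ((h1 i).2 hi)
      have b := ((h1' i).2 hi)
      have u1 : c i < c' i + 1 := by
        have : (c i : ℝ) < c' i + 1 := by linarith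
        exact_mod_cast this
      have u2 : c' i < c i + 1 := by
        have : (c' i : ℝ) < c i + 1 := by linarith
        exact_mod_cast this
      omega
  have hdiam : ∀ p x y, x ∈ B p → y ∈ B p → y ∈ Metric.ball x δ := by
    rintro ⟨S, c⟩ x y ⟨h1, -⟩ ⟨h1', -⟩
    simp only [mem_iInter, mem_ofPred_eq] at h1 h1'
    rw [Metric.mem_ball, dist_pi_lt_iff hδ]
    intro i
    have key : |N * y i - N * x i| < 1 := by
      rw [abs_lt]
      by_cases hi : i ∈ S
      · have a := abs_lt.1 ((h1 i).1 hi)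
        have b := abs_lt.1 ((h1' i).1 hi)
        constructor <;> linarith
      · have a := ((h1 i).2 hi)
        have b := ((h1' i).2 hi)
        constructor <;> linarith
    rw [Real.dist_eq]
    rw [← mul_sub, abs_mul, abs_of_pos hN0] at key
    nlinarith [abs_nonneg (y i - x i)]
  have hcov : ∀ x, ∃ p, x ∈ B p := by
    intro x
    classical
    have hz : ∀ i, ∃ z : ℤ, (d (N * x i) < 1/2 → |N * x i - z| < 1/2) ∧
        (¬ d (N * x i) < 1/2 → z < N * x i ∧ N * x i < z + 1) := by
      intro i
      by_cases hi : d (N * x i) < 1/2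
      · obtain ⟨_, ⟨z, rfl⟩, hz⟩ := (Metric.infDist_lt_iff (range_nonempty _)).1 hi
        exact ⟨z, fun _ => hz, fun h => absurd hi h⟩
      · refine ⟨⌊N * x i⌋, fun h => absurd h hi, fun _ => ⟨?_, Int.lt_floor_add_one _⟩⟩
        refine lt_of_le_of_ne (Int.floor_le _) fun he => hi ?_
        have : d (N * x i) = 0 := Metric.infDist_zero_of_mem ⟨_, he⟩
        rw [this]; norm_num
    choose c hc1 hc2 using hz
    refine ⟨⟨Finset.univ.filter fun i => d (N * x i) < 1/2, c⟩, ?_, ?_⟩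
    · simp only [mem_iInter, mem_ofPred_eq, Finset.mem_filter, Finset.mem_univ, true_and]
      exact fun i => ⟨hc1 i, hc2 i⟩
    · simp only [mem_iInter, mem_ofPred_eq, Finset.mem_filter, Finset.mem_univ, true_and,
        Finset.mem_compl]
      intro i hi j hj
      exact lt_of_lt_of_le hi (not_lt.1 hj)
  have hidx : ∀ p : {p // (B p ∩ K).Nonempty}, ∃ i, B p.1 ⊆ U i := by
    rintro ⟨p, x, hx, hxK⟩
    obtain ⟨i, hi⟩ := hleb x hxK
    exact ⟨i, fun y hy => hi (hdiam p x y hx hy)⟩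
  choose c hc' using hidx
  refine ⟨fun i => ⋃ p : {p // c p = i}, B p.1.1, fun i => isOpen_iUnion fun p => hB _,
    fun i => iUnion_subset fun p => by have := hc' p.1; rwa [p.2] at this, ?_, ?_⟩
  · intro x hx
    obtain ⟨p, hp⟩ := hcov x
    exact mem_iUnion.2 ⟨_, mem_iUnion.2 ⟨⟨⟨p, x, hp, hx⟩, rfl⟩, hp⟩⟩
  · intro x _ s hs
    have : ∀ i : s, ∃ p, c p = i ∧ x ∈ B p.1 := by
      rintro ⟨i, hi⟩
      obtain ⟨p, hp⟩ := mem_iUnion.1 (hs i hi)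
      exact ⟨p.1, p.2, hp⟩
    choose w hw1 hw2 using this
    have hinj : Function.Injective (fun i : s => (⟨(w i).1.1.card, by
        have := Finset.card_le_univ (w i).1.1; simp at this; omega⟩ : Fin (m + 1))) := by
      intro i j hij
      have : w i = w j := Subtype.ext (hdisj _ _ x (hw2 i) (hw2 j) (Fin.mk.inj hij))
      apply Subtype.ext; rw [← hw1 i, ← hw1 j, this]
    have := Fintype.card_le_of_injective _ hinj
    simpa using this

theorem dimOn_compact_euclidean {m : ℕ} {K : Set (EuclideanSpace ℝ (Fin m))} (hK : IsCompact K) :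
    DimOn K m := by
  have e := (EuclideanSpace.equiv (Fin m) ℝ).toHomeomorph
  rw [← dimOn_image e.isEmbedding]
  exact dimOn_compact_pi (hK.image e.continuous)

abbrev EE (k : ℕ) : Type := EuclideanSpace ℝ (Fin k)

def SphNull {X : Type} [TopologicalSpace X] (n : ℕ) (S T : Set X) : Prop :=
  S ⊆ T ∧ ∀ k < n, ∀ g : C(Sph k, X), (∀ s, g s ∈ S) →
    ∃ G : C(EE (k + 1), X), (∀ s : Sph k, G s = g s) ∧ ∀ x, G x ∈ T

theorem SphNull.mono {X : Type} [TopologicalSpace X] {n : ℕ} {S T S' T' : Set X}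
    (h : SphNull n S T) (hS : S' ⊆ S) (hT : T ⊆ T') : SphNull n S' T' :=
  ⟨hS.trans (h.1.trans hT), fun k hk g hg =>
    let ⟨G, h1, h2⟩ := h.2 k hk g fun s => hS (hg s)
    ⟨G, h1, fun x => hT (h2 x)⟩⟩

/-- radial retraction onto the unit ball -/
def rad (k : ℕ) (x : EE k) : EE k := (max 1 ‖x‖)⁻¹ • x

theorem rad_cont (k : ℕ) : Continuous (rad k) := by
  unfold rad
  have hc : Continuous fun x : EE k => max 1 ‖x‖ := by fun_prop
  refine Continuous.smul (hc.inv₀ fun x => ?_) continuous_id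
  have : (1:ℝ) ≤ max 1 ‖x‖ := le_max_left _ _
  positivity

theorem rad_norm {k : ℕ} (x : EE k) : ‖rad k x‖ ≤ 1 := by
  have h1 : (1:ℝ) ≤ max 1 ‖x‖ := le_max_left _ _
  have h2 : ‖x‖ ≤ max 1 ‖x‖ := le_max_right _ _
  rw [rad, norm_smul, norm_inv, Real.norm_of_nonneg (by positivity), inv_mul_le_iff₀ (by positivity)]
  simp

theorem rad_eq {k : ℕ} {x : EE k} (h : ‖x‖ ≤ 1) : rad k x = x := by
  rw [rad, max_eq_left h]; simp

theorem extend_ball {X : Type} [TopologicalSpace X] {k : ℕ} {G : EE k → X}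
    (hG : ContinuousOn G (Metric.closedBall 0 1)) :
    ∃ G' : C(EE k, X), (∀ x, ‖x‖ ≤ 1 → G' x = G x) ∧ ∀ x, ∃ y, ‖y‖ ≤ 1 ∧ G' x = G y := by
  refine ⟨⟨fun x => G (rad k x), hG.comp_continuous (rad_cont k) fun x => by
    simpa using rad_norm x⟩, fun x hx => ?_, fun x => ⟨_, rad_norm x, rfl⟩⟩
  change G (rad k x) = G x
  rw [rad_eq hx]

theorem sphNull_of_incl {X : Type} [TopologicalSpace X] {n : ℕ} {S T : Set X}
    (h : InclusionNullInDimLT n S T) : SphNull n S T := by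
  obtain ⟨hST, h⟩ := h
  refine ⟨hST, fun k hk g hg => ?_⟩
  obtain ⟨y, ⟨F⟩⟩ := h k hk ⟨fun s => ⟨g s, hg s⟩, by fun_prop⟩
  have hnz : ∀ x : EE (k+1), x ≠ 0 → ‖x‖⁻¹ • x ∈ Metric.sphere (0 : EE (k+1)) 1 := by
    intro x hx
    simp [norm_smul, inv_mul_cancel₀ (norm_ne_zero_iff.2 hx)]
  classical
  let G : EE (k+1) → X := fun x => if hx : x = 0 then y.1 else
    (F (projIcc 0 1 zero_le_one (2 - 2 * ‖x‖), ⟨‖x‖⁻¹ • x, hnz x hx⟩)).1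
  have hT : ∀ x, G x ∈ T := by
    intro x
    by_cases hx : x = 0
    · simp only [G, hx, dite_true]; exact y.2
    · simp only [G, hx, dite_false]; exact Subtype.coe_prop _
  have hG : Continuous G := by
    rw [continuous_iff_continuousAt]
    intro x
    by_cases hx : x = 0
    · have : G =ᶠ[𝓝 x] fun _ => y.1 := by
        filter_upwards [Metric.ball_mem_nhds x (show (0:ℝ) < 1/2 by norm_num)] with z hz
        rw [hx] at hz
        have hz' : ‖z‖ < 1/2 := by simpa using hz
        by_cases h0 : z = 0
        · simp [G, h0]
        · simp only [G, h0, dite_false]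
          rw [projIcc_of_right_le _ (by linarith)]
          have := F.apply_one ⟨‖z‖⁻¹ • z, hnz z h0⟩
          exact congrArg Subtype.val this
      exact continuousAt_const.congr this.symm
    · have hop : IsOpen ({0}ᶜ : Set (EE (k+1))) := isOpen_compl_singleton
      refine ContinuousOn.continuousAt ?_ (hop.mem_nhds hx)
      rw [continuousOn_iff_continuous_domRestrict]
      have hc : Continuous fun x : ({0}ᶜ : Set (EE (k+1))) =>
        (F (projIcc 0 1 zero_le_one (2 - 2 * ‖x.1‖), ⟨‖x.1‖⁻¹ • x.1, hnz x.1 x.2⟩)).1 := by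
        refine continuous_subtype_val.comp (F.continuous.comp (Continuous.prodMk ?_ ?_))
        · exact continuous_projIcc.comp (by fun_prop)
        · have hc : Continuous fun x : ({0}ᶜ : Set (EE (k+1))) => ‖x.1‖ := by fun_prop
          refine Continuous.subtype_mk (Continuous.smul (hc.inv₀ ?_) continuous_subtype_val) _
          intro z; exact norm_ne_zero_iff.2 z.2
      convert hc using 1
      funext z
      have hz : z.1 ≠ 0 := z.2
      simp [G, hz]
  refine ⟨⟨G, hG⟩, fun s => ?_, hT⟩
  have hs : ‖s.1‖ = 1 := by simp
  have h0 : s.1 ≠ 0 := by intro h; rw [h] at hs; simp at hs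
  change G s.1 = g s
  simp only [G, h0, dite_false, hs]
  rw [projIcc_of_le_left _ (by norm_num)]
  have := F.apply_zero ⟨(1:ℝ)⁻¹ • s.1, by simp⟩
  refine (congrArg Subtype.val this).trans ?_
  change g ⟨(1:ℝ)⁻¹ • s.1, _⟩ = g s
  congr 1; apply Subtype.ext; simp

theorem incl_of_sphNull {X : Type} [TopologicalSpace X] {n : ℕ} {S T : Set X}
    (h : SphNull n S T) : InclusionNullInDimLT n S T := by
  refine ⟨h.1, fun k hk f => ?_⟩
  obtain ⟨G, h1, h2⟩ := h.2 k hk ⟨fun s => (f s).1, by fun_prop⟩ (fun s => (f s).2)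
  refine ⟨⟨G 0, h2 0⟩, ⟨⟨⟨fun p => ⟨G ((1 - p.1.1) • p.2.1), h2 _⟩, ?_⟩, ?_, ?_⟩⟩⟩
  · exact Continuous.subtype_mk (G.continuous.comp (by fun_prop)) _
  · intro s
    apply Subtype.ext
    change G ((1 - (0:ℝ)) • s.1) = (f s).1
    rw [sub_zero, one_smul]
    exact h1 s
  · intro s
    apply Subtype.ext
    simp

/-- closed simplex spanned by a finite set of vertices -/
def Dl {ι : Type} (σ : Finset ι) : Set (ι → ℝ) :=
  {x | (∀ i, 0 ≤ x i) ∧ (∀ i, i ∉ σ → x i = 0) ∧ ∑ i ∈ σ, x i = 1}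

def dDl {ι : Type} (σ : Finset ι) : Set (ι → ℝ) := {x ∈ Dl σ | ∃ i ∈ σ, x i = 0}

theorem extend_simplex {X ι : Type} [TopologicalSpace X] {n k : ℕ} (hk : k < n) {S T : Set X}
    (h : SphNull n S T) {σ : Finset ι} (hσ : σ.card = k + 2) {e : (ι → ℝ) → X}
    (he : ContinuousOn e (dDl σ)) (heS : MapsTo e (dDl σ) S) :
    ∃ e' : (ι → ℝ) → X, ContinuousOn e' (Dl σ) ∧ EqOn e' e (dDl σ) ∧ MapsTo e' (Dl σ) T := by
  classical
  let q := σ.equivFinOfCardEq hσ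
  let β : EE (k+1) → Fin (k+2) → ℝ := fun y => Fin.snoc (α := fun _ => ℝ) (fun j => y j) (1 - ∑ j, y j)
  have hβc : ∀ y (j : Fin (k+1)), β y j.castSucc = y j := fun y j => by simp [β]
  have hβl : ∀ y, β y (Fin.last _) = 1 - ∑ j, y j := fun y => by simp [β]
  have hβcont : ∀ j, Continuous fun y => β y j := by
    intro j
    refine Fin.lastCases ?_ (fun j => ?_) j
    · simp only [hβl]; fun_prop
    · simp only [hβc]; fun_prop
  have hβaff : ∀ (y c : EE (k+1)) (t : ℝ) j, β (y + t • (y - c)) j = β y j + t * (β y j - β c j) := by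
    intro y c t j
    refine Fin.lastCases ?_ (fun j => ?_) j
    · simp only [hβl, PiLp.add_apply, PiLp.smul_apply, PiLp.sub_apply, smul_eq_mul,
        Finset.sum_add_distrib, ← Finset.mul_sum, Finset.sum_sub_distrib]; ring
    · simp only [hβc, PiLp.add_apply, PiLp.smul_apply, PiLp.sub_apply, smul_eq_mul]
  have hβsum : ∀ y, ∑ j, β y j = 1 := by
    intro y; rw [Fin.sum_univ_castSucc]; simp only [hβc, hβl]; ring
  let K : Set (EE (k+1)) := {y | ∀ j, 0 ≤ β y j}
  have hKc : IsClosed K := by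
    have : K = ⋂ j, {y | 0 ≤ β y j} := by ext y; simp [K]
    rw [this]
    exact isClosed_iInter fun j => isClosed_le continuous_const (hβcont j)
  have hKi : {y | ∀ j, 0 < β y j} ⊆ interior K := by
    refine interior_maximal (fun y hy j => (hy j).le) ?_
    have : {y | ∀ j, 0 < β y j} = ⋂ j, {y | 0 < β y j} := by ext y; simp
    rw [this]
    exact isOpen_iInter_of_finite fun j => isOpen_lt continuous_const (hβcont j)
  have hconv : Convex ℝ K := by
    intro x hx y hy a b ha hb hab j
    have hb' : a = 1 - b := by linarith
    have : β (a • x + b • y) j = a * β x j + b * β y j := by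
      have h1 : a • x + b • y = x + (-b) • (x - y) := by rw [hb']; module
      rw [h1, hβaff, hb']; ring
    rw [this]
    have := hx j; have := hy j
    positivity
  have hne : ∃ c, ∀ j, 0 < β c j := by
    refine ⟨WithLp.toLp 2 fun _ => 1 / ((k:ℝ) + 2), fun j => ?_⟩
    refine Fin.lastCases ?_ (fun j => ?_) j
    · rw [hβl]; simp
      rw [← div_eq_mul_inv, div_lt_one (by positivity)]; linarith
    · rw [hβc]; simp; positivity
  have hbd : Bornology.IsBounded K := by
    have hcube : K ⊆ (EuclideanSpace.equiv (Fin (k+1)) ℝ).symm '' (Icc 0 1) := by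
      intro y hy
      refine ⟨fun j => y j, ⟨fun j => ?_, fun j => ?_⟩, rfl⟩
      · have := hy j.castSucc; rwa [hβc] at this
      · have h1 := Finset.single_le_sum (f := β y) (fun i _ => hy i) (Finset.mem_univ j.castSucc)
        rw [hβsum, hβc] at h1; exact h1
    refine Bornology.IsBounded.subset (IsCompact.isBounded ?_) hcube
    exact isCompact_Icc.image (ContinuousLinearEquiv.continuous _)
  obtain ⟨c, hc⟩ := hne
  obtain ⟨H, -, hH2, hH3⟩ := exists_homeomorph_image_interior_closure_frontier_eq_unitBall hconv
    ⟨c, hKi hc⟩ hbd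
  rw [hKc.closure_eq] at hH2
  have hfr1 : ∀ y ∈ frontier K, y ∈ K ∧ ∃ j, β y j = 0 := by
    intro y hy
    rw [hKc.frontier_eq] at hy
    refine ⟨hy.1, ?_⟩
    by_contra hcon; push Not at hcon
    exact hy.2 (hKi fun j => lt_of_le_of_ne (hy.1 j) (hcon j).symm)
  have hfr2 : ∀ y ∈ K, (∃ j, β y j = 0) → y ∈ frontier K := by
    rintro y hy ⟨j, hj⟩
    rw [hKc.frontier_eq]
    refine ⟨hy, fun hint => ?_⟩
    have hct : Filter.Tendsto (fun t : ℝ => y + t • (y - c)) (𝓝 0) (𝓝 y) := by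
      have : Continuous fun t : ℝ => y + t • (y - c) := by fun_prop
      simpa using this.tendsto 0
    have hev := hct.eventually (isOpen_interior.mem_nhds hint)
    obtain ⟨ε, hε, hb⟩ := Metric.eventually_nhds_iff.1 hev
    have h1 := interior_subset (hb (y := ε / 2) (by
      rw [Real.dist_eq, sub_zero, abs_of_pos (by positivity)]; linarith)) j
    rw [hβaff, hj] at h1
    have := hc j
    nlinarith
  -- parametrisation
  let ψ : EE (k+1) → ι → ℝ := fun y i => if hi : i ∈ σ then β y (q ⟨i, hi⟩) else 0
  have hψc : Continuous ψ := by
    refine continuous_pi fun i => ?_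
    by_cases hi : i ∈ σ
    · simp only [ψ, hi, dite_true]; exact hβcont _
    · simp only [ψ, hi, dite_false]; exact continuous_const
  have hψΔ : ∀ y ∈ K, ψ y ∈ Dl σ := by
    intro y hy
    refine ⟨fun i => ?_, fun i hi => by simp [ψ, hi], ?_⟩
    · by_cases hi : i ∈ σ
      · simp only [ψ, hi, dite_true]; exact hy _
      · simp [ψ, hi]
    · rw [← Finset.sum_coe_sort, ← hβsum y, ← Equiv.sum_comp q]
      refine Finset.sum_congr rfl fun i _ => ?_
      simp [ψ]
  have hψd : ∀ y ∈ frontier K, ψ y ∈ dDl σ := by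
    intro y hy
    obtain ⟨h1, j, hj⟩ := hfr1 y hy
    refine ⟨hψΔ y h1, (q.symm j).1, (q.symm j).2, ?_⟩
    simp [ψ, hj]
  let φ : (ι → ℝ) → EE (k+1) := fun x => WithLp.toLp 2 fun j => x (q.symm j.castSucc).1
  have hφc : Continuous φ := by fun_prop
  have hβφ : ∀ x ∈ Dl σ, ∀ j, β (φ x) j = x (q.symm j).1 := by
    rintro x ⟨-, -, hx⟩ j
    rw [← Finset.sum_coe_sort, ← Equiv.sum_comp q.symm, Fin.sum_univ_castSucc] at hx
    refine Fin.lastCases ?_ (fun j => ?_) j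
    · rw [hβl]
      change 1 - ∑ j : Fin (k+1), x (q.symm j.castSucc).1 = _
      linarith
    · rw [hβc]
  have hφK : ∀ x ∈ Dl σ, φ x ∈ K := fun x hx j => by rw [hβφ x hx]; exact hx.1 _
  have hψφ : ∀ x ∈ Dl σ, ψ (φ x) = x := by
    intro x hx
    funext i
    by_cases hi : i ∈ σ
    · simp only [ψ, hi, dite_true]; rw [hβφ x hx]; simp
    · simp only [ψ, hi, dite_false]; exact (hx.2.1 i hi).symm
  have hsph : ∀ s : Sph k, H.symm s.1 ∈ frontier K := by
    intro s
    obtain ⟨y, hy, hys⟩ := hH3.ge s.2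
    rw [← hys]; simpa using hy
  obtain ⟨G, hG1, hG2⟩ := h.2 k hk ⟨fun s => e (ψ (H.symm s.1)),
    he.comp_continuous (by fun_prop) fun s => hψd _ (hsph s)⟩ (fun s => heS (hψd _ (hsph s)))
  refine ⟨fun x => G (H (φ x)), by fun_prop, ?_, fun x _ => hG2 _⟩
  rintro x ⟨hx, i, hi, hxi⟩
  have h1 : φ x ∈ frontier K := hfr2 _ (hφK x hx) ⟨q ⟨i, hi⟩, by rw [hβφ x hx]; simpa using hxi⟩
  have h2 : H (φ x) ∈ Metric.sphere (0 : EE (k+1)) 1 := by rw [← hH3]; exact mem_image_of_mem _ h1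
  have h3 := hG1 ⟨_, h2⟩
  change G (H (φ x)) = e x
  rw [h3]
  change e (ψ (H.symm (H (φ x)))) = e x
  rw [H.symm_apply_apply, hψφ x hx]

theorem Dl_closed {ι : Type} (σ : Finset ι) : IsClosed (Dl σ) := by
  have : Dl σ = (⋂ i, {x | 0 ≤ x i}) ∩ ((⋂ i, ⋂ (_ : i ∉ σ), {x | x i = 0}) ∩
      {x | ∑ i ∈ σ, x i = 1}) := by
    ext x; simp [Dl]
  rw [this]
  refine (isClosed_iInter fun i => isClosed_le continuous_const (continuous_apply i)).inter
    ((isClosed_iInter fun i => isClosed_iInter fun _ =>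
      isClosed_eq (continuous_apply i) continuous_const).inter
      (isClosed_eq (by fun_prop) continuous_const))

theorem Dl_erase {ι : Type} [DecidableEq ι] {σ : Finset ι} {x : ι → ℝ} {i : ι} (hx : x ∈ Dl σ)
    (hi : i ∈ σ) (h0 : x i = 0) : x ∈ Dl (σ.erase i) := by
  refine ⟨hx.1, fun j hj => ?_, ?_⟩
  · by_cases hji : j = i
    · rw [hji, h0]
    · exact hx.2.1 j fun h => hj (Finset.mem_erase.2 ⟨hji, h⟩)
  · rw [← hx.2.2, ← Finset.add_sum_erase σ x hi, h0, zero_add]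

theorem Dl_supp {ι : Type} {σ τ : Finset ι} {x : ι → ℝ} (hx : x ∈ Dl σ) (hx' : x ∈ Dl τ)
    (hd : x ∉ dDl τ) : τ ⊆ σ := by
  intro i hi
  by_contra his
  exact hd ⟨hx', i, hi, hx.2.1 i his⟩

theorem continuousOn_finite_closed {α β κ : Type*} [TopologicalSpace α] [TopologicalSpace β]
    [Finite κ] {C : κ → Set α} {g : α → β} (hC : ∀ i, IsClosed (C i))
    (hg : ∀ i, ContinuousOn g (C i)) : ContinuousOn g (⋃ i, C i) :=
  (locallyFinite_of_finite C).continuousOn_iUnion hC hg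

theorem skeletal {Z X : Type} [TopologicalSpace Z] [TopologicalSpace.MetrizableSpace Z]
    [TopologicalSpace X] {n : ℕ} (hZ : CovDimLE Z n) (P : ℕ → Set (Set Z × Set X))
    (hW : ∀ p ∈ P 0, IsOpen p.1) (hcov : ∀ z, ∃ p ∈ P 0, z ∈ p.1 ∧ p.2.Nonempty)
    (hR : ∀ i < n, ∀ F : Finset (Set Z × Set X), F.Nonempty → (∀ p ∈ F, p ∈ P i) →
      ∀ z, (∀ p ∈ F, z ∈ p.1) → ∃ q ∈ P (i + 1), (⋂ p ∈ F, p.1) ⊆ q.1 ∧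
        SphNull n (⋃ p ∈ F, p.2) q.2) :
    ∃ G : C(Z, X), ∀ z, ∃ p ∈ P n, z ∈ p.1 ∧ G z ∈ p.2 := by
  classical
  let := TopologicalSpace.metrizableSpaceMetric Z
  rcases isEmpty_or_nonempty Z with hZe | ⟨⟨z0⟩⟩
  · exact ⟨⟨fun z => (hZe.false z).elim, continuous_of_const fun z => (hZe.false z).elim⟩,
      fun z => (hZe.false z).elim⟩
  let ι : Type := {p : Set Z × Set X // p ∈ P 0 ∧ p.2.Nonempty}
  obtain ⟨V, hV1, hV2, hV3, hV4⟩ := covDimLE_iff.1 hZ ι (fun i => i.1.1) (fun i => hW _ i.2.1)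
    (fun z _ => let ⟨p, h1, h2, h3⟩ := hcov z; mem_iUnion.2 ⟨⟨p, h1, h3⟩, h2⟩)
  obtain ⟨f, hf⟩ := PartitionOfUnity.exists_isSubordinate isClosed_univ V hV1 hV3
  let nv : Finset ι → Prop := fun σ => σ.Nonempty ∧ ∃ z, ∀ i ∈ σ, z ∈ V i
  have nvcard : ∀ σ, nv σ → σ.card ≤ n + 1 := fun σ ⟨_, z, hz⟩ => hV4 z trivial σ hz
  have nvsub : ∀ σ τ, nv σ → τ ⊆ σ → τ.Nonempty → nv τ := fun σ τ h hτ hne =>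
    ⟨hne, h.2.imp fun z hz i hi => hz i (hτ hi)⟩
  have main : ∀ m ≤ n, ∃ (e : (ι → ℝ) → X) (Q : Finset ι → Set Z × Set X), ∀ σ, nv σ →
      σ.card ≤ m + 1 → Q σ ∈ P m ∧ (⋂ i ∈ σ, V i) ⊆ (Q σ).1 ∧ ContinuousOn e (Dl σ) ∧
        MapsTo e (Dl σ) (Q σ).2 := by
    intro m
    induction m with
    | zero =>
      intro _
      obtain ⟨p0, hp0, -, hp1⟩ := hcov z0
      let i0 : ι := ⟨p0, hp0, hp1⟩
      let e : (ι → ℝ) → X := fun x => if h : ∃ i, x i = 1 then h.choose.2.2.some else i0.2.2.some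
      let Q : Finset ι → Set Z × Set X := fun σ => if h : σ.Nonempty then h.choose.1 else p0
      refine ⟨e, Q, fun σ hσ hc => ?_⟩
      have hc1 : σ.card = 1 := le_antisymm hc hσ.1.card_pos
      obtain ⟨i, rfl⟩ := Finset.card_eq_one.1 hc1
      have hQ : Q {i} = i.1 := by
        have h : ({i} : Finset ι).Nonempty := ⟨i, by simp⟩
        have : h.choose = i := by simpa using h.choose_spec
        simp only [Q, h, dite_true, this]
      have hx1 : ∀ x ∈ Dl ({i} : Finset ι), x i = 1 := fun x hx => by simpa using hx.2.2
      have hxj : ∀ x ∈ Dl ({i} : Finset ι), ∀ j, j ≠ i → x j = 0 := fun x hx j hj =>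
        hx.2.1 j (by simpa using hj)
      rw [hQ]
      refine ⟨i.2.1, by simpa using hV2 i, Set.Subsingleton.continuousOn ?_ _, ?_⟩
      · intro x hx y hy
        funext j
        by_cases hj : j = i
        · rw [hj, hx1 x hx, hx1 y hy]
        · rw [hxj x hx j hj, hxj y hy j hj]
      · intro x hx
        have h : ∃ i, x i = 1 := ⟨i, hx1 x hx⟩
        have hi : h.choose = i := by
          by_contra hne
          have := h.choose_spec
          rw [hxj x hx _ hne] at this; norm_num at this
        simp only [e, h, dite_true]
        have h5 := h.choose.2.2.some_mem
        have h6 : h.choose.1.2 = i.1.2 := by rw [hi]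
        exact h6 ▸ h5
    | succ m ih =>
      intro hm
      obtain ⟨e, Q, hQ⟩ := ih (by omega)
      let F : Finset ι → Finset (Set Z × Set X) := fun σ =>
        (σ.powerset.filter fun τ => τ.Nonempty ∧ τ.card ≤ m + 1).image Q
      have hF : ∀ σ p, p ∈ F σ ↔ ∃ τ, τ ⊆ σ ∧ τ.Nonempty ∧ τ.card ≤ m + 1 ∧ Q τ = p := by
        intro σ p; simp [F, and_assoc]
      have hex : ∀ σ, ∃ q, nv σ → q ∈ P (m + 1) ∧ (⋂ p ∈ F σ, p.1) ⊆ q.1 ∧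
          SphNull n (⋃ p ∈ F σ, p.2) q.2 := by
        intro σ
        by_cases hσ : nv σ
        · obtain ⟨z, hz⟩ := hσ.2
          obtain ⟨q, h1, h2, h3⟩ := hR m (by omega) (F σ) (by
            obtain ⟨i, hi⟩ := hσ.1
            exact ⟨Q {i}, (hF _ _).2 ⟨{i}, by simpa using hi, ⟨i, by simp⟩, by simp, rfl⟩⟩)
            (by
              intro p hp
              obtain ⟨τ, h1, h2, h3, rfl⟩ := (hF _ _).1 hp
              exact (hQ τ (nvsub σ τ hσ h1 h2) h3).1) z (by
              intro p hp
              obtain ⟨τ, h1, h2, h3, rfl⟩ := (hF _ _).1 hp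
              refine (hQ τ (nvsub σ τ hσ h1 h2) h3).2.1 ?_
              exact mem_iInter₂.2 fun i hi => hz i (h1 hi))
          exact ⟨q, fun _ => ⟨h1, h2, h3⟩⟩
        · exact ⟨Q σ, fun h => absurd h hσ⟩
      choose Q' hQ' using hex
      have hext : ∀ σ, ∃ e' : (ι → ℝ) → X, nv σ → σ.card = m + 2 → ContinuousOn e' (Dl σ) ∧
          EqOn e' e (dDl σ) ∧ MapsTo e' (Dl σ) (Q' σ).2 := by
        intro σ
        by_cases hσ : nv σ ∧ σ.card = m + 2
        · have herase : ∀ i ∈ σ, nv (σ.erase i) ∧ (σ.erase i).card ≤ m + 1 := by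
            intro i hi
            have hc : (σ.erase i).card = m + 1 := by rw [Finset.card_erase_of_mem hi]; omega
            exact ⟨nvsub σ _ hσ.1 (Finset.erase_subset _ _)
              (Finset.card_pos.1 (by omega)), hc.le⟩
          obtain ⟨e', h1, h2, h3⟩ := extend_simplex (e := e) (by omega : m < n) (hQ' σ hσ.1).2.2 hσ.2
            (by
              refine (continuousOn_finite_closed (C := fun i : σ => Dl (σ.erase i.1))
                (fun i => Dl_closed _) (fun i => (hQ _ (herase i.1 i.2).1 (herase i.1 i.2).2).2.2.1)).mono ?_
              rintro x ⟨hx, i, hi, h0⟩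
              exact mem_iUnion.2 ⟨⟨i, hi⟩, Dl_erase hx hi h0⟩)
            (by
              rintro x ⟨hx, i, hi, h0⟩
              refine mem_iUnion₂.2 ⟨Q (σ.erase i), (hF _ _).2 ⟨_, Finset.erase_subset _ _,
                (herase i hi).1.1, (herase i hi).2, rfl⟩, ?_⟩
              exact (hQ _ (herase i hi).1 (herase i hi).2).2.2.2 (Dl_erase hx hi h0))
          exact ⟨e', fun _ _ => ⟨h1, h2, h3⟩⟩
        · exact ⟨e, fun h1 h2 => absurd ⟨h1, h2⟩ hσ⟩
      choose ex hex using hext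
      let e' : (ι → ℝ) → X := fun x =>
        if h : ∃ σ, nv σ ∧ σ.card = m + 2 ∧ x ∈ Dl σ ∧ x ∉ dDl σ then ex h.choose x else e x
      have he1 : ∀ σ, σ.card ≤ m + 1 → EqOn e' e (Dl σ) := by
        intro σ hc x hx
        have : ¬ ∃ σ, nv σ ∧ σ.card = m + 2 ∧ x ∈ Dl σ ∧ x ∉ dDl σ := by
          rintro ⟨τ, -, h2, h3, h4⟩
          have := Finset.card_le_card (Dl_supp hx h3 h4)
          omega
        simp only [e', this, dite_false]
      have he2 : ∀ σ, nv σ → σ.card = m + 2 → EqOn e' (ex σ) (Dl σ) := by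
        intro σ hσ hc x hx
        by_cases hd : x ∈ dDl σ
        · rw [(hex σ hσ hc).2.1 hd]
          obtain ⟨_, i, hi, h0⟩ := hd
          exact he1 (σ.erase i) (by rw [Finset.card_erase_of_mem hi]; omega) (Dl_erase hx hi h0)
        · have h : ∃ σ, nv σ ∧ σ.card = m + 2 ∧ x ∈ Dl σ ∧ x ∉ dDl σ := ⟨σ, hσ, hc, hx, hd⟩
          have hs := h.choose_spec
          have : h.choose = σ := Finset.Subset.antisymm (Dl_supp hx hs.2.2.1 hs.2.2.2)
            (Dl_supp hs.2.2.1 hx hd)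
          simp only [e', h, dite_true, this]
      refine ⟨e', Q', fun σ hσ hc => ?_⟩
      refine ⟨(hQ' σ hσ).1, Subset.trans ?_ (hQ' σ hσ).2.1, ?_⟩
      · intro z hz
        refine mem_iInter₂.2 fun p hp => ?_
        obtain ⟨τ, h1, h2, h3, rfl⟩ := (hF _ _).1 hp
        refine (hQ τ (nvsub σ τ hσ h1 h2) h3).2.1 ?_
        exact mem_iInter₂.2 fun i hi => mem_iInter₂.1 hz i (h1 hi)
      · rcases Nat.lt_or_ge σ.card (m + 2) with hlt | hge
        · have h := hQ σ hσ (by omega)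
          refine ⟨h.2.2.1.congr (he1 σ (by omega)), fun x hx => ?_⟩
          rw [he1 σ (by omega) hx]
          refine (hQ' σ hσ).2.2.1 (mem_iUnion₂.2 ⟨Q σ, (hF _ _).2 ⟨σ, Subset.rfl, hσ.1, by omega, rfl⟩, ?_⟩)
          exact h.2.2.2 hx
        · have hc' : σ.card = m + 2 := by omega
          have h := hex σ hσ hc'
          refine ⟨h.1.congr (he2 σ hσ hc'), fun x hx => ?_⟩
          rw [he2 σ hσ hc' hx]
          exact h.2.2 hx
  obtain ⟨e, Q, hQ⟩ := main n le_rfl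
  let l : Z → ι → ℝ := fun z i => f i z
  have hl : Continuous l := continuous_pi fun i => (f i).continuous
  have hfV : ∀ i z, f i z ≠ 0 → z ∈ V i := fun i z h => hf i (subset_tsupport _ h)
  have hlD : ∀ z (σ : Finset ι), (∀ i, i ∉ σ → f i z = 0) → l z ∈ Dl σ := by
    intro z σ h
    refine ⟨fun i => f.nonneg i z, h, ?_⟩
    have h1 := f.sum_eq_one (x := z) trivial
    rw [finsum_eq_sum_of_support_subset (s := σ)] at h1
    · exact h1
    · intro i hi; by_contra hc; exact hi (h i hc)
  have hsupp : ∀ z, ∃ σ, nv σ ∧ (∀ i, i ∈ σ ↔ f i z ≠ 0) := by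
    intro z
    have hfin : {i | z ∈ Function.support (f i)}.Finite := f.locallyFinite.point_finite z
    refine ⟨hfin.toFinset, ⟨?_, z, fun i hi => ?_⟩, fun i => by simp⟩
    · by_contra hne
      rw [Finset.not_nonempty_iff_eq_empty] at hne
      have := (hlD z ∅ (fun i _ => by
        by_contra h0
        have : i ∈ hfin.toFinset := by simpa using h0
        rw [hne] at this; simp at this)).2.2
      simp at this
    · exact hfV i z (by simpa using hi)
  have hG : Continuous fun z => e (l z) := by
    rw [continuous_iff_continuousAt]
    intro z
    obtain ⟨N, hN, hNf⟩ := f.locallyFinite z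
    let s := hNf.toFinset
    let κ := {τ : Finset ι // τ ∈ s.powerset ∧ nv τ}
    have : Finite κ := Finite.of_injective (fun τ : κ => (⟨τ.1, τ.2.1⟩ : s.powerset))
      (fun a b h => Subtype.ext (Subtype.mk.inj h))
    let C : κ → Set Z := fun τ => {w | ∀ i, i ∉ τ.1 → f i w = 0}
    have hC : ∀ τ, IsClosed (C τ) := by
      intro τ
      have : C τ = ⋂ i, ⋂ (_ : i ∉ τ.1), {w | f i w = 0} := by ext; simp [C]
      rw [this]
      exact isClosed_iInter fun i => isClosed_iInter fun _ =>
        isClosed_eq (f i).continuous continuous_const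
    have hcont : ContinuousOn (fun z => e (l z)) (⋃ τ, C τ) := by
      refine continuousOn_finite_closed hC fun τ => ?_
      exact (hQ τ.1 τ.2.2 (nvcard _ τ.2.2)).2.2.1.comp hl.continuousOn fun w hw => hlD w τ.1 hw
    refine hcont.continuousAt (Filter.mem_of_superset hN fun w hw => ?_)
    obtain ⟨σ, h1, h2⟩ := hsupp w
    refine mem_iUnion.2 ⟨⟨σ, Finset.mem_powerset.2 fun i hi => ?_, h1⟩, fun i hi => ?_⟩
    · exact hNf.mem_toFinset.2 ⟨w, (h2 i).1 hi, hw⟩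
    · by_contra h0; exact hi ((h2 i).2 h0)
  refine ⟨⟨_, hG⟩, fun z => ?_⟩
  obtain ⟨σ, h1, h2⟩ := hsupp z
  have h := hQ σ h1 (nvcard σ h1)
  refine ⟨Q σ, h.1, h.2.1 (mem_iInter₂.2 fun i hi => hfV i z ((h2 i).1 hi)), ?_⟩
  exact h.2.2.2 (hlD z σ fun i hi => by by_contra h0; exact hi ((h2 i).2 h0))

theorem nice_cover {D : Type} [TopologicalSpace D] [TopologicalSpace.MetrizableSpace D]
    (W : D → Set D) (hW : ∀ z, IsOpen (W z)) (hz : ∀ z, z ∈ W z) :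
    ∃ p : D → Set D, (∀ z, IsOpen (p z)) ∧ (∀ z, ∃ a, z ∈ p a) ∧ (∀ a, closure (p a) ⊆ W a) ∧
      ∀ z, {a | z ∈ closure (p a)}.Finite ∧
        ∃ N, IsOpen N ∧ z ∈ N ∧ ∀ a, (N ∩ closure (p a)).Nonempty → z ∈ closure (p a) := by
  let := TopologicalSpace.metrizableSpaceMetric D
  obtain ⟨v, hv1, hv2, hv3, hv4⟩ := precise_refinement W hW
    (eq_univ_of_forall fun z => mem_iUnion.2 ⟨z, hz z⟩)
  obtain ⟨p, hp1, hp2, hp3⟩ := exists_iUnion_eq_closure_subset hv1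
    (fun x => hv3.point_finite x) hv2
  have hlf : LocallyFinite fun a => closure (p a) := hv3.subset hp3
  refine ⟨p, hp2, fun z => mem_iUnion.1 (hp1.ge (mem_univ z)), fun a => (hp3 a).trans (hv4 a),
    fun z => ⟨hlf.point_finite z, ?_⟩⟩
  obtain ⟨N, h1, h2, h3⟩ := mem_nhds_iff.1 (hlf.eventually_subset (fun _ => isClosed_closure) z)
  exact ⟨N, h2, h3, fun a ⟨y, hy, hya⟩ => h1 hy hya⟩

theorem star_cover {D : Type} [TopologicalSpace D] [TopologicalSpace.MetrizableSpace D]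
    (𝒢 : Set (Set D)) (h𝒢 : IsOpenCover 𝒢) : ∃ 𝒱 : Set (Set D), IsOpenCover 𝒱 ∧
      ∀ a, ∃ O, IsOpen O ∧ a ∈ O ∧ ∃ Γ ∈ 𝒢, a ∈ Γ ∧ ∀ v ∈ 𝒱, (v ∩ O).Nonempty → v ⊆ Γ := by
  have : ∀ z, ∃ Γ ∈ 𝒢, z ∈ Γ := fun z => by
    have := h𝒢.2.ge (mem_univ z); exact this
  choose W hW1 hW2 using this
  obtain ⟨p, h1, h2, h3, h4⟩ := nice_cover W (fun z => h𝒢.1 _ (hW1 z)) hW2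
  refine ⟨{v | IsOpen v ∧ ∀ a, (v ∩ closure (p a)).Nonempty → v ⊆ W a}, ⟨fun v hv => hv.1, ?_⟩, ?_⟩
  · refine eq_univ_of_forall fun z => ?_
    obtain ⟨hfin, N, hN, hzN, hNa⟩ := h4 z
    refine ⟨N ∩ ⋂ a ∈ {a | z ∈ closure (p a)}, W a,
      ⟨hN.inter (hfin.isOpen_biInter fun a _ => h𝒢.1 _ (hW1 a)), fun a ha => ?_⟩,
      hzN, mem_iInter₂.2 fun a ha => h3 a ha⟩
    have : z ∈ closure (p a) := hNa a (ha.mono (inter_subset_inter_left _ inter_subset_left))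
    exact fun y hy => mem_iInter₂.1 hy.2 a this
  · intro z
    obtain ⟨a, ha⟩ := h2 z
    exact ⟨p a, h1 a, ha, W a, hW1 a, h3 a (subset_closure ha), fun v hv hne =>
      hv.2 a (hne.mono (inter_subset_inter_right _ subset_closure))⟩

/-- the relation between consecutive levels in the skeletal lemma -/
def RR {Z X : Type} [TopologicalSpace X] (n : ℕ) (P P' : Set (Set Z × Set X)) : Prop :=
  ∀ F : Finset (Set Z × Set X), F.Nonempty → (∀ p ∈ F, p ∈ P) →
      ∀ z, (∀ p ∈ F, z ∈ p.1) → ∃ q ∈ P', (⋂ p ∈ F, p.1) ⊆ q.1 ∧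
        SphNull n (⋃ p ∈ F, p.2) q.2

def Good {D X : Type} [TopologicalSpace D] (𝒮 : D → Filter X) (P : Set (Set D × Set X)) : Prop :=
  (∀ p ∈ P, IsOpen p.1 ∧ ∀ z ∈ p.1, p.2 ∈ 𝒮 z) ∧ ∀ z, ∃ p ∈ P, z ∈ p.1

structure FNice {D X : Type} [TopologicalSpace D] [TopologicalSpace X] (n : ℕ)
    (𝒮 : D → Filter X) : Prop where
  a : ∀ z, ∀ S ∈ 𝒮 z, ∀ᶠ z' in 𝓝 z, S ∈ 𝒮 z'
  b : ∀ z, ∀ S ∈ 𝒮 z, ∃ S' ∈ 𝒮 z, SphNull n S' S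

theorem FNice.step {D X : Type} [TopologicalSpace D] [TopologicalSpace.MetrizableSpace D]
    [TopologicalSpace X] {n : ℕ} {𝒮 : D → Filter X} (h : FNice n 𝒮) {P' : Set (Set D × Set X)}
    (hP : Good 𝒮 P') : ∃ P, Good 𝒮 P ∧ RR n P P' := by
  have : ∀ z, ∃ q ∈ P', z ∈ q.1 ∧ ∃ S, SphNull n S q.2 ∧ ∃ W, IsOpen W ∧ z ∈ W ∧ W ⊆ q.1 ∧
      ∀ z' ∈ W, S ∈ 𝒮 z' := by
    intro z
    obtain ⟨q, hq, hzq⟩ := hP.2 z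
    obtain ⟨S, hS, hS'⟩ := h.b z q.2 ((hP.1 q hq).2 z hzq)
    obtain ⟨W, h1, h2, h3⟩ := mem_nhds_iff.1 (h.a z S hS)
    exact ⟨q, hq, hzq, S, hS', W ∩ q.1, h2.inter (hP.1 q hq).1, ⟨h3, hzq⟩, inter_subset_right,
      fun z' hz' => h1 hz'.1⟩
  choose q hq hzq S hS W hWo hzW hWq hWS using this
  obtain ⟨p, h1, h2, h3, h4⟩ := nice_cover W hWo hzW
  refine ⟨{r | IsOpen r.1 ∧ (∀ z ∈ r.1, r.2 ∈ 𝒮 z) ∧ ∀ a, (r.1 ∩ closure (p a)).Nonempty →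
    r.1 ⊆ (q a).1 ∧ r.2 ⊆ S a}, ⟨fun r hr => ⟨hr.1, hr.2.1⟩, fun z => ?_⟩, ?_⟩
  · obtain ⟨hfin, N, hN, hzN, hNa⟩ := h4 z
    refine ⟨(N ∩ ⋂ a ∈ {a | z ∈ closure (p a)}, W a, ⋂ a ∈ {a | z ∈ closure (p a)}, S a),
      ⟨hN.inter (hfin.isOpen_biInter fun a _ => hWo a), fun z' hz' => ?_, fun a ha => ?_⟩,
      hzN, mem_iInter₂.2 fun a ha => h3 a ha⟩
    · exact (Filter.biInter_mem hfin).2 fun a ha => hWS a z' (mem_iInter₂.1 hz'.2 a ha)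
    · have : z ∈ closure (p a) := hNa a (ha.mono (inter_subset_inter_left _ inter_subset_left))
      exact ⟨fun y hy => hWq a (mem_iInter₂.1 hy.2 a this), fun y hy => mem_iInter₂.1 hy a this⟩
  · intro F hne hF z hz
    obtain ⟨a, ha⟩ := h2 z
    have key : ∀ r ∈ F, r.1 ⊆ (q a).1 ∧ r.2 ⊆ S a := fun r hr =>
      (hF r hr).2.2 a ⟨z, hz r hr, subset_closure ha⟩
    refine ⟨q a, hq a, ?_, (hS a).mono (iUnion₂_subset fun r hr => (key r hr).2) Subset.rfl⟩
    obtain ⟨r, hr⟩ := hne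
    exact (iInter₂_subset r hr).trans (key r hr).1

theorem FNice.chain {D X : Type} [TopologicalSpace D] [TopologicalSpace.MetrizableSpace D]
    [TopologicalSpace X] {n : ℕ} {𝒮 : D → Filter X} (h : FNice n 𝒮) {P' : Set (Set D × Set X)}
    (hP : Good 𝒮 P') : ∃ P : ℕ → Set (Set D × Set X), P n = P' ∧ (∀ i, Good 𝒮 (P i)) ∧
      ∀ i < n, RR n (P i) (P (i + 1)) := by
  choose nx h1 h2 using fun (P : {P // Good 𝒮 P}) => h.step P.2
  let Q : ℕ → {P // Good 𝒮 P} := fun j => Nat.rec ⟨P', hP⟩ (fun _ P => ⟨nx P, h1 P⟩) j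
  refine ⟨fun i => (Q (n - i)).1, by simp [Q], fun i => (Q (n - i)).2, fun i hi => ?_⟩
  have : n - i = (n - (i + 1)) + 1 := by omega
  change RR n (Q (n - i)).1 _
  rw [this]
  exact h2 (Q (n - (i+1)))

theorem filter_skeletal {D X : Type} [TopologicalSpace D] [TopologicalSpace.MetrizableSpace D]
    [TopologicalSpace X] {n : ℕ} (hD : CovDimLE D n) {𝒮 : D → Filter X} (h : FNice n 𝒮)
    (hne : ∀ z, (𝒮 z).NeBot) {P' : Set (Set D × Set X)} (hP : Good 𝒮 P') :
    ∃ G : C(D, X), ∀ z, ∃ p ∈ P', z ∈ p.1 ∧ G z ∈ p.2 := by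
  obtain ⟨P, rfl, h2, h3⟩ := h.chain hP
  refine skeletal hD P (fun p hp => ((h2 0).1 p hp).1) (fun z => ?_) h3
  obtain ⟨p, hp, hz⟩ := (h2 0).2 z
  exact ⟨p, hp, hz, (hne z).nonempty_of_mem (((h2 0).1 p hp).2 z hz)⟩

def LCn (n : ℕ) (X : Type) [TopologicalSpace X] : Prop :=
  ∀ x : X, ∀ S ∈ 𝓝 x, ∃ S' ∈ 𝓝 x, SphNull n S' S

def UVSAt (n : ℕ) {X Y : Type} [TopologicalSpace X] [TopologicalSpace Y] (f : X → Y) (y : Y) :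
    Prop := ∀ S ∈ Filter.comap f (𝓝 y), ∃ S' ∈ Filter.comap f (𝓝 y), SphNull n S' S

def UVS (n : ℕ) {X Y : Type} [TopologicalSpace X] [TopologicalSpace Y] (f : X → Y) : Prop :=
  ∀ y : Y, UVSAt n f y

theorem comap_neBot_of_dense {X Y : Type} [TopologicalSpace Y] {f : X → Y} (hd : DenseRange f)
    (y : Y) : (Filter.comap f (𝓝 y)).NeBot := by
  rw [Filter.comap_neBot_iff]
  intro t ht
  obtain ⟨_, h1, ⟨x, rfl⟩⟩ := mem_closure_iff_nhds.1 (hd y) t ht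
  exact ⟨x, h1⟩

theorem lift_map {Z X Y : Type} [TopologicalSpace Z] [TopologicalSpace.MetrizableSpace Z]
    [TopologicalSpace X] [TopologicalSpace.MetrizableSpace X] [TopologicalSpace Y] {n : ℕ}
    (hZ : CovDimLE Z n) {f : X → Y} (hf : Continuous f) {Q : Z → Y} {C : Set Z}
    (hd : ∀ z ∉ C, (Filter.comap f (𝓝 (Q z))).NeBot) (hUV : ∀ z ∉ C, UVSAt n f (Q z))
    (hLC : LCn n X) {O : Set Z} (hC : IsClosed C) (hO : IsOpen O) (hCO : C ⊆ O) (G0 : Z → X)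
    (hG0 : ContinuousOn G0 O) (hQ : ContinuousOn Q Cᶜ) (hQG : ∀ z ∈ O, f (G0 z) = Q z)
    (U : Z → Set Y) (hU : ∀ z ∉ C, U z ∈ 𝓝 (Q z)) (N : Z → Set Z) (hN : ∀ z ∉ C, N z ∈ 𝓝 z) :
    ∃ G : C(Z, X), EqOn G G0 C ∧ ∀ z ∉ C, ∃ z' ∉ C, z ∈ N z' ∧ f (G z) ∈ U z' := by
  classical
  let := TopologicalSpace.metrizableSpaceMetric Z
  let := TopologicalSpace.metrizableSpaceMetric X
  let D : Type := (Cᶜ : Set Z)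
  have hGat : ∀ z ∈ O, ContinuousAt G0 z := fun z hz => hG0.continuousAt (hO.mem_nhds hz)
  let 𝒮 : D → Filter X := fun z => if z.1 ∈ O then 𝓝 (G0 z.1) else Filter.comap f (𝓝 (Q z.1))
  have h𝒮1 : ∀ z : D, z.1 ∈ O → 𝒮 z = 𝓝 (G0 z.1) := fun z hz => by simp only [𝒮, hz, if_true]
  have h𝒮2 : ∀ z : D, z.1 ∉ O → 𝒮 z = Filter.comap f (𝓝 (Q z.1)) := fun z hz => by
    simp only [𝒮, hz, if_false]
  have h𝒮3 : ∀ z : D, ∀ V ∈ 𝓝 (Q z.1), f ⁻¹' V ∈ 𝒮 z := by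
    intro z V hV
    by_cases hz : z.1 ∈ O
    · rw [h𝒮1 z hz]
      rw [← hQG _ hz] at hV
      exact hf.continuousAt hV
    · rw [h𝒮2 z hz]; exact Filter.preimage_mem_comap hV
  have hQc : Continuous fun z : D => Q z.1 := continuousOn_iff_continuous_domRestrict.1 hQ
  have hnice : FNice n 𝒮 := by
    constructor
    · intro z S hS
      by_cases hz : z.1 ∈ O
      · rw [h𝒮1 z hz] at hS
        have h1 : ∀ᶠ z' : D in 𝓝 z, z'.1 ∈ O :=
          continuous_subtype_val.continuousAt (hO.mem_nhds hz)
        have h2 : ∀ᶠ z' : D in 𝓝 z, S ∈ 𝓝 (G0 z'.1) := by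
          have : ContinuousAt (fun z' : D => G0 z'.1) z :=
            ContinuousAt.comp (f := fun z' : D => z'.1) (hGat z.1 hz) continuous_subtype_val.continuousAt
          exact this.eventually (eventually_mem_nhds_iff.2 hS)
        filter_upwards [h1, h2] with z' h1 h2
        rwa [h𝒮1 z' h1]
      · rw [h𝒮2 z hz] at hS
        obtain ⟨V, hV, hVS⟩ := Filter.mem_comap.1 hS
        have : ∀ᶠ z' : D in 𝓝 z, V ∈ 𝓝 (Q z'.1) :=
          hQc.continuousAt.eventually (eventually_mem_nhds_iff.2 hV)
        filter_upwards [this] with z' h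
        exact Filter.mem_of_superset (h𝒮3 z' V h) hVS
    · intro z S hS
      by_cases hz : z.1 ∈ O
      · rw [h𝒮1 z hz] at hS ⊢; exact hLC _ S hS
      · rw [h𝒮2 z hz] at hS ⊢; exact hUV _ z.2 S hS
  have hneb : ∀ z, (𝒮 z).NeBot := by
    intro z
    by_cases hz : z.1 ∈ O
    · rw [h𝒮1 z hz]; infer_instance
    · rw [h𝒮2 z hz]; exact hd _ z.2
  have hr : ∀ z : D, ∃ r > 0, ∀ c ∈ C, r ≤ dist z.1 c / 2 := by
    intro z
    obtain ⟨ε, hε, h⟩ := Metric.isOpen_iff.1 hC.isOpen_compl z.1 z.2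
    refine ⟨ε / 2, by positivity, fun c hc => ?_⟩
    by_contra hlt
    exact h (show c ∈ Metric.ball z.1 ε by rw [Metric.mem_ball']; linarith) hc
  choose r hr0 hrC using hr
  let P' : Set (Set D × Set X) := {p | IsOpen p.1 ∧ (∀ z ∈ p.1, p.2 ∈ 𝒮 z) ∧ ∃ z0 : D,
    (∀ w ∈ p.1, dist w.1 z0.1 < r z0 ∧ w.1 ∈ N z0.1) ∧ p.2 ⊆ f ⁻¹' U z0.1 ∧
    (z0.1 ∈ O → p.2 ⊆ Metric.ball (G0 z0.1) (r z0))}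
  have hgood : Good 𝒮 P' := by
    refine ⟨fun p hp => ⟨hp.1, hp.2.1⟩, fun z => ?_⟩
    have : ∃ S ∈ 𝒮 z, S ⊆ f ⁻¹' U z.1 ∧ (z.1 ∈ O → S ⊆ Metric.ball (G0 z.1) (r z)) := by
      by_cases hz : z.1 ∈ O
      · refine ⟨f ⁻¹' U z.1 ∩ Metric.ball (G0 z.1) (r z), Filter.inter_mem (h𝒮3 z _ (hU z.1 z.2)) ?_,
          inter_subset_left, fun _ => inter_subset_right⟩
        rw [h𝒮1 z hz]; exact Metric.ball_mem_nhds _ (hr0 z)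
      · exact ⟨_, h𝒮3 z _ (hU z.1 z.2), Subset.rfl, fun h => absurd h hz⟩
    obtain ⟨S, hS, hS1, hS2⟩ := this
    have h1 : ∀ᶠ w : D in 𝓝 z, w.1 ∈ Metric.ball z.1 (r z) ∩ N z.1 :=
      continuous_subtype_val.continuousAt
        (Filter.inter_mem (Metric.ball_mem_nhds _ (hr0 z)) (hN z.1 z.2))
    obtain ⟨W, hW1, hW2, hW3⟩ := mem_nhds_iff.1 ((hnice.a z S hS).and h1)
    exact ⟨(W, S), ⟨hW2, fun w hw => (hW1 hw).1, z, fun w hw => (hW1 hw).2, hS1, hS2⟩, hW3⟩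
  obtain ⟨G1, hG1⟩ := filter_skeletal (hZ.isOpen hC.isOpen_compl) hnice hneb hgood
  let G : Z → X := fun z => if h : z ∈ C then G0 z else G1 ⟨z, h⟩
  have hGC : ∀ z ∈ C, G z = G0 z := fun z hz => by simp only [G, hz, dite_true]
  have hGD : ∀ z (hz : z ∉ C), G z = G1 ⟨z, hz⟩ := fun z hz => by simp only [G, hz, dite_false]
  have hGcont : Continuous G := by
    rw [continuous_iff_continuousAt]
    intro c
    by_cases hc : c ∈ C
    · rw [Metric.continuousAt_iff]
      intro ε hε
      have h1 := Metric.continuousAt_iff.1 (hGat c (hCO hc)) (ε / 2) (by positivity)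
      obtain ⟨δ1, hδ1, h1⟩ := h1
      obtain ⟨δ2, hδ2, h2⟩ := Metric.isOpen_iff.1 hO c (hCO hc)
      refine ⟨min (min δ1 δ2 / 2) (ε / 2), by positivity, fun {z} hz => ?_⟩
      have hz1 : dist z c < δ1 / 2 := by
        have := min_le_left δ1 δ2
        have := lt_of_lt_of_le hz (min_le_left _ _); linarith
      have hz2 : dist z c < δ2 / 2 := by
        have := min_le_right δ1 δ2
        have := lt_of_lt_of_le hz (min_le_left _ _); linarith
      have hz3 : dist z c < ε / 2 := lt_of_lt_of_le hz (min_le_right _ _)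
      rw [hGC c hc]
      by_cases hzC : z ∈ C
      · rw [hGC z hzC]
        have := h1 (show dist z c < δ1 by linarith [dist_nonneg (x := z) (y := c)])
        linarith
      · rw [hGD z hzC]
        obtain ⟨p, ⟨-, -, z0, hp1, hp2, hp3⟩, hzp, hGp⟩ := hG1 ⟨z, hzC⟩
        have a1 := (hp1 _ hzp).1
        have a2 := hrC z0 c hc
        have a3 : dist z0.1 c ≤ dist z z0.1 + dist z c := by
          rw [dist_comm z z0.1]; exact dist_triangle _ _ _
        change dist z z0.1 < _ at a1
        have hz0 : z0.1 ∈ O := h2 (show dist z0.1 c < δ2 by linarith)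
        have a4 := h1 (show dist z0.1 c < δ1 by linarith)
        have a5 : dist (G1 ⟨z, hzC⟩) (G0 z0.1) < r z0 := hp3 hz0 hGp
        have := dist_triangle (G1 ⟨z, hzC⟩) (G0 z0.1) (G0 c)
        linarith
    · refine ContinuousOn.continuousAt ?_ (hC.isOpen_compl.mem_nhds hc)
      rw [continuousOn_iff_continuous_domRestrict]
      convert G1.continuous using 1
      funext z
      exact hGD z.1 z.2
  refine ⟨⟨G, hGcont⟩, hGC, fun z hz => ?_⟩
  obtain ⟨p, ⟨-, -, z0, hp1, hp2, hp3⟩, hzp, hGp⟩ := hG1 ⟨z, hz⟩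
  refine ⟨z0.1, z0.2, (hp1 _ hzp).2, ?_⟩
  change f (G z) ∈ _
  rw [hGD z hz]
  exact hp2 hGp

/-- version without a prescribed part -/
theorem lift_map' {Z X Y : Type} [TopologicalSpace Z] [TopologicalSpace.MetrizableSpace Z]
    [TopologicalSpace X] [TopologicalSpace.MetrizableSpace X] [TopologicalSpace Y] {n : ℕ}
    (hZ : CovDimLE Z n) {f : X → Y} (hf : Continuous f) (hd : DenseRange f) (hUV : UVS n f)
    (hLC : LCn n X) (Q : Z → Y) (hQ : Continuous Q)
    (U : Z → Set Y) (hU : ∀ z, U z ∈ 𝓝 (Q z)) (N : Z → Set Z) (hN : ∀ z, N z ∈ 𝓝 z) :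
    ∃ G : C(Z, X), ∀ z, ∃ z', z ∈ N z' ∧ f (G z) ∈ U z' := by
  rcases isEmpty_or_nonempty Z with hZe | ⟨⟨z0⟩⟩
  · exact ⟨⟨fun z => (hZe.false z).elim, continuous_of_const fun z => (hZe.false z).elim⟩,
      fun z => (hZe.false z).elim⟩
  · have : Nonempty X := by
      have := comap_neBot_of_dense hd (Q z0)
      exact (Filter.comap f (𝓝 (Q z0))).nonempty_of_neBot
    obtain ⟨G, -, hG⟩ := lift_map (Q := Q) hZ hf (fun z _ => comap_neBot_of_dense hd _)
      (fun z _ => hUV _) hLC isClosed_empty isOpen_empty Subset.rfl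
      (fun _ => this.some) (by simp) hQ.continuousOn (by simp) U (fun z _ => hU z) N
      (fun z _ => hN z)
    exact ⟨G, fun z => let ⟨z', _, h⟩ := hG z (by simp); ⟨z', h⟩⟩

def clip (t : ℝ) : ℝ := max 0 (min 1 t)

theorem clip_cont : Continuous clip := by unfold clip; fun_prop
theorem clip_mem (t : ℝ) : 0 ≤ clip t ∧ clip t ≤ 1 :=
  ⟨le_max_left _ _, max_le zero_le_one (min_le_left _ _)⟩
theorem clip_eq {t : ℝ} (h0 : 0 ≤ t) (h1 : t ≤ 1) : clip t = t := by
  simp [clip, h0, h1]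

theorem dimBall (k : ℕ) (r : ℝ) : CovDimLE (Metric.closedBall (0 : EE k) r) k :=
  covDimLE_subtype.2 (dimOn_compact_euclidean (isCompact_closedBall _ _))

theorem CovDimLE.mono {Z : Type} [TopologicalSpace Z] {m n : ℕ} (h : CovDimLE Z m) (hmn : m ≤ n) :
    CovDimLE Z n := covDimLE_iff.2 ((covDimLE_iff.1 h).mono hmn)

def dirn {k : ℕ} (x : EE (k+1)) (hx : x ≠ 0) : Sph k :=
  ⟨‖x‖⁻¹ • x, by simp [norm_smul, inv_mul_cancel₀ (norm_ne_zero_iff.2 hx)]⟩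

theorem dirn_cont {k : ℕ} {α : Type} [TopologicalSpace α] {u : α → EE (k+1)} (hu : Continuous u)
    (h : ∀ a, u a ≠ 0) : Continuous fun a => dirn (u a) (h a) :=
  Continuous.subtype_mk (Continuous.smul ((hu.norm).inv₀ fun a => norm_ne_zero_iff.2 (h a)) hu) _

theorem dirn_smul {k : ℕ} (s : Sph k) {r : ℝ} (hr : 0 < r) (h : r • s.1 ≠ 0) :
    dirn (r • s.1) h = s := by
  apply Subtype.ext
  have hs : ‖s.1‖ = 1 := by simp
  simp only [dirn, norm_smul, hs, Real.norm_of_nonneg hr.le, smul_smul]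
  rw [mul_one, inv_mul_cancel₀ hr.ne', one_smul]

theorem conc {X : Type} [TopologicalSpace X] {n k : ℕ} (hX : IsAbsExtensorInDim n X) (hk : k < n)
    (g : C(Sph k, X)) (gj : ℕ → C(Sph k, X)) (ht : Filter.Tendsto gj Filter.atTop (𝓝 g))
    {U : Set X} (hU : IsOpen U) (hg : ∀ s, g s ∈ U) :
    ∀ᶠ j in Filter.atTop, ∃ h : C(ℝ × Sph k, X), (∀ s, h (0, s) = g s) ∧ (∀ s, h (1, s) = gj j s) ∧
      ∀ p, h p ∈ U := by
  let θ : C(OnePoint ℕ, ℝ) := OnePoint.continuousMapMkNat (fun j => (1/2:ℝ)^j) 0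
    (tendsto_pow_atTop_nhds_zero_of_lt_one (by norm_num) (by norm_num))
  let γ : C(OnePoint ℕ, C(Sph k, X)) := OnePoint.continuousMapMkNat gj g ht
  have hθ1 : ∀ j : ℕ, θ (j : OnePoint ℕ) = (1/2:ℝ)^j := fun j => rfl
  have hθ0 : θ OnePoint.infty = 0 := rfl
  have hγ1 : ∀ j : ℕ, γ (j : OnePoint ℕ) = gj j := fun j => rfl
  have hγ0 : γ OnePoint.infty = g := rfl
  have hinj : Function.Injective θ := by
    intro a b hab
    induction a using OnePoint.rec with
    | infty =>
      induction b using OnePoint.rec with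
      | infty => rfl
      | coe b => rw [hθ0, hθ1] at hab; exact absurd hab.symm (by positivity)
    | coe a =>
      induction b using OnePoint.rec with
      | infty => rw [hθ0, hθ1] at hab; exact absurd hab (by positivity)
      | coe b =>
        rw [hθ1, hθ1] at hab
        rw [pow_right_injective₀ (by norm_num) (by norm_num) hab]
  have hce : IsClosedEmbedding θ := θ.continuous.isClosedEmbedding hinj
  let e := hce.isEmbedding.toHomeomorph
  let Z : Type := Metric.closedBall (0 : EE (k+1)) 2
  let T : Set Z := {x | ‖x.1‖ - 1 ∈ range θ}
  have hnc : Continuous fun x : Z => ‖x.1‖ - 1 := by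
    have : Continuous fun x : Z => x.1 := continuous_subtype_val
    fun_prop
  have hT : IsClosed T := hce.isClosed_range.preimage hnc
  have hpos : ∀ o, 0 ≤ θ o := by
    intro o
    induction o using OnePoint.rec with
    | infty => exact hθ0.ge
    | coe a => rw [hθ1]; positivity
  have hne : ∀ x : T, x.1.1 ≠ 0 := by
    rintro ⟨x, o, ho⟩ h0
    have := hpos o
    change x.1 = 0 at h0
    rw [h0] at ho
    simp at ho
    linarith
  let φ : C(T, X) := ⟨fun x => γ (e.symm ⟨‖x.1.1‖ - 1, x.2⟩) (dirn x.1.1 (hne x)), by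
    have h1 : Continuous fun x : T => γ (e.symm ⟨‖x.1.1‖ - 1, x.2⟩) :=
      γ.continuous.comp (e.symm.continuous.comp
        (Continuous.subtype_mk (hnc.comp continuous_subtype_val) _))
    have h2 : Continuous fun x : T => dirn x.1.1 (hne x) :=
      dirn_cont (continuous_subtype_val.comp continuous_subtype_val) hne
    exact ContinuousEval.continuous_eval.comp (h1.prodMk h2)⟩
  obtain ⟨H, hH⟩ := hX Z ((dimBall (k+1) 2).mono hk) T hT φ
  have hmem : ∀ p : ℝ × Sph k, (1 + clip p.1) • p.2.1 ∈ Metric.closedBall (0 : EE (k+1)) 2 := by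
    intro p
    have := clip_mem p.1
    have hs : ‖p.2.1‖ = 1 := by simp
    rw [mem_closedBall_zero_iff, norm_smul, hs, Real.norm_of_nonneg (by linarith)]
    linarith
  let Hh : C(ℝ × Sph k, X) := H.comp ⟨fun p => ⟨(1 + clip p.1) • p.2.1, hmem p⟩, by
    refine Continuous.subtype_mk ?_ _
    have := clip_cont
    fun_prop⟩
  have hHθ : ∀ o s, θ o ≤ 1 → Hh (θ o, s) = γ o s := by
    intro o s ho
    have hs : ‖s.1‖ = 1 := by simp
    have hn : ‖(1 + clip (θ o)) • s.1‖ - 1 = θ o := by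
      rw [clip_eq (hpos o) ho, norm_smul, hs, Real.norm_of_nonneg (by linarith [hpos o])]; ring
    have hT' : (⟨(1 + clip (θ o)) • s.1, hmem (θ o, s)⟩ : Z) ∈ T := ⟨o, hn.symm⟩
    refine (hH ⟨_, hT'⟩).trans ?_
    have h1 : e.symm ⟨‖(1 + clip (θ o)) • s.1‖ - 1, hT'⟩ = o := by
      rw [Homeomorph.symm_apply_eq]
      apply Subtype.ext
      exact hn
    change γ (e.symm ⟨‖(1 + clip (θ o)) • s.1‖ - 1, hT'⟩) (dirn ((1 + clip (θ o)) • s.1) _) = _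
    rw [h1, dirn_smul s (by linarith [(clip_mem (θ o)).1])]
  have hev : ∀ᶠ t in 𝓝 (0:ℝ), ∀ s ∈ (univ : Set (Sph k)), Hh (t, s) ∈ U := by
    refine isCompact_univ.eventually_forall_of_forall_eventually fun s _ => ?_
    refine Hh.continuous.continuousAt (hU.mem_nhds ?_)
    have := hHθ OnePoint.infty s (by rw [hθ0]; norm_num)
    rw [hθ0] at this
    rw [this]; exact hg s
  obtain ⟨ε, hε, hb⟩ := Metric.eventually_nhds_iff_ball.1 hev
  have h2 : ∀ᶠ j : ℕ in Filter.atTop, (1/2:ℝ)^j < ε :=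
    (tendsto_pow_atTop_nhds_zero_of_lt_one (by norm_num) (by norm_num)).eventually (gt_mem_nhds hε)
  filter_upwards [h2] with j hj
  have hcc : Continuous fun p : ℝ × Sph k => ((1/2:ℝ)^j * clip p.1, p.2) := by
    have := clip_cont
    fun_prop
  refine ⟨Hh.comp ⟨_, hcc⟩, fun s => ?_, fun s => ?_, fun p => ?_⟩
  · have := hHθ OnePoint.infty s (by rw [hθ0]; norm_num)
    rw [hθ0] at this
    change Hh ((1/2:ℝ)^j * clip 0, s) = _
    rw [clip_eq le_rfl zero_le_one, mul_zero, this, hγ0]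
  · have := hHθ (j : OnePoint ℕ) s (by rw [hθ1]; exact pow_le_one₀ (by norm_num) (by norm_num))
    rw [hθ1] at this
    change Hh ((1/2:ℝ)^j * clip 1, s) = _
    rw [clip_eq zero_le_one le_rfl, mul_one, this, hγ1]
  · refine hb _ ?_ _ (mem_univ _)
    have := clip_mem p.1
    have h3 : (0:ℝ) < (1/2)^j := by positivity
    rw [Metric.mem_ball, Real.dist_0_eq_abs, abs_of_nonneg (mul_nonneg h3.le this.1)]
    nlinarith

theorem cone_ext {X : Type} [TopologicalSpace X] {k : ℕ} (h : C(ℝ × Sph k, X)) (D : C(EE (k+1), X))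
    (hD : ∀ s : Sph k, h (1, s) = D s.1) :
    ∃ G : C(EE (k+1), X), (∀ y, ‖y‖ ≤ 1/2 → G y = D ((2:ℝ) • y)) ∧
      ∀ y (hy : y ≠ 0), 1/2 ≤ ‖y‖ → G y = h (2 - 2 * ‖y‖, dirn y hy) := by
  classical
  let G : EE (k+1) → X := fun y => if hy : y = 0 then D 0 else
    if ‖y‖ ≤ 1/2 then D ((2:ℝ) • y) else h (2 - 2 * ‖y‖, dirn y hy)
  have h1 : ∀ y, ‖y‖ ≤ 1/2 → G y = D ((2:ℝ) • y) := by
    intro y hy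
    by_cases h0 : y = 0
    · simp [G, h0]
    · simp only [G, h0, dite_false, hy, if_true]
  have h2 : ∀ y (hy : y ≠ 0), 1/2 ≤ ‖y‖ → G y = h (2 - 2 * ‖y‖, dirn y hy) := by
    intro y hy hle
    rcases hle.eq_or_lt with he | hlt
    · rw [h1 y he.ge, ← he]
      have : (2:ℝ) - 2 * (1/2) = 1 := by norm_num
      rw [this, hD]
      congr 1
      simp only [dirn, ← he]; norm_num
    · simp only [G, hy, dite_false, not_le.2 hlt, if_false]
  have hc1 : ContinuousOn G {y | ‖y‖ ≤ 1/2} := by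
    have : ContinuousOn (fun y : EE (k+1) => D ((2:ℝ) • y)) {y | ‖y‖ ≤ 1/2} := by fun_prop
    exact this.congr fun y hy => h1 y hy
  have hc2 : ContinuousOn G {y | 1/2 ≤ ‖y‖} := by
    rw [continuousOn_iff_continuous_domRestrict]
    have hn : ∀ y : {y : EE (k+1) | 1/2 ≤ ‖y‖}, y.1 ≠ 0 := by
      rintro ⟨y, hy⟩ h0
      change y = 0 at h0
      have hy' : 1/2 ≤ ‖y‖ := hy
      rw [h0, norm_zero] at hy'; norm_num at hy'
    have : Continuous fun y : {y : EE (k+1) | 1/2 ≤ ‖y‖} => h (2 - 2 * ‖y.1‖, dirn y.1 (hn y)) := by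
      have := dirn_cont (u := fun y : {y : EE (k+1) | 1/2 ≤ ‖y‖} => y.1) continuous_subtype_val hn
      refine h.continuous.comp (Continuous.prodMk (by fun_prop) this)
    convert this using 1
    funext y
    exact h2 y.1 (hn y) y.2
  have hG : Continuous G := by
    rw [← continuousOn_univ]
    have hu : (univ : Set (EE (k+1))) = {y | ‖y‖ ≤ 1/2} ∪ {y | 1/2 ≤ ‖y‖} := by
      ext y; simpa using le_total ‖y‖ (1/2)
    rw [hu]
    exact ContinuousOn.union_of_isClosed hc1 hc2 (isClosed_le continuous_norm continuous_const)
      (isClosed_le continuous_const continuous_norm)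
  exact ⟨⟨G, hG⟩, h1, h2⟩

theorem sphNull_assemble {X : Type} [TopologicalSpace X] {n : ℕ} {F : Filter X} {S : Set X}
    (hS : S ∈ F) (h : ∀ k < n, ∃ S' ∈ F, ∀ g : C(Sph k, X), (∀ s, g s ∈ S') →
      ∃ G : C(EE (k + 1), X), (∀ s : Sph k, G s = g s) ∧ ∀ x, G x ∈ S) :
    ∃ S' ∈ F, SphNull n S' S := by
  choose! T hT h using h
  refine ⟨S ∩ ⋂ k : Fin n, T k, Filter.inter_mem hS (Filter.iInter_mem.2 fun k => hT k k.2),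
    inter_subset_left, fun k hk g hg => h k hk g fun s => ?_⟩
  exact mem_iInter.1 (hg s).2 ⟨k, hk⟩

theorem lcn_of_ae {X : Type} [TopologicalSpace X] [TopologicalSpace.MetrizableSpace X] {n : ℕ}
    (hX : IsAbsExtensorInDim n X) : LCn n X := by
  let := TopologicalSpace.metrizableSpaceMetric X
  intro x S hS
  refine sphNull_assemble hS fun k hk => ?_
  by_contra hcon
  push Not at hcon
  have hb : ∀ j : ℕ, Metric.ball x (1 / (j + 1 : ℝ)) ∈ 𝓝 x := fun j =>
    Metric.ball_mem_nhds _ (by positivity)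
  choose gj hgj hno using fun j : ℕ => hcon _ (hb j)
  have ht : Filter.Tendsto gj Filter.atTop (𝓝 (ContinuousMap.const _ x)) := by
    rw [ContinuousMap.tendsto_iff_tendstoUniformly, Metric.tendstoUniformly_iff]
    intro ε hε
    filter_upwards [(tendsto_one_div_add_atTop_nhds_zero_nat (𝕜 := ℝ)).eventually (gt_mem_nhds hε)]
      with j hj s
    rw [dist_comm]
    exact lt_trans (hgj j s) hj
  have := conc hX hk _ gj ht isOpen_interior (fun s => mem_interior_iff_mem_nhds.2 hS)
  obtain ⟨j, h, h0, h1, hU⟩ := this.exists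
  let h' : C(ℝ × Sph k, X) := h.comp ⟨fun p => (1 - p.1, p.2), by fun_prop⟩
  obtain ⟨G, hG1, hG2⟩ := cone_ext h' (ContinuousMap.const _ x) (fun s => by
    change h (1 - 1, s) = x
    rw [sub_self, h0]; rfl)
  obtain ⟨y, hy⟩ := hno j G fun s => by
    have hs : ‖s.1‖ = 1 := by simp
    have hs0 : s.1 ≠ 0 := by intro h; rw [h] at hs; simp at hs
    rw [hG2 s.1 hs0 (by rw [hs]; norm_num)]
    change h (1 - (2 - 2 * ‖s.1‖), _) = _
    have e1 : 1 - (2 - 2 * ‖s.1‖) = 1 := by rw [hs]; norm_num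
    rw [e1, h1]
    congr 1
    apply Subtype.ext; simp [dirn, hs]
  apply hy
  by_cases hle : ‖y‖ ≤ 1/2
  · rw [hG1 y hle]; exact mem_of_mem_nhds hS
  · have hy0 : y ≠ 0 := by rintro rfl; simp at hle
    rw [hG2 y hy0 (not_le.1 hle).le]
    exact interior_subset (hU _)

theorem zset_maps {Y : Type} [MetricSpace Y] {A : Set Y} (hA : IsZSet A) {ε : ℝ} (hε : 0 < ε) :
    ∃ α : C(Y, Y), (∀ y, dist (α y) y < ε) ∧ ∀ y, α y ∉ A := by
  obtain ⟨α, h1, h2⟩ := hA.2 (range fun y => Metric.ball y (ε/2)) ⟨by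
    rintro _ ⟨y, rfl⟩; exact Metric.isOpen_ball, by
    rw [sUnion_range, eq_univ_iff_forall]
    intro y; exact mem_iUnion.2 ⟨y, Metric.mem_ball_self (by linarith)⟩⟩
  refine ⟨α, fun y => ?_, fun y hy => ?_⟩
  · obtain ⟨_, ⟨c, rfl⟩, hc1, hc2⟩ := h1 y
    have := dist_triangle_right (α y) y c
    rw [Metric.mem_ball] at hc1 hc2
    change dist y c < _ at hc2
    linarith
  · exact (h2 ▸ (⟨⟨y, rfl⟩, hy⟩ : α y ∈ range α ∩ A) : α y ∈ (∅ : Set Y))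

theorem sphNull_diff_zset {Y : Type} [TopologicalSpace Y] [TopologicalSpace.MetrizableSpace Y] {n : ℕ}
    (hY : IsAbsExtensorInDim n Y) {A : Set Y} (hA : IsZSet A) (y : Y) {S : Set Y} (hS : S ∈ 𝓝 y) :
    ∃ S' ∈ 𝓝 y, SphNull n (S' \ A) (S \ A) := by
  let := TopologicalSpace.metrizableSpaceMetric Y
  obtain ⟨S', hS', hn⟩ := lcn_of_ae hY y (interior S) (interior_mem_nhds.2 hS)
  refine ⟨S', hS', sdiff_subset_sdiff_left (hn.1.trans interior_subset), fun k hk g hg => ?_⟩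
  obtain ⟨D, hD1, hD2⟩ := hn.2 k hk g fun s => (hg s).1
  choose α hα1 hα2 using fun j : ℕ => zset_maps hA (show (0:ℝ) < 1 / (j + 1) by positivity)
  have hU : IsOpen (interior S \ A) := isOpen_interior.sdiff hA.1
  have ht : Filter.Tendsto (fun j => (α j).comp g) Filter.atTop (𝓝 g) := by
    rw [ContinuousMap.tendsto_iff_tendstoUniformly, Metric.tendstoUniformly_iff]
    intro ε hε
    filter_upwards [(tendsto_one_div_add_atTop_nhds_zero_nat (𝕜 := ℝ)).eventually (gt_mem_nhds hε)]
      with j hj s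
    rw [dist_comm]
    exact lt_trans (hα1 j _) hj
  have h1 := conc hY hk g _ ht hU (fun s => ⟨hn.1 (hg s).1, (hg s).2⟩)
  have hK : IsCompact (D '' Metric.closedBall 0 1) := (isCompact_closedBall _ _).image D.continuous
  obtain ⟨δ, hδ, hthick⟩ := hK.exists_thickening_subset_open isOpen_interior
    (by rintro _ ⟨x, -, rfl⟩; exact hD2 x)
  have h2 := (tendsto_one_div_add_atTop_nhds_zero_nat (𝕜 := ℝ)).eventually (gt_mem_nhds hδ)
  obtain ⟨j, ⟨h, h0, h1, hU⟩, hj⟩ := (h1.and h2).exists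
  have hrad : ∀ s : Sph k, rad (k+1) s.1 = s.1 := fun s => rad_eq (by simp)
  let D' : C(EE (k+1), Y) := ((α j).comp D).comp ⟨_, rad_cont (k+1)⟩
  obtain ⟨G, hG1, hG2⟩ := cone_ext h D' (fun s => by
    change _ = α j (D (rad (k+1) s.1))
    rw [hrad, h1, hD1]; rfl)
  refine ⟨G, fun s => ?_, fun y => ?_⟩
  · have hs : ‖s.1‖ = 1 := by simp
    have hs0 : s.1 ≠ 0 := by intro h; rw [h] at hs; simp at hs
    rw [hG2 s.1 hs0 (by rw [hs]; norm_num)]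
    have e1 : (2 - 2 * ‖s.1‖) = 0 := by rw [hs]; norm_num
    rw [e1, h0]
    congr 1
    apply Subtype.ext; simp [dirn, hs]
  · by_cases hle : ‖y‖ ≤ 1/2
    · rw [hG1 y hle]
      refine ⟨interior_subset (hthick ?_), hα2 j _⟩
      rw [Metric.mem_thickening_iff]
      exact ⟨_, ⟨_, by simpa using rad_norm _, rfl⟩, (hα1 j _).trans hj⟩
    · have hy0 : y ≠ 0 := by rintro rfl; simp at hle
      rw [hG2 y hy0 (not_le.1 hle).le]
      exact ⟨interior_subset (hU _).1, (hU _).2⟩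

theorem SphNull.subtype {X : Type} [TopologicalSpace X] {n : ℕ} {S T X0 : Set X}
    (h : SphNull n S T) (hT : T ⊆ X0) :
    SphNull n ((↑) ⁻¹' S : Set X0) ((↑) ⁻¹' T) := by
  refine ⟨preimage_mono h.1, fun k hk g hg => ?_⟩
  obtain ⟨G, h1, h2⟩ := h.2 k hk ⟨fun s => (g s).1, by fun_prop⟩ hg
  exact ⟨⟨fun x => ⟨G x, hT (h2 x)⟩, by fun_prop⟩, fun s => Subtype.ext (h1 s), h2⟩

theorem LCn.isOpen {X : Type} [TopologicalSpace X] {n : ℕ} (h : LCn n X) {X0 : Set X}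
    (h0 : IsOpen X0) : LCn n X0 := by
  intro x S hS
  obtain ⟨T, hT, hTS⟩ := mem_nhds_subtype _ _ _ |>.1 hS
  obtain ⟨S', hS', hn⟩ := h x.1 (T ∩ X0) (Filter.inter_mem hT (h0.mem_nhds x.2))
  exact ⟨_, continuous_subtype_val.continuousAt hS', (hn.subtype inter_subset_right).mono Subset.rfl
    fun z hz => hTS hz.1⟩

theorem uvs_of_uv {X Y : Type} [TopologicalSpace X] [TopologicalSpace Y] {n : ℕ} {f : X → Y}
    (hf : IsUVMap n f) : UVS n f := by
  intro y S hS
  obtain ⟨T, hT, hTS⟩ := Filter.mem_comap.1 hS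
  obtain ⟨U, hUT, hU, hyU⟩ := mem_nhds_iff.1 hT
  obtain ⟨V, hV, hyV, hVU, hn⟩ := hf.2.2 y U hU hyU
  exact ⟨f ⁻¹' V, Filter.preimage_mem_comap (hV.mem_nhds hyV),
    (sphNull_of_incl hn).mono Subset.rfl ((preimage_mono hUT).trans hTS)⟩

theorem uvs_restrict_off {X Y : Type} [TopologicalSpace X] [TopologicalSpace Y] {n : ℕ} {f : X → Y}
    (hf : UVS n f) {A : Set Y} (hA : IsClosed A) {y : Y} (hy : y ∉ A) :
    UVSAt n (fun x : ↥((f ⁻¹' A)ᶜ) => f x) y := by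
  intro S hS
  obtain ⟨T, hT, hTS⟩ := Filter.mem_comap.1 hS
  obtain ⟨S', hS', hn⟩ := hf y (f ⁻¹' (T \ A)) (Filter.preimage_mem_comap
    (Filter.inter_mem hT (hA.isOpen_compl.mem_nhds hy)))
  obtain ⟨T', hT', hTS'⟩ := Filter.mem_comap.1 hS'
  refine ⟨(↑) ⁻¹' S', Filter.mem_comap.2 ⟨T', hT', fun z hz => hTS' hz⟩,
    (hn.subtype fun x hx => hx.2).mono Subset.rfl fun z hz => hTS hz.1⟩

theorem dense_restrict {X Y : Type} [TopologicalSpace X] [TopologicalSpace Y]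
    [TopologicalSpace.MetrizableSpace Y] {f : X → Y} (hd : DenseRange f) {A : Set Y}
    (hA : IsZSet A) : DenseRange (fun x : ↥((f ⁻¹' A)ᶜ) => f x) := by
  let := TopologicalSpace.metrizableSpaceMetric Y
  intro y
  rw [Metric.mem_closure_iff]
  intro ε hε
  obtain ⟨α, h1, h2⟩ := zset_maps hA (half_pos hε)
  have ho : IsOpen (Metric.ball (α y) (ε/2) \ A) := Metric.isOpen_ball.sdiff hA.1
  obtain ⟨x, hx⟩ := hd.exists_mem_open ho ⟨α y, Metric.mem_ball_self (half_pos hε), h2 y⟩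
  refine ⟨f x, ⟨⟨x, hx.2⟩, rfl⟩, ?_⟩
  have := dist_triangle_left y (f x) (α y)
  have h3 := hx.1
  rw [Metric.mem_ball, dist_comm] at h3
  linarith [h1 y]

theorem uvs_restrict {X Y : Type} [TopologicalSpace X] [TopologicalSpace Y]
    [TopologicalSpace.MetrizableSpace X] [TopologicalSpace.MetrizableSpace Y] {n : ℕ} {f : X → Y}
    (hX : IsAbsExtensorInDim n X) (hY : IsAbsExtensorInDim n Y) (hfc : Continuous f)
    (hd : DenseRange f) (hf : UVS n f) {A : Set Y} (hA : IsZSet A) :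
    UVS n (fun x : ↥((f ⁻¹' A)ᶜ) => f x) := by
  classical
  intro y S hS
  obtain ⟨T0, hT0, hTS0⟩ := Filter.mem_comap.1 hS
  obtain ⟨T, hTT, hTo, hyT⟩ := mem_nhds_iff.1 hT0
  have hT := hTo.mem_nhds hyT
  have hTS : (fun x : ↥((f ⁻¹' A)ᶜ) => f x) ⁻¹' T ⊆ S := (preimage_mono hTT).trans hTS0
  obtain ⟨V', hV', hn⟩ := sphNull_diff_zset hY hA y hT
  obtain ⟨V, hVV, hV, hyV⟩ := mem_nhds_iff.1 hV'
  replace hn := hn.mono (sdiff_subset_sdiff_left hVV) Subset.rfl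
  have hX0 : IsOpen ((f ⁻¹' A)ᶜ) := (hA.1.preimage hfc).isOpen_compl
  refine ⟨(fun x : ↥((f ⁻¹' A)ᶜ) => f x) ⁻¹' V, Filter.preimage_mem_comap (hV.mem_nhds hyV), ?_⟩
  have hVT : ∀ x : ↥((f ⁻¹' A)ᶜ), f x ∈ V → x ∈ S := fun x hx => hTS (hn.1 ⟨hx, x.2⟩).1
  refine ⟨hVT, fun k hk g hg => ?_⟩
  let Z : Type := Metric.closedBall (0 : EE (k+1)) 1
  have hZ : CovDimLE Z n := (dimBall (k+1) 1).mono hk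
  have hrm : ∀ x, rad (k+1) x ∈ Metric.closedBall (0 : EE (k+1)) 1 := fun x => by
    simpa using rad_norm x
  let radZ : C(EE (k+1), Z) := ⟨fun x => ⟨rad (k+1) x, hrm x⟩, Continuous.subtype_mk (rad_cont _) _⟩
  have hradZ : ∀ s : Sph k, radZ s.1 = ⟨s.1, by simp⟩ := fun s => Subtype.ext (rad_eq (by simp))
  let Csph : Set Z := {z | ‖z.1‖ = 1}
  have hzc : Continuous fun z : Z => ‖z.1‖ := by
    have : Continuous fun x : Z => x.1 := continuous_subtype_val
    fun_prop
  have hCs : IsClosed Csph := isClosed_eq hzc continuous_const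
  obtain ⟨G00, hG00⟩ := hX Z hZ Csph hCs ⟨fun z => (g ⟨z.1.1, mem_sphere_zero_iff_norm.2 z.2⟩).1, by
    have h1 : Continuous fun z : Csph => z.1.1 := continuous_subtype_val.comp continuous_subtype_val
    exact continuous_subtype_val.comp (g.continuous.comp (Continuous.subtype_mk h1 _))⟩
  let G0 : C(EE (k+1), X) := G00.comp radZ
  have hG0 : ∀ s : Sph k, G0 s.1 = (g s).1 := by
    intro s
    have hs : ‖s.1‖ = 1 := by simp
    change G00 (radZ s.1) = _
    rw [hradZ]
    exact hG00 ⟨⟨s.1, by simp⟩, hs⟩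
  have hW : IsOpen (f ⁻¹' (V \ A)) := (hV.sdiff hA.1).preimage hfc
  have hev : ∀ᶠ t in 𝓝 (0:ℝ), ∀ s ∈ (univ : Set (Sph k)), G0 ((1 - t) • s.1) ∈ f ⁻¹' (V \ A) := by
    refine isCompact_univ.eventually_forall_of_forall_eventually fun s _ => ?_
    have hc : Continuous fun p : ℝ × Sph k => G0 ((1 - p.1) • p.2.1) := by fun_prop
    refine hc.continuousAt (hW.mem_nhds ?_)
    simp only [sub_zero, one_smul]
    rw [hG0]; exact ⟨hg s, (g s).2⟩
  obtain ⟨ε, hε, hb⟩ := Metric.eventually_nhds_iff_ball.1 hev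
  have hcl : ∀ (t : ℝ) (s : Sph k), G0 ((1 - ε / 2 * clip t) • s.1) ∈ f ⁻¹' (V \ A) := by
    intro t s
    refine hb _ ?_ s (mem_univ _)
    have := clip_mem t
    rw [Metric.mem_ball, Real.dist_0_eq_abs, abs_of_nonneg (mul_nonneg (by linarith) this.1)]
    nlinarith
  let h0 : C(ℝ × Sph k, ↥((f ⁻¹' A)ᶜ)) := ⟨fun p => ⟨G0 ((1 - ε / 2 * clip p.1) • p.2.1),
    (hcl p.1 p.2).2⟩, by
      refine Continuous.subtype_mk ?_ _
      have := clip_cont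
      fun_prop⟩
  have h00 : ∀ s, h0 (0, s) = g s := by
    intro s
    apply Subtype.ext
    change G0 ((1 - ε / 2 * clip 0) • s.1) = _
    rw [clip_eq le_rfl zero_le_one, mul_zero, sub_zero, one_smul, hG0]
  have hfh : ∀ p, f (h0 p) ∈ V \ A := fun p => hcl p.1 p.2
  let fh : C(ℝ × Sph k, Y) := ⟨fun p => f (h0 p), by fun_prop⟩
  obtain ⟨D, hD1, hD2⟩ := hn.2 k hk ⟨fun s => fh (1, s), by fun_prop⟩ (fun s => hfh _)
  obtain ⟨Q, hQ1, hQ2⟩ := cone_ext fh D (fun s => (hD1 s).symm)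
  have hQT : ∀ z, Q z ∈ T \ A := by
    intro y
    by_cases hle : ‖y‖ ≤ 1/2
    · rw [hQ1 y hle]; exact hD2 _
    · have hy0 : y ≠ 0 := by rintro rfl; simp at hle
      rw [hQ2 y hy0 (not_le.1 hle).le]
      exact hn.1 (hfh _)
  let s0 : Sph k := ⟨EuclideanSpace.single 0 1, by simp⟩
  let GZ : Z → ↥((f ⁻¹' A)ᶜ) := fun z => if hz : z.1 = 0 then g s0 else
    h0 (2 - 2 * ‖z.1‖, dirn z.1 hz)
  have hGZ : ∀ (z : Z) (hz : z.1 ≠ 0), GZ z = h0 (2 - 2 * ‖z.1‖, dirn z.1 hz) := fun z hz => by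
    simp only [GZ, hz, dite_false]
  let O : Set Z := {z | 1/2 < ‖z.1‖}
  have hO0 : ∀ z ∈ O, z.1 ≠ 0 := by
    intro z hz h0
    have hz' : 1/2 < ‖z.1‖ := hz
    rw [h0, norm_zero] at hz'; norm_num at hz'
  have hGZc : ContinuousOn GZ O := by
    rw [continuousOn_iff_continuous_domRestrict]
    have hn : ∀ z : O, z.1.1 ≠ 0 := fun z => hO0 z.1 z.2
    have hzz : Continuous fun z : O => z.1.1 := continuous_subtype_val.comp continuous_subtype_val
    have : Continuous fun z : O => h0 (2 - 2 * ‖z.1.1‖, dirn z.1.1 (hn z)) :=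
      by
      have hnn : Continuous fun z : O => 2 - 2 * ‖z.1.1‖ :=
        continuous_const.sub (continuous_const.mul hzz.norm)
      exact h0.continuous.comp (hnn.prodMk (dirn_cont hzz hn))
    convert this using 1
    funext z
    exact hGZ z.1 (hn z)
  have hC1 : ∀ (z : Z) (hz : z ∈ Csph), GZ z = g ⟨z.1, mem_sphere_zero_iff_norm.2 hz⟩ := by
    intro z hz
    have hz' : ‖z.1‖ = 1 := hz
    have hz0 : z.1 ≠ 0 := by intro h; rw [h] at hz'; simp at hz'
    rw [hGZ z hz0]
    have e1 : (2 - 2 * ‖z.1‖) = 0 := by rw [hz']; norm_num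
    rw [e1, h00]
    congr 1
    apply Subtype.ext; simp [dirn, hz']
  obtain ⟨G, hG1, hG2⟩ := lift_map (Z := Z) hZ (f := fun x : ↥((f ⁻¹' A)ᶜ) => f x)
    (hfc.comp continuous_subtype_val) (Q := fun z => Q z.1) (C := Csph)
    (fun z _ => comap_neBot_of_dense (dense_restrict hd hA) _)
    (fun z _ => uvs_restrict_off hf hA.1 (hQT z.1).2)
    ((lcn_of_ae hX).isOpen hX0) (O := O) hCs (isOpen_lt continuous_const hzc)
    (fun z hz => by change 1/2 < ‖z.1‖; rw [show ‖z.1‖ = 1 from hz]; norm_num)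
    GZ hGZc (Q.continuous.comp continuous_subtype_val).continuousOn
    (fun z hz => by
      rw [hGZ z (hO0 z hz), hQ2 z.1 (hO0 z hz) (le_of_lt hz)]; rfl)
    (fun _ => T) (fun z _ => hTo.mem_nhds (hQT z.1).1) (fun _ => univ) (fun _ _ => Filter.univ_mem)
  · refine ⟨G.comp radZ, fun s => ?_, fun x => ?_⟩
    · have hs : ‖s.1‖ = 1 := by simp
      change G (radZ s.1) = _
      rw [hradZ]
      have h2 : (⟨s.1, by simp⟩ : Z) ∈ Csph := hs
      rw [hG1 h2, hC1 _ h2]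
    · change G (radZ x) ∈ S
      by_cases hx : radZ x ∈ Csph
      · rw [hG1 hx, hC1 _ hx]; exact hVT _ (hg _)
      · obtain ⟨_, _, _, h⟩ := hG2 _ hx
        exact hTS h

set_option linter.unusedSectionVars false
section adj
variable {X Y : Type} [TopologicalSpace X] [TopologicalSpace Y] {f : X → Y} {A : Set Y}

theorem adjBasic_eq (U : Set Y) : adjBasic f A U = adjMap f A ⁻¹' U := by
  ext p
  rcases p with x | a
  · exact ⟨fun h => h.1, fun h => ⟨h, x.2⟩⟩
  · exact ⟨fun h => h.1, fun h => ⟨h, a.2⟩⟩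

theorem adjMap_cont : Continuous (adjMap f A) := by
  refine continuous_def.2 fun U hU => ?_
  rw [← adjBasic_eq]
  exact TopologicalSpace.isOpen_generateFrom_of_mem (Or.inr ⟨U, hU, rfl⟩)

theorem adjInl_inj : Function.Injective (adjInl f A) := Sum.inl_injective

theorem adjMap_inl (x) : adjMap f A (adjInl f A x) = f x.1 := rfl
theorem adjMap_inr (a) : adjMap f A (adjInr f A a) = a.1 := rfl

theorem adjInl_open (hf : Continuous f) : IsOpenEmbedding (adjInl f A) := by
  refine IsOpenEmbedding.of_continuous_injective_isOpenMap ?_ adjInl_inj fun V hV =>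
    TopologicalSpace.isOpen_generateFrom_of_mem (Or.inl ⟨V, hV, rfl⟩)
  refine continuous_generateFrom_iff.2 ?_
  rintro S (⟨V, hV, rfl⟩ | ⟨U, hU, rfl⟩)
  · rwa [preimage_image_eq _ adjInl_inj]
  · rw [adjBasic_eq]
    exact hU.preimage (hf.comp continuous_subtype_val)

theorem adj_cases (p : AdjCarrier f A) : (∃ x, p = adjInl f A x) ∨ ∃ a, p = adjInr f A a := by
  rcases p with x | a
  · exact Or.inl ⟨x, rfl⟩
  · exact Or.inr ⟨a, rfl⟩

theorem range_adjInr : range (adjInr f A) = adjMap f A ⁻¹' A := by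
  ext p
  obtain ⟨x, rfl⟩ | ⟨a, rfl⟩ := adj_cases p
  · constructor
    · rintro ⟨a, ha⟩; cases ha
    · intro h; exact absurd h x.2
  · exact ⟨fun _ => a.2, fun _ => ⟨a, rfl⟩⟩

theorem range_adjInl : range (adjInl f A) = (adjMap f A ⁻¹' A)ᶜ := by
  ext p
  obtain ⟨x, rfl⟩ | ⟨a, rfl⟩ := adj_cases p
  · exact ⟨fun _ => x.2, fun _ => ⟨x, rfl⟩⟩
  · constructor
    · rintro ⟨a, ha⟩; cases ha
    · intro h; exact absurd a.2 h

theorem nhds_adjInr (a : A) : 𝓝 (adjInr f A a) = Filter.comap (adjMap f A) (𝓝 a.1) := by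
  apply le_antisymm
  · exact Filter.tendsto_iff_comap.1 (adjMap_cont.tendsto (adjInr f A a))
  · rw [TopologicalSpace.nhds_generateFrom]
    refine le_iInf₂ fun S hS => ?_
    obtain ⟨haS, (⟨V, hV, rfl⟩ | ⟨U, hU, rfl⟩)⟩ := hS
    · obtain ⟨x, _, hx⟩ := haS; cases hx
    · rw [adjBasic_eq] at haS ⊢
      rw [Filter.le_principal_iff]
      exact Filter.preimage_mem_comap (hU.mem_nhds haS)

theorem nhds_adj_mem {p : AdjCarrier f A} (hp : adjMap f A p ∈ A) :
    𝓝 p = Filter.comap (adjMap f A) (𝓝 (adjMap f A p)) := by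
  have : p ∈ range (adjInr f A) := by rw [range_adjInr]; exact hp
  obtain ⟨a, rfl⟩ := this
  exact nhds_adjInr a

theorem adjInr_closed (hA : IsClosed A) : IsClosedEmbedding (adjInr f A) := by
  have hc : Continuous (adjInr f A) := by
    rw [continuous_iff_continuousAt]
    intro a
    rw [ContinuousAt, nhds_adjInr, Filter.tendsto_comap_iff]
    exact continuous_subtype_val.continuousAt
  refine ⟨⟨IsInducing.of_comp hc adjMap_cont ?_, Sum.inr_injective⟩, ?_⟩
  · exact IsInducing.subtypeVal
  · rw [range_adjInr]; exact hA.preimage adjMap_cont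

open Classical in
def adjPi (f : X → Y) (A : Set Y) (x : X) : AdjCarrier f A :=
  if h : f x ∈ A then adjInr f A ⟨f x, h⟩ else adjInl f A ⟨x, h⟩

theorem adjPi_inl {x : X} (h : f x ∉ A) : adjPi f A x = adjInl f A ⟨x, h⟩ := by
  simp only [adjPi, h, dite_false]

theorem adjPi_inr {x : X} (h : f x ∈ A) : adjPi f A x = adjInr f A ⟨f x, h⟩ := by
  simp only [adjPi, h, dite_true]

theorem adjMap_pi (x : X) : adjMap f A (adjPi f A x) = f x := by
  by_cases h : f x ∈ A
  · rw [adjPi_inr h]; rfl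
  · rw [adjPi_inl h]; rfl

theorem adjPi_cont (hf : Continuous f) (hA : IsClosed A) : Continuous (adjPi f A) := by
  rw [continuous_iff_continuousAt]
  intro x
  by_cases h : f x ∈ A
  · rw [ContinuousAt, adjPi_inr h, nhds_adjInr, Filter.tendsto_comap_iff]
    have : adjMap f A ∘ adjPi f A = f := funext adjMap_pi
    rw [this]; exact hf.continuousAt
  · have ho : IsOpen ((f ⁻¹' A)ᶜ) := (hA.preimage hf).isOpen_compl
    refine ContinuousOn.continuousAt ?_ (ho.mem_nhds h)
    rw [continuousOn_iff_continuous_domRestrict]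
    convert (adjInl_open (A := A) hf).continuous using 1
    funext z
    exact adjPi_inl (f := f) (A := A) z.2

end adj

theorem exists_bdd_embedding (X : Type) [MetricSpace X] [CompleteSpace X] :
    ∃ k : X → BoundedContinuousFunction X ℝ, IsClosedEmbedding k ∧ ∀ x, ‖k x‖ ≤ 1 := by
  have hb : ∀ x y : X, ‖min 1 (dist x y)‖ ≤ 1 := by
    intro x y
    rw [Real.norm_of_nonneg (le_min zero_le_one dist_nonneg)]
    exact min_le_left _ _
  let k : X → BoundedContinuousFunction X ℝ := fun x =>
    BoundedContinuousFunction.ofNormedAddCommGroup (fun y => min 1 (dist x y)) (by fun_prop) 1 (hb x)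
  have hk : ∀ x y, k x y = min 1 (dist x y) := fun _ _ => rfl
  have h1 : ∀ x x', dist (k x) (k x') ≤ dist x x' := by
    intro x x'
    rw [BoundedContinuousFunction.dist_le dist_nonneg]
    intro y
    rw [hk, hk, Real.dist_eq]
    refine (abs_min_sub_min_le_max _ _ _ _).trans ?_
    simp only [sub_self, abs_zero]
    refine max_le dist_nonneg (abs_dist_sub_le x x' y)
  have h2 : ∀ x x', min 1 (dist x x') ≤ dist (k x) (k x') := by
    intro x x'
    have := BoundedContinuousFunction.dist_coe_le_dist (f := k x) (g := k x') x'
    rw [hk, hk, Real.dist_eq, dist_self] at this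
    simpa using (le_abs_self _).trans this
  refine ⟨k, ?_, fun x => ?_⟩
  · have hu : IsUniformInducing k := by
      rw [Metric.isUniformInducing_iff]
      refine ⟨(LipschitzWith.of_dist_le_mul (K := 1) (by simpa using h1)).uniformContinuous,
        fun δ hδ => ⟨min 1 δ, by positivity, fun {a b} hab => ?_⟩⟩
      have := (h2 a b).trans_lt hab
      rcases min_lt_iff.1 this with h | h
      · exact absurd (lt_min_iff.1 h).1 (lt_irrefl _)
      · exact (lt_min_iff.1 h).2
    exact hu.isUniformEmbedding.isClosedEmbedding
  · exact (BoundedContinuousFunction.norm_le zero_le_one).2 (hb x)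

theorem exists_zero_fun {Y : Type} [MetricSpace Y] {A : Set Y} (hA : IsClosed A) :
    ∃ τ : C(Y, ℝ), (∀ y, 0 ≤ τ y) ∧ ∀ y, τ y = 0 ↔ y ∈ A := by
  rcases A.eq_empty_or_nonempty with rfl | hne
  · exact ⟨ContinuousMap.const _ 1, fun _ => zero_le_one, fun y => by simp⟩
  · exact ⟨⟨fun y => Metric.infDist y A, Metric.continuous_infDist_pt A⟩, fun _ => Metric.infDist_nonneg,
      fun y => (hA.mem_iff_infDist_zero hne).symm⟩

theorem adj_polish {X Y : Type} [TopologicalSpace X] [TopologicalSpace Y] [PolishSpace X]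
    [PolishSpace Y] {f : X → Y} (hf : Continuous f) {A : Set Y} (hA : IsClosed A) :
    PolishSpace (AdjCarrier f A) := by
  classical
  let := TopologicalSpace.upgradeIsCompletelyMetrizable X
  let := TopologicalSpace.upgradeIsCompletelyMetrizable Y
  have h2 : SecondCountableTopology (AdjCarrier f A) := by
    let bX := TopologicalSpace.countableBasis ↥((f ⁻¹' A)ᶜ)
    let bY := TopologicalSpace.countableBasis Y
    have hbX : TopologicalSpace.IsTopologicalBasis bX := TopologicalSpace.isBasis_countableBasis _
    have hbY : TopologicalSpace.IsTopologicalBasis bY := TopologicalSpace.isBasis_countableBasis _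
    let 𝒢 : Set (Set (AdjCarrier f A)) := (fun V => adjInl f A '' V) '' bX ∪
      (fun U => adjMap f A ⁻¹' U) '' bY
    have h𝒢 : 𝒢.Countable := ((TopologicalSpace.countable_countableBasis _).image _).union
      ((TopologicalSpace.countable_countableBasis _).image _)
    refine ⟨𝒢, h𝒢, le_antisymm ?_ ?_⟩
    · refine le_generateFrom ?_
      rintro _ (⟨V, hV, rfl⟩ | ⟨U, hU, rfl⟩)
      · exact (adjInl_open hf).isOpenMap _ (hbX.isOpen hV)
      · exact (hbY.isOpen hU).preimage adjMap_cont
    · refine le_generateFrom ?_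
      rintro _ (⟨V, hV, rfl⟩ | ⟨U, hU, rfl⟩)
      · rw [hbX.open_eq_sUnion' hV, image_sUnion]
        refine TopologicalSpace.GenerateOpen.sUnion _ ?_
        rintro _ ⟨W, hW, rfl⟩
        exact TopologicalSpace.isOpen_generateFrom_of_mem (Or.inl ⟨W, hW.1, rfl⟩)
      · rw [adjBasic_eq, hbY.open_eq_sUnion' hU, preimage_sUnion, ← sUnion_image]
        refine TopologicalSpace.GenerateOpen.sUnion _ ?_
        rintro _ ⟨W, hW, rfl⟩
        exact TopologicalSpace.isOpen_generateFrom_of_mem (Or.inr ⟨W, hW.1, rfl⟩)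
  obtain ⟨k, hk, hk1⟩ := exists_bdd_embedding X
  obtain ⟨τ, hτ0, hτ⟩ := exists_zero_fun hA
  let κ : AdjCarrier f A → BoundedContinuousFunction X ℝ :=
    Sum.elim (fun x => τ (f x) • k x) (fun _ => 0)
  have hκl : ∀ x, κ (adjInl f A x) = τ (f x) • k x := fun _ => rfl
  have hκr : ∀ a, κ (adjInr f A a) = 0 := fun _ => rfl
  have hκn : ∀ p, ‖κ p‖ ≤ τ (adjMap f A p) := by
    intro p
    obtain ⟨x, rfl⟩ | ⟨a, rfl⟩ := adj_cases p
    · rw [hκl, adjMap_inl, norm_smul, Real.norm_of_nonneg (hτ0 _)]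
      exact mul_le_of_le_one_right (hτ0 _) (hk1 _)
    · rw [hκr, norm_zero]; exact hτ0 _
  have hκc : Continuous κ := by
    rw [continuous_iff_continuousAt]
    intro p
    obtain ⟨x, rfl⟩ | ⟨a, rfl⟩ := adj_cases p
    · rw [← (adjInl_open hf).continuousAt_iff]
      have : Continuous fun x : ↥((f ⁻¹' A)ᶜ) => τ (f x) • k x := by
        have := hk.continuous
        fun_prop
      exact this.continuousAt
    · rw [ContinuousAt, hκr]
      have h3 : Filter.Tendsto (fun p => τ (adjMap f A p)) (𝓝 (adjInr f A a)) (𝓝 0) := by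
        have : Continuous fun p => τ (adjMap f A p) := τ.continuous.comp adjMap_cont
        have h := this.tendsto (adjInr f A a)
        rwa [adjMap_inr, (hτ a.1).2 a.2] at h
      exact squeeze_zero_norm hκn h3
  let e : AdjCarrier f A → Y × BoundedContinuousFunction X ℝ := fun p => (adjMap f A p, κ p)
  have hec : Continuous e := adjMap_cont.prodMk hκc
  have hinj : Function.Injective e := by
    intro p q hpq
    have h1 : adjMap f A p = adjMap f A q := congrArg Prod.fst hpq
    have h2 : κ p = κ q := congrArg Prod.snd hpq
    obtain ⟨x, rfl⟩ | ⟨a, rfl⟩ := adj_cases p <;> obtain ⟨x', rfl⟩ | ⟨a', rfl⟩ := adj_cases q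
    · rw [hκl, hκl] at h2
      rw [adjMap_inl, adjMap_inl] at h1
      rw [h1] at h2
      have hne : τ (f x'.1) ≠ 0 := fun h => x'.2 ((hτ _).1 h)
      rw [Subtype.ext (hk.injective (smul_right_injective _ hne h2))]
    · rw [adjMap_inl, adjMap_inr] at h1
      exact absurd (show f x.1 ∈ A by rw [h1]; exact a'.2) x.2
    · rw [adjMap_inl, adjMap_inr] at h1
      exact absurd (show f x'.1 ∈ A by rw [← h1]; exact a.2) x'.2
    · rw [adjMap_inr, adjMap_inr] at h1
      rw [Subtype.ext h1]
  have hlim : ∀ (F : Filter (AdjCarrier f A)), F.NeBot → ∀ y v, Filter.Tendsto e F (𝓝 (y, v)) →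
      ∃ p, F ≤ 𝓝 p := by
    intro F hF y v hlim
    have h1 : Filter.Tendsto (adjMap f A) F (𝓝 y) := (continuous_fst.tendsto _).comp hlim
    have h2 : Filter.Tendsto κ F (𝓝 v) := (continuous_snd.tendsto _).comp hlim
    by_cases hy : y ∈ A
    · exact ⟨adjInr f A ⟨y, hy⟩, by rw [nhds_adjInr]; exact Filter.tendsto_iff_comap.1 h1⟩
    · have hev : range (adjInl f A) ∈ F := by
        rw [range_adjInl]
        exact h1 (hA.isOpen_compl.mem_nhds hy)
      let F' := Filter.comap (adjInl f A) F
      have hF' : F'.NeBot := Filter.NeBot.comap_of_range_mem hF hev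
      have hmap : Filter.map (adjInl f A) F' = F := Filter.map_comap_of_mem hev
      have h3 : Filter.Tendsto (fun x : ↥((f ⁻¹' A)ᶜ) => f x) F' (𝓝 y) := by
        have : Filter.Tendsto (adjInl f A) F' F := Filter.tendsto_comap
        exact h1.comp this
      have h4 : Filter.Tendsto (fun x : ↥((f ⁻¹' A)ᶜ) => τ (f x) • k x) F' (𝓝 v) := by
        have : Filter.Tendsto (adjInl f A) F' F := Filter.tendsto_comap
        exact h2.comp this
      have hne : τ y ≠ 0 := fun h => hy ((hτ _).1 h)
      have h5 : Filter.Tendsto (fun x : ↥((f ⁻¹' A)ᶜ) => k x) F' (𝓝 ((τ y)⁻¹ • v)) := by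
        have h6 : Filter.Tendsto (fun x : ↥((f ⁻¹' A)ᶜ) => (τ (f x))⁻¹) F' (𝓝 (τ y)⁻¹) :=
          ((τ.continuous.tendsto y).comp h3).inv₀ hne
        refine (h6.smul h4).congr fun x => ?_
        have hx : τ (f x.1) ≠ 0 := fun h => x.2 ((hτ _).1 h)
        rw [smul_smul, inv_mul_cancel₀ hx, one_smul]
      obtain ⟨x, hx⟩ : (τ y)⁻¹ • v ∈ range k :=
        hk.isClosed_range.mem_of_tendsto h5 (Filter.Eventually.of_forall fun z => ⟨z.1, rfl⟩)
      rw [← hx] at h5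
      have h6 : Filter.Tendsto (fun x : ↥((f ⁻¹' A)ᶜ) => x.1) F' (𝓝 x) :=
        hk.isEmbedding.tendsto_nhds_iff.2 h5
      have hfx : f x = y := tendsto_nhds_unique ((hf.tendsto x).comp h6) h3
      have hxA : x ∈ (f ⁻¹' A)ᶜ := by change f x ∉ A; rw [hfx]; exact hy
      refine ⟨adjInl f A ⟨x, hxA⟩, ?_⟩
      rw [← hmap]
      have h7 : F' ≤ 𝓝 ⟨x, hxA⟩ := by
        rw [nhds_subtype_eq_comap]
        exact Filter.tendsto_iff_comap.1 h6
      exact (Filter.map_mono h7).trans (adjInl_open hf).continuous.continuousAt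
  have hce : IsClosedEmbedding e := by
    refine IsClosedEmbedding.of_continuous_injective_isClosedMap hec hinj fun C hC => ?_
    refine isClosed_of_closure_subset fun yv hyv => ?_
    rw [mem_closure_iff_clusterPt, ClusterPt, ← Filter.map_principal] at hyv
    let F := Filter.comap e (𝓝 yv) ⊓ Filter.principal C
    have hF : F.NeBot := by
      rw [← Filter.map_neBot_iff e, Filter.push_pull']
      exact hyv
    have ht : Filter.Tendsto e F (𝓝 yv) := Filter.tendsto_comap.mono_left inf_le_left
    obtain ⟨p, hp⟩ := hlim F hF yv.1 yv.2 ht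
    have hpC : p ∈ C := by
      have : Filter.NeBot (𝓝 p ⊓ Filter.principal C) := hF.mono (le_inf hp inf_le_right)
      exact hC.closure_subset (mem_closure_iff_clusterPt.2 this)
    exact ⟨p, hpC, tendsto_nhds_unique ((hec.tendsto p).mono_left hp) ht⟩
  have := hce.IsCompletelyMetrizableSpace
  exact {}

theorem adj_dim {X Y : Type} [TopologicalSpace X] [TopologicalSpace Y] [PolishSpace X]
    [PolishSpace Y] {n : ℕ} {f : X → Y} (hf : Continuous f) {A : Set Y} (hA : IsClosed A)
    (hX : CovDimLE X n) (hY : CovDimLE Y n) : CovDimLE (AdjCarrier f A) n := by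
  have := adj_polish hf hA
  let := TopologicalSpace.metrizableSpaceMetric (AdjCarrier f A)
  have hcl := adjInr_closed (f := f) hA
  refine covDimLE_of_closed_add hcl.isClosed_range ?_ fun C hC hd => ?_
  · rw [covDimLE_range hcl.isEmbedding, covDimLE_subtype]
    exact hY.closed hA
  · have hCl : C ⊆ range (adjInl f A) := by
      rw [range_adjInl, ← range_adjInr]
      exact hd.subset_compl_right
    have h1 : adjInl f A '' (adjInl f A ⁻¹' C) = C := image_preimage_eq_of_subset hCl
    rw [← h1, dimOn_image (adjInl_open hf).isEmbedding,
      ← dimOn_image (e := ((↑) : ↥((f ⁻¹' A)ᶜ) → X)) IsEmbedding.subtypeVal]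
    have h2 : ((↑) : ↥((f ⁻¹' A)ᶜ) → X) '' (adjInl f A ⁻¹' C) = adjPi f A ⁻¹' C := by
      ext x
      constructor
      · rintro ⟨x, hx, rfl⟩
        change adjPi f A x.1 ∈ C
        rw [adjPi_inl (f := f) (A := A) x.2]; exact hx
      · intro hx
        by_cases h : f x ∈ A
        · change adjPi f A x ∈ C at hx
          rw [adjPi_inr h] at hx
          exact absurd ⟨_, rfl⟩ (disjoint_left.1 hd hx)
        · change adjPi f A x ∈ C at hx
          rw [adjPi_inl h] at hx
          exact ⟨⟨x, h⟩, hx, rfl⟩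
    rw [h2]
    exact hX.closed (hC.preimage (adjPi_cont hf hA))

theorem tendsto_of_dist_le {Z Y : Type} [PseudoMetricSpace Y] {l : Filter Z} {h Q : Z → Y}
    {τ : Z → ℝ} (c : ℝ) {y : Y} (hQ : Filter.Tendsto Q l (𝓝 y)) (hτ : Filter.Tendsto τ l (𝓝 0))
    (hle : ∀ᶠ z in l, dist (h z) (Q z) ≤ c * τ z) : Filter.Tendsto h l (𝓝 y) := by
  rw [tendsto_iff_dist_tendsto_zero] at hQ ⊢
  have h1 : Filter.Tendsto (fun z => c * τ z + dist (Q z) y) l (𝓝 0) := by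
    simpa using (hτ.const_mul c).add hQ
  refine squeeze_zero' (Filter.Eventually.of_forall fun _ => dist_nonneg) ?_ h1
  filter_upwards [hle] with z hz
  have := dist_triangle (h z) (Q z) y
  linarith

theorem adj_ae {X Y : Type} [TopologicalSpace X] [TopologicalSpace Y]
    [TopologicalSpace.MetrizableSpace X] [TopologicalSpace.MetrizableSpace Y] {n : ℕ} {f : X → Y}
    (hX : IsAbsExtensorInDim n X) (hY : IsAbsExtensorInDim n Y) (hfc : Continuous f)
    (hd : DenseRange f) (hf : UVS n f) {A : Set Y} (hA : IsZSet A) :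
    IsAbsExtensorInDim n (AdjCarrier f A) := by
  classical
  intro Z _ _ _ hZ B hB φ
  let := TopologicalSpace.metrizableSpaceMetric Y
  let := TopologicalSpace.metrizableSpaceMetric Z
  have h2Z : SecondCountableTopology Z := UniformSpace.secondCountable_of_separable Z
  have hX0 : IsOpen ((f ⁻¹' A)ᶜ) := (hA.1.preimage hfc).isOpen_compl
  let BA : Set Z := (↑) '' {b : B | adjMap f A (φ b) ∈ A}
  have hBA : IsClosed BA := hB.isClosedEmbedding_subtypeVal.isClosedMap _
    (hA.1.preimage (adjMap_cont.comp φ.continuous))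
  have hBAB : BA ⊆ B := by rintro _ ⟨b, _, rfl⟩; exact b.2
  have hBAm : ∀ (z : Z) (hz : z ∈ B), z ∈ BA ↔ adjMap f A (φ ⟨z, hz⟩) ∈ A := by
    intro z hz
    constructor
    · rintro ⟨b, hb, rfl⟩; exact hb
    · intro h; exact ⟨⟨z, hz⟩, h, rfl⟩
  let Ws : Set Z := BAᶜ
  have hWo : IsOpen Ws := hBA.isOpen_compl
  let W : Type := Ws
  have hW : CovDimLE W n := hZ.isOpen hWo
  let B' : Set W := {w | w.1 ∈ B}
  have hwc : Continuous fun w : W => w.1 := continuous_subtype_val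
  have hB' : IsClosed B' := hB.preimage hwc
  let e := (adjInl_open (A := A) hfc).isEmbedding.toHomeomorph
  have he : ∀ p : range (adjInl f A), adjInl f A (e.symm p) = p.1 := fun p =>
    congrArg Subtype.val (e.apply_symm_apply p)
  have hran : ∀ b : B', φ ⟨b.1.1, b.2⟩ ∈ range (adjInl f A) := by
    intro b
    rw [range_adjInl]
    exact fun h => b.1.2 ((hBAm _ b.2).2 h)
  let φ0 : C(B', ↥((f ⁻¹' A)ᶜ)) := ⟨fun b => e.symm ⟨φ ⟨b.1.1, b.2⟩, hran b⟩, by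
    refine e.symm.continuous.comp (Continuous.subtype_mk (φ.continuous.comp
      (Continuous.subtype_mk (hwc.comp continuous_subtype_val) _)) _)⟩
  have hφ0 : ∀ b : B', adjInl f A (φ0 b) = φ ⟨b.1.1, b.2⟩ := fun b => he _
  obtain ⟨G0, hG0⟩ := hX W hW B' hB' ⟨fun b => (φ0 b).1, continuous_subtype_val.comp φ0.continuous⟩
  obtain ⟨Q, hQ⟩ := hY Z hZ B hB ⟨fun b => adjMap f A (φ b), adjMap_cont.comp φ.continuous⟩
  obtain ⟨τ, hτ0, hτ⟩ := exists_zero_fun hBA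
  have hτW : ∀ w : W, 0 < τ w.1 := fun w =>
    lt_of_le_of_ne (hτ0 _) fun h => w.2 ((hτ _).1 h.symm)
  let N : Set W := {w | G0 w ∈ (f ⁻¹' A)ᶜ} ∩ {w | dist (f (G0 w)) (Q w.1) < τ w.1}
  have hN : IsOpen N := (hX0.preimage G0.continuous).inter
    (isOpen_lt ((hfc.comp G0.continuous).dist (Q.continuous.comp hwc)) (τ.continuous.comp hwc))
  have hB'N : B' ⊆ N := by
    intro w hw
    have h1 : G0 w = (φ0 ⟨w, hw⟩).1 := hG0 ⟨w, hw⟩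
    refine ⟨by change G0 w ∈ (f ⁻¹' A)ᶜ; rw [h1]; exact (φ0 ⟨w, hw⟩).2, ?_⟩
    have h2 : Q w.1 = adjMap f A (φ ⟨w.1, hw⟩) := hQ ⟨w.1, hw⟩
    have h3 : f (G0 w) = Q w.1 := by
      rw [h2, h1, ← hφ0 ⟨w, hw⟩, adjMap_inl]
    change dist (f (G0 w)) (Q w.1) < τ w.1
    rw [h3, dist_self]; exact hτW w
  obtain ⟨O, hO, hB'O, hON⟩ := normal_exists_closure_subset hB' hN hB'N
  let D : Set Z := ((↑) '' ((closure O)ᶜ : Set W))ᶜ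
  have hDc : IsClosed D := by
    refine IsOpen.isClosed_compl ?_
    exact hWo.isOpenMap_subtype_val _ isClosed_closure.isOpen_compl
  have hD1 : ∀ w : W, w.1 ∈ D → w ∈ closure O := by
    intro w hw
    by_contra h
    exact hw ⟨w, h, rfl⟩
  let q : Z → Y := fun z => if h : z ∈ Ws then f (G0 ⟨z, h⟩) else Q z
  have hqW : ∀ w : W, q w.1 = f (G0 w) := fun w => by
    have := w.2
    exact dif_pos w.2
  have hqB : ∀ z ∈ BA, q z = Q z := fun z hz => by
    have : z ∉ Ws := fun h => h hz
    simp only [q, this, dite_false]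
  have hqQ : ∀ z ∈ D, dist (q z) (Q z) ≤ 1 * τ z := by
    intro z hz
    by_cases h : z ∈ Ws
    · rw [hqW ⟨z, h⟩, one_mul]
      exact (hON (hD1 ⟨z, h⟩ hz)).2.le
    · rw [hqB z (not_not.1 h), dist_self, one_mul]; exact hτ0 z
  have hqc : ContinuousOn q D := by
    intro z hz
    by_cases h : z ∈ Ws
    · refine ContinuousAt.continuousWithinAt (ContinuousOn.continuousAt (s := Ws) ?_ (hWo.mem_nhds h))
      rw [continuousOn_iff_continuous_domRestrict]
      convert hfc.comp G0.continuous using 1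
      funext w; exact hqW w
    · have hzB := not_not.1 h
      rw [ContinuousWithinAt, hqB z hzB]
      refine tendsto_of_dist_le 1 (Q.continuous.continuousWithinAt)
        (?_ : Filter.Tendsto τ _ _) (eventually_mem_nhdsWithin.mono hqQ)
      have := (τ.continuous.continuousWithinAt (s := D) (x := z)).tendsto
      rwa [(hτ z).2 hzB] at this
  obtain ⟨Q1, hQ1⟩ := hY Z hZ D hDc ⟨fun z => q z.1, continuousOn_iff_continuous_domRestrict.1 hqc⟩
  have hQ1W : ∀ w ∈ closure O, Q1 w.1 = f (G0 w) := by
    intro w hw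
    have : w.1 ∈ D := by
      rintro ⟨w', hw', h⟩
      exact hw' (Subtype.ext h ▸ hw)
    exact (hQ1 ⟨w.1, this⟩).trans (hqW w)
  have hBAD : BA ⊆ D := by
    rintro z hz ⟨w, _, rfl⟩
    exact w.2 hz
  have hQ1B : ∀ z ∈ BA, Q1 z = Q z := fun z hz => (hQ1 ⟨z, hBAD hz⟩).trans (hqB z hz)
  have hdr := dense_restrict hd hA
  have hne : ∀ w : W, Nonempty ↥((f ⁻¹' A)ᶜ) := fun w => by
    have : Nonempty Y := ⟨Q w.1⟩
    exact hdr.nonempty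
  let G0' : W → ↥((f ⁻¹' A)ᶜ) := fun w => if h : G0 w ∈ (f ⁻¹' A)ᶜ then ⟨G0 w, h⟩ else
    Classical.choice (hne w)
  have hG0' : ∀ w ∈ N, (G0' w).1 = G0 w := fun w hw => by
    have := hw.1
    simp only [mem_ofPred_eq] at this
    simp only [G0', this, dite_true]
  have hOcl : O ⊆ N := subset_closure.trans hON
  obtain ⟨G, hG1, hG2⟩ := lift_map hW (f := fun x : ↥((f ⁻¹' A)ᶜ) => f x)
    (hfc.comp continuous_subtype_val) (Q := fun w : W => Q1 w.1) (C := B')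
    (fun w _ => comap_neBot_of_dense hdr _)
    (fun w _ => uvs_restrict hX hY hfc hd hf hA _)
    ((lcn_of_ae hX).isOpen hX0) hB' hO hB'O G0'
    (by
      rw [continuousOn_iff_continuous_domRestrict]
      have h1 : Continuous fun w : O => G0 w.1 := G0.continuous.comp continuous_subtype_val
      refine (h1.subtype_mk fun w => (hOcl w.2).1).congr fun w => ?_
      exact Subtype.ext (hG0' w.1 (hOcl w.2)).symm)
    (Q1.continuous.comp hwc).continuousOn
    (fun w hw => by rw [hG0' w (hOcl hw), hQ1W w (subset_closure hw)])
    (fun w => Metric.ball (Q1 w.1) (τ w.1)) (fun w _ => Metric.ball_mem_nhds _ (hτW w))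
    (fun w => {w' : W | τ w.1 / 2 < τ w'.1} ∩ {w' : W | dist (Q1 w'.1) (Q1 w.1) < τ w.1})
    (fun w _ => by
      refine IsOpen.mem_nhds ((isOpen_lt continuous_const (τ.continuous.comp hwc)).inter
        (isOpen_lt ((Q1.continuous.comp hwc).dist continuous_const) continuous_const)) ⟨?_, ?_⟩
      · change τ w.1 / 2 < τ w.1
        linarith [hτW w]
      · change dist (Q1 w.1) (Q1 w.1) < τ w.1
        rw [dist_self]; exact hτW w)
  have hGB : ∀ w (hw : w ∈ B'), G w = φ0 ⟨w, hw⟩ := by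
    intro w hw
    rw [hG1 hw]
    apply Subtype.ext
    rw [hG0' w (hB'N hw)]
    exact hG0 ⟨w, hw⟩
  have hdist : ∀ w : W, dist (f (G w)) (Q1 w.1) ≤ 4 * τ w.1 := by
    intro w
    by_cases hw : w ∈ B'
    · have h1 : f (G w) = Q1 w.1 := by
        rw [hG1 hw, hG0' w (hB'N hw), hQ1W w (subset_closure (hB'O hw))]
      rw [h1, dist_self]
      linarith [hτW w]
    · obtain ⟨w', hw', ⟨h1, h2⟩, h3⟩ := hG2 w hw
      have h1 : τ w'.1 / 2 < τ w.1 := h1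
      have h2 : dist (Q1 w.1) (Q1 w'.1) < τ w'.1 := h2
      have h3 : dist (f (G w)) (Q1 w'.1) < τ w'.1 := h3
      have := dist_triangle_right (f (G w)) (Q1 w.1) (Q1 w'.1)
      linarith
  let g : Z → AdjCarrier f A := fun z => if h : z ∈ Ws then adjInl f A (G ⟨z, h⟩) else
    φ ⟨z, hBAB (not_not.1 h)⟩
  have hgW : ∀ w : W, g w.1 = adjInl f A (G w) := fun w => by
    have := w.2
    exact dif_pos w.2
  have hgB : ∀ z (hz : z ∈ BA), g z = φ ⟨z, hBAB hz⟩ := fun z hz => by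
    have : z ∉ Ws := fun h => h hz
    simp only [g, this, dite_false]
  have hgQ : ∀ z, dist (adjMap f A (g z)) (Q1 z) ≤ 4 * τ z := by
    intro z
    by_cases h : z ∈ Ws
    · rw [hgW ⟨z, h⟩, adjMap_inl]; exact hdist ⟨z, h⟩
    · have hz := not_not.1 h
      have h2 : Q z = adjMap f A (φ ⟨z, hBAB hz⟩) := hQ ⟨z, hBAB hz⟩
      rw [hgB z hz, hQ1B z hz, h2, dist_self]
      linarith [hτ0 z]
  have hgc : Continuous g := by
    rw [continuous_iff_continuousAt]
    intro z
    by_cases h : z ∈ Ws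
    · refine ContinuousOn.continuousAt (s := Ws) ?_ (hWo.mem_nhds h)
      rw [continuousOn_iff_continuous_domRestrict]
      convert (adjInl_open (A := A) hfc).continuous.comp G.continuous using 1
      funext w; exact hgW w
    · have hz := not_not.1 h
      have hzA : adjMap f A (g z) ∈ A := by
        rw [hgB z hz]; exact (hBAm z (hBAB hz)).1 hz
      rw [ContinuousAt, nhds_adj_mem hzA, Filter.tendsto_comap_iff]
      have h1 : adjMap f A (g z) = Q1 z := by
        have := hgQ z
        rw [(hτ z).2 hz, mul_zero] at this
        exact dist_le_zero.1 this
      rw [h1]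
      refine tendsto_of_dist_le 4 (Q1.continuous.tendsto z) (?_ : Filter.Tendsto τ _ _)
        (Filter.Eventually.of_forall hgQ)
      have := τ.continuous.tendsto z
      rwa [(hτ z).2 hz] at this
  refine ⟨⟨g, hgc⟩, fun b => ?_⟩
  change g b.1 = φ b
  by_cases h : b.1 ∈ Ws
  · rw [hgW ⟨b.1, h⟩, hGB ⟨b.1, h⟩ b.2, hφ0]
  · exact hgB b.1 (not_not.1 h)

theorem SphNull.image {X X' : Type} [TopologicalSpace X] [TopologicalSpace X'] {n : ℕ}
    {S T : Set X} {e : X → X'} (he : IsEmbedding e) (h : SphNull n S T) :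
    SphNull n (e '' S) (e '' T) := by
  refine ⟨image_mono h.1, fun k hk g hg => ?_⟩
  choose g' hg' using hg
  have hgg : e ∘ g' = g := funext fun s => (hg' s).2
  obtain ⟨G, h1, h2⟩ := h.2 k hk ⟨g', he.continuous_iff.2 (by rw [hgg]; exact g.continuous)⟩
    fun s => (hg' s).1
  exact ⟨⟨e ∘ G, he.continuous.comp G.continuous⟩, fun s => (congrArg e (h1 s)).trans (hg' s).2,
    fun x => ⟨_, h2 x, rfl⟩⟩

theorem SphNull.preim {X X' : Type} [TopologicalSpace X] [TopologicalSpace X'] {n : ℕ}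
    {S T : Set X'} {e : X → X'} (he : IsEmbedding e) (h : SphNull n S T) (hT : T ⊆ range e) :
    SphNull n (e ⁻¹' S) (e ⁻¹' T) := by
  refine ⟨preimage_mono h.1, fun k hk g hg => ?_⟩
  obtain ⟨G, h1, h2⟩ := h.2 k hk ⟨e ∘ g, he.continuous.comp g.continuous⟩ hg
  choose G' hG' using fun x => hT (h2 x)
  have hgg : e ∘ G' = G := funext hG'
  refine ⟨⟨G', he.continuous_iff.2 (by rw [hgg]; exact G.continuous)⟩,
    fun s => he.injective ((hG' _).trans (h1 s)), fun x => ?_⟩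
  change e (G' x) ∈ T
  rw [hG']; exact h2 x

section adj2
variable {X Y : Type} [TopologicalSpace X] [TopologicalSpace Y]
  [TopologicalSpace.MetrizableSpace X] [TopologicalSpace.MetrizableSpace Y] {n : ℕ} {f : X → Y}

theorem comap_adjInl (A : Set Y) (a : A) : Filter.comap (adjInl f A) (𝓝 (adjInr f A a)) =
    Filter.comap (fun x : ↥((f ⁻¹' A)ᶜ) => f x) (𝓝 a.1) := by
  rw [nhds_adjInr, Filter.comap_comap]; rfl

theorem adjInl_dense (hd : DenseRange f) {A : Set Y} (hA : IsZSet A) :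
    DenseRange (adjInl f A) := by
  intro p
  obtain ⟨x, rfl⟩ | ⟨a, rfl⟩ := adj_cases p
  · exact subset_closure ⟨x, rfl⟩
  · rw [mem_closure_iff_comap_neBot]
    have := comap_neBot_of_dense (dense_restrict hd hA) a.1
    rw [← comap_adjInl] at this
    rw [Filter.comap_neBot_iff] at this ⊢
    intro t ht
    obtain ⟨x, hx⟩ := this t ht
    exact ⟨⟨_, ⟨x, rfl⟩⟩, hx⟩

theorem adjInl_uvs (hX : IsAbsExtensorInDim n X) (hY : IsAbsExtensorInDim n Y) (hfc : Continuous f)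
    (hd : DenseRange f) (hf : UVS n f) {A : Set Y} (hA : IsZSet A) : UVS n (adjInl f A) := by
  intro p
  obtain ⟨x, rfl⟩ | ⟨a, rfl⟩ := adj_cases p
  · have hlc := (lcn_of_ae hX).isOpen (hA.1.preimage hfc).isOpen_compl x
    rw [UVSAt, ← (adjInl_open hfc).isInducing.nhds_eq_comap]
    exact hlc
  · rw [UVSAt, comap_adjInl]
    exact uvs_restrict hX hY hfc hd hf hA a.1

theorem adj_push (hX : IsAbsExtensorInDim n X) (hY : IsAbsExtensorInDim n Y) (hfc : Continuous f)
    (hd : DenseRange f) (hf : UVS n f) {A : Set Y} (hA : IsZSet A) {Z : Type} [TopologicalSpace Z]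
    [TopologicalSpace.MetrizableSpace Z] (hZ : CovDimLE Z n) (h : C(Z, AdjCarrier f A))
    (𝒰 : Set (Set (AdjCarrier f A))) (h𝒰 : IsOpenCover 𝒰) :
    ∃ G : C(Z, ↥((f ⁻¹' A)ᶜ)), UClose 𝒰 (fun z => adjInl f A (G z)) h := by
  have h1 : ∀ z, ∃ u ∈ 𝒰, h z ∈ u := fun z => by
    have : h z ∈ ⋃₀ 𝒰 := by rw [h𝒰.2]; trivial
    exact this
  choose u hu hzu using h1
  obtain ⟨G, hG⟩ := lift_map' hZ (adjInl_open hfc).continuous (adjInl_dense hd hA)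
    (adjInl_uvs hX hY hfc hd hf hA) ((lcn_of_ae hX).isOpen (hA.1.preimage hfc).isOpen_compl)
    h h.continuous u (fun z => (h𝒰.1 _ (hu z)).mem_nhds (hzu z)) (fun z => h ⁻¹' (u z))
    (fun z => h.continuous.continuousAt ((h𝒰.1 _ (hu z)).mem_nhds (hzu z)))
  exact ⟨G, fun z => let ⟨z', ha, hb⟩ := hG z; ⟨u z', hu z', hb, ha⟩⟩

theorem adj_zset (hX : IsAbsExtensorInDim n X)
    (hY : IsAbsExtensorInDim n Y) (hfc : Continuous f)
    (hd : DenseRange f) (hf : UVS n f) {A : Set Y} (hA : IsZSet A)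
    [TopologicalSpace.MetrizableSpace (AdjCarrier f A)] (hZ : CovDimLE (AdjCarrier f A) n) :
    IsZSet (range (adjInr f A)) := by
  refine ⟨(adjInr_closed hA.1).isClosed_range, fun 𝒰 h𝒰 => ?_⟩
  obtain ⟨G, hG⟩ := adj_push hX hY hfc hd hf hA hZ (ContinuousMap.id _) 𝒰 h𝒰
  refine ⟨⟨fun z => adjInl f A (G z), (adjInl_open hfc).continuous.comp G.continuous⟩, hG, ?_⟩
  rw [range_adjInr]
  refine eq_empty_of_forall_notMem ?_
  rintro _ ⟨⟨z, rfl⟩, hz⟩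
  exact (G z).2 hz

theorem adj_uv (hX : IsAbsExtensorInDim n X)
    (hY : IsAbsExtensorInDim n Y) (hfc : Continuous f)
    (hd : DenseRange f) (hf : UVS n f) {A : Set Y} (hA : IsZSet A)
    [TopologicalSpace.MetrizableSpace (AdjCarrier f A)] :
    IsUVMap n (adjMap f A) := by
  have huv : UVS n (adjMap f A) := by
    intro y
    by_cases hy : y ∈ A
    · rw [UVSAt, ← nhds_adjInr ⟨y, hy⟩]
      exact lcn_of_ae (adj_ae hX hY hfc hd hf hA) _
    · intro S hS
      obtain ⟨T, hT, hTS⟩ := Filter.mem_comap.1 hS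
      obtain ⟨S', hS', hn⟩ := uvs_restrict_off hf hA.1 hy _ (Filter.preimage_mem_comap hT)
      obtain ⟨T', hT', hTS'⟩ := Filter.mem_comap.1 hS'
      refine ⟨adjMap f A ⁻¹' (T' \ A), Filter.preimage_mem_comap
        (Filter.inter_mem hT' (hA.1.isOpen_compl.mem_nhds hy)),
        (hn.image (adjInl_open (A := A) hfc).isEmbedding).mono ?_ ?_⟩
      · intro p hp
        obtain ⟨x, rfl⟩ | ⟨a, rfl⟩ := adj_cases p
        · exact ⟨x, hTS' hp.1, rfl⟩
        · exact absurd a.2 hp.2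
      · rintro _ ⟨x, hx, rfl⟩
        exact hTS hx
  refine ⟨adjMap_cont, ?_, fun y U hU hy => ?_⟩
  · refine (dense_restrict hd hA).mono ?_
    rintro _ ⟨x, rfl⟩
    exact ⟨adjInl f A x, rfl⟩
  · obtain ⟨S', hS', hn⟩ := huv y _ (Filter.preimage_mem_comap (hU.mem_nhds hy))
    obtain ⟨T', hT', hTS'⟩ := Filter.mem_comap.1 hS'
    obtain ⟨V, hV, hVo, hyV⟩ := mem_nhds_iff.1 hT'
    exact ⟨V ∩ U, hVo.inter hU, ⟨hyV, hy⟩, inter_subset_right,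
      incl_of_sphNull (hn.mono (fun p hp => hTS' (hV hp.1)) Subset.rfl)⟩
end adj2

def trp {Z D X : Type} (r : Z → D → Prop) (p : Set D × Set X) : Set Z × Set X :=
  ({z | ∃ d ∈ p.1, r z d}, p.2)

theorem RR.transfer {Z D X : Type} [TopologicalSpace X] {n : ℕ} {P P' : Set (Set D × Set X)}
    (h : RR n P P') (r : Z → D → Prop) (hr : ∀ z d d', r z d → r z d' → d = d') :
    RR n (trp r '' P) (trp r '' P') := by
  classical
  intro F hne hF z hz
  choose! s hs1 hs2 using hF
  obtain ⟨p0, hp0⟩ := hne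
  have hd : ∀ w, (∀ p ∈ F, w ∈ p.1) → ∃ d, r w d ∧ ∀ p ∈ F, d ∈ (s p).1 := by
    intro w hw
    have key : ∀ p ∈ F, ∃ d ∈ (s p).1, r w d := fun p hp => by
      have := hw p hp
      rw [← hs2 p hp] at this
      exact this
    obtain ⟨d, hd, hrd⟩ := key p0 hp0
    refine ⟨d, hrd, fun p hp => ?_⟩
    obtain ⟨d', hd', hrd'⟩ := key p hp
    rwa [hr w d d' hrd hrd']
  obtain ⟨d, hrd, hd1⟩ := hd z hz
  obtain ⟨q, hq, hq1, hq2⟩ := h (F.image s) ⟨_, Finset.mem_image_of_mem _ hp0⟩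
    (fun p hp => by obtain ⟨p', hp', rfl⟩ := Finset.mem_image.1 hp; exact hs1 _ hp') d
    (fun p hp => by obtain ⟨p', hp', rfl⟩ := Finset.mem_image.1 hp; exact hd1 _ hp')
  refine ⟨trp r q, ⟨q, hq, rfl⟩, fun w hw => ?_, hq2.mono ?_ Subset.rfl⟩
  · obtain ⟨d', hrd', hd'⟩ := hd w (fun p hp => mem_iInter₂.1 hw p hp)
    refine ⟨d', hq1 (mem_iInter₂.2 fun p hp => ?_), hrd'⟩
    obtain ⟨p', hp', rfl⟩ := Finset.mem_image.1 hp; exact hd' _ hp'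
  · refine iUnion₂_subset fun p hp => ?_
    have : p.2 = (s p).2 := by
      conv_lhs => rw [← hs2 p hp]
      rfl
    rw [this]
    exact subset_iUnion₂_of_subset (s p) (Finset.mem_image_of_mem _ hp) Subset.rfl

theorem RR.refine_up {Z X : Type} [TopologicalSpace X] {n : ℕ} {P : ℕ → Set (Set Z × Set X)}
    (h : ∀ i < n, RR n (P i) (P (i + 1))) (k i : ℕ) (hk : i + k ≤ n) {p : Set Z × Set X}
    (hp : p ∈ P i) {z : Z} (hz : z ∈ p.1) : ∃ q ∈ P (i + k), p.1 ⊆ q.1 ∧ p.2 ⊆ q.2 := by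
  induction k with
  | zero => exact ⟨p, hp, Subset.rfl, Subset.rfl⟩
  | succ k ih =>
    obtain ⟨q, hq, h1, h2⟩ := ih (by omega)
    obtain ⟨q', hq', h3, h4⟩ := h (i + k) (by omega) {q} (by simp) (by simpa using hq) z
      (by simpa using h1 hz)
    simp only [Finset.mem_singleton, iInter_iInter_eq_left, iUnion_iUnion_eq_left] at h3 h4
    exact ⟨q', hq', h1.trans h3, h2.trans h4.1⟩

def mixP {Z X : Type} (P1 P2 : Set (Set Z × Set X)) (M : Set Z) : Set (Set Z × Set X) :=
  P1 ∪ (fun c => (c.1 \ M, c.2)) '' P2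

theorem mix {Z X : Type} [TopologicalSpace X] {n : ℕ} {P1 P2 : ℕ → Set (Set Z × Set X)}
    (h1 : ∀ i < n, RR n (P1 i) (P1 (i + 1))) (h2 : ∀ i < n, RR n (P2 i) (P2 (i + 1))) (M : Set Z)
    (hdom : ∀ p ∈ P1 n, ∃ c ∈ P2 0, p.1 ⊆ c.1 ∧ p.2 ⊆ c.2) :
    ∀ i < n, RR n (mixP (P1 i) (P2 i) M) (mixP (P1 (i + 1)) (P2 (i + 1)) M) := by
  classical
  intro i hi F hne hF z hz
  by_cases hall : ∀ p ∈ F, p ∈ P1 i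
  · obtain ⟨q, hq, h3⟩ := h1 i hi F hne hall z hz
    exact ⟨q, Or.inl hq, h3⟩
  push Not at hall
  obtain ⟨p0, hp0, hp0'⟩ := hall
  have hp0M : p0.1 ⊆ Mᶜ := by
    rcases hF p0 hp0 with h | ⟨c, hc, rfl⟩
    · exact absurd h hp0'
    · exact fun x hx => hx.2
  have key : ∀ p ∈ F, ∃ c ∈ P2 i, p.1 ⊆ c.1 ∧ p.2 ⊆ c.2 := by
    intro p hp
    rcases hF p hp with h | ⟨c, hc, rfl⟩
    · obtain ⟨q, hq, ha, hb⟩ := RR.refine_up h1 (n - i) i (by omega) h (hz p hp)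
      rw [show i + (n - i) = n by omega] at hq
      obtain ⟨c, hc, ha', hb'⟩ := hdom q hq
      obtain ⟨c', hc', ha'', hb''⟩ := RR.refine_up h2 i 0 (by omega) hc (ha' (ha (hz p hp)))
      rw [zero_add] at hc'
      exact ⟨c', hc', ha.trans (ha'.trans ha''), hb.trans (hb'.trans hb'')⟩
    · exact ⟨c, hc, sdiff_subset, Subset.rfl⟩
  choose! s hs1 hs2 hs3 using key
  obtain ⟨q, hq, hq1, hq2⟩ := h2 i hi (F.image s) ⟨_, Finset.mem_image_of_mem _ hp0⟩
    (fun p hp => by obtain ⟨p', hp', rfl⟩ := Finset.mem_image.1 hp; exact hs1 _ hp') z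
    (fun p hp => by obtain ⟨p', hp', rfl⟩ := Finset.mem_image.1 hp; exact hs2 _ hp' (hz _ hp'))
  refine ⟨(q.1 \ M, q.2), Or.inr ⟨q, hq, rfl⟩, fun w hw => ⟨hq1 (mem_iInter₂.2 fun p hp => ?_),
    hp0M (mem_iInter₂.1 hw p0 hp0)⟩, hq2.mono ?_ Subset.rfl⟩
  · obtain ⟨p', hp', rfl⟩ := Finset.mem_image.1 hp
    exact hs2 _ hp' (mem_iInter₂.1 hw p' hp')
  · exact iUnion₂_subset fun p hp =>
      subset_iUnion₂_of_subset (s p) (Finset.mem_image_of_mem _ hp) (hs3 p hp)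

/-- fibres over small neighbourhoods of `p` have diameter at most `κ` -/
def KG {Z P : Type} [MetricSpace Z] [TopologicalSpace P] (κ : ℝ) (g : Z → P) (p : P) : Prop :=
  ∃ O, IsOpen O ∧ p ∈ O ∧ ∀ z z', g z ∈ O → g z' ∈ O → dist z z' ≤ κ

theorem kg_of_closed {Z P : Type} [MetricSpace Z] [TopologicalSpace P] {κ : ℝ} (hκ : 0 < κ)
    {g : Z → P} (hg : IsClosedEmbedding g) (p : P) : KG κ g p := by
  by_cases hp : p ∈ range g
  · obtain ⟨z0, rfl⟩ := hp
    obtain ⟨O, hO, hO'⟩ := hg.isInducing.isOpen_iff.1 (Metric.isOpen_ball (x := z0) (ε := κ / 2))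
    refine ⟨O, hO, ?_, fun z z' hz hz' => ?_⟩
    · change z0 ∈ g ⁻¹' O
      rw [hO']; exact Metric.mem_ball_self (half_pos hκ)
    · change z ∈ g ⁻¹' O at hz
      change z' ∈ g ⁻¹' O at hz'
      rw [hO', Metric.mem_ball] at hz hz'
      have := dist_triangle_right z z' z0
      linarith
  · exact ⟨(range g)ᶜ, hg.isClosed_range.isOpen_compl, hp, fun z _ hz => absurd ⟨z, rfl⟩ hz⟩

theorem closed_of_kg {Z P : Type} [MetricSpace Z] [CompleteSpace Z] [TopologicalSpace P]
    [T2Space P] {g : Z → P} (hg : Continuous g) (h : ∀ κ > 0, ∀ p, KG κ g p) :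
    IsClosedEmbedding g := by
  have hinj : Function.Injective g := by
    intro z z' hzz
    refine dist_le_zero.1 (le_of_forall_gt_imp_ge_of_dense fun κ hκ => ?_)
    obtain ⟨O, hO, hp, hO'⟩ := h κ hκ (g z)
    exact hO' z z' hp (hzz ▸ hp)
  refine IsClosedEmbedding.of_continuous_injective_isClosedMap hg hinj fun C hC => ?_
  refine isClosed_of_closure_subset fun p hp => ?_
  let l : Filter Z := Filter.comap g (𝓝 p) ⊓ Filter.principal C
  have hl : l.NeBot := by
    refine Filter.inf_principal_neBot_iff.2 fun U hU => ?_
    obtain ⟨V, hV, hVU⟩ := Filter.mem_comap.1 hU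
    obtain ⟨_, hb, ⟨z, hz, rfl⟩⟩ := mem_closure_iff_nhds.1 hp V hV
    exact ⟨z, hVU hb, hz⟩
  have hc : Cauchy l := by
    refine Metric.cauchy_iff.2 ⟨hl, fun ε hε => ?_⟩
    obtain ⟨O, hO, hpO, hO'⟩ := h (ε / 2) (half_pos hε) p
    refine ⟨g ⁻¹' O, Filter.mem_inf_of_left (Filter.preimage_mem_comap (hO.mem_nhds hpO)),
      fun z hz z' hz' => ?_⟩
    have := hO' z z' hz hz'
    linarith
  obtain ⟨z, hz⟩ := CompleteSpace.complete hc
  have hzC : z ∈ C := by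
    rw [← hC.closure_eq, mem_closure_iff_clusterPt]
    exact hl.mono (le_inf hz inf_le_right)
  have h1 : Filter.Tendsto g l (𝓝 p) := Filter.tendsto_comap.mono_left inf_le_left
  have h2 : Filter.Tendsto g l (𝓝 (g z)) := (hg.tendsto z).mono_left hz
  exact ⟨z, hzC, tendsto_nhds_unique h2 h1⟩

theorem IsOpenCover.mem {Y : Type} [TopologicalSpace Y] {𝒰 : Set (Set Y)} (h : IsOpenCover 𝒰)
    (y : Y) : ∃ u ∈ 𝒰, y ∈ u := h.2.ge (mem_univ y)

theorem good_at_A {X' Y Z : Type} [TopologicalSpace X'] [TopologicalSpace Y]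
    [TopologicalSpace.MetrizableSpace Y] [MetricSpace Z] {n : ℕ} (hZ : CovDimLE Z n) {F : X' → Y}
    (hF : Continuous F) (hd : DenseRange F) (hUV : UVS n F) (hLC : LCn n X') {A : Set Y}
    (hA : IsClosed A) (hAr : ∀ a ∈ A, ∃ p, F p = a ∧ 𝓝 p = Filter.comap F (𝓝 a)) (h : C(Z, X'))
    (hq : ∀ 𝒰, IsOpenCover 𝒰 → ∃ q : C(Z, Y), IsClosedEmbedding q ∧ UClose 𝒰 q (F ∘ h))
    {𝒰' : Set (Set X')} (h𝒰' : IsOpenCover 𝒰') {κ : ℝ} (hκ : 0 < κ) :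
    ∃ G : C(Z, X'), UClose 𝒰' G h ∧ ∀ y ∈ A, KG κ (F ∘ G) y := by
  classical
  let := TopologicalSpace.metrizableSpaceMetric Y
  obtain ⟨ψ, hψ⟩ : ∃ ψ : C(Z, Y), ∀ z, ψ z = F (h z) := ⟨⟨F ∘ h, hF.comp h.continuous⟩, fun _ => rfl⟩
  have hV : ∀ a : A, ∃ V, IsOpen V ∧ a.1 ∈ V ∧ ∃ u ∈ 𝒰', F ⁻¹' V ⊆ u := by
    intro a
    obtain ⟨p, hp, hnp⟩ := hAr a a.2
    obtain ⟨u, hu, hpu⟩ := h𝒰'.mem p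
    have := (h𝒰'.1 u hu).mem_nhds hpu
    rw [hnp] at this
    obtain ⟨T, hT, hTu⟩ := Filter.mem_comap.1 this
    obtain ⟨V, h1, h2, h3⟩ := mem_nhds_iff.1 hT
    exact ⟨V, h2, h3, u, hu, (preimage_mono h1).trans hTu⟩
  choose V hVo haV hVu using hV
  obtain ⟨lam, hl0, hl1, -⟩ := exists_continuous_zero_one_of_isClosed hA
    (isOpen_iUnion hVo).isClosed_compl (disjoint_compl_right_iff_subset.2 fun a ha =>
      mem_iUnion.2 ⟨⟨a, ha⟩, haV ⟨a, ha⟩⟩)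
  have hlc := lam.continuous
  let 𝒱 : Set (Set Y) := {v | IsOpen v ∧ (v ⊆ {y | lam y < 1/4} ∨ v ⊆ {y | 1/8 < lam y}) ∧
    ((∃ u ∈ 𝒰', F ⁻¹' v ⊆ u) ∨ v ⊆ {y | 3/4 < lam y})}
  have h𝒱 : ∀ y, ∃ v ∈ 𝒱, y ∈ v := by
    intro y
    have a1 : ∃ v, IsOpen v ∧ y ∈ v ∧ (v ⊆ {y | lam y < 1/4} ∨ v ⊆ {y | 1/8 < lam y}) := by
      by_cases hy : lam y < 1/4
      · exact ⟨_, isOpen_lt hlc continuous_const, hy, Or.inl Subset.rfl⟩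
      · refine ⟨_, isOpen_lt continuous_const hlc, ?_, Or.inr Subset.rfl⟩
        change 1/8 < lam y
        linarith
    have a2 : ∃ v, IsOpen v ∧ y ∈ v ∧ ((∃ u ∈ 𝒰', F ⁻¹' v ⊆ u) ∨ v ⊆ {y | 3/4 < lam y}) := by
      by_cases hy : y ∈ ⋃ a, V a
      · obtain ⟨a, ha⟩ := mem_iUnion.1 hy
        exact ⟨V a, hVo a, ha, Or.inl (hVu a)⟩
      · refine ⟨_, isOpen_lt continuous_const hlc, ?_, Or.inr Subset.rfl⟩
        have : lam y = 1 := hl1 hy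
        change 3/4 < lam y
        rw [this]; norm_num
    obtain ⟨v1, b1, b2, b3⟩ := a1
    obtain ⟨v2, c1, c2, c3⟩ := a2
    refine ⟨v1 ∩ v2, ⟨b1.inter c1, ?_, ?_⟩, b2, c2⟩
    · exact b3.imp (inter_subset_left.trans ·) (inter_subset_left.trans ·)
    · exact c3.imp (fun ⟨u, hu, h⟩ => ⟨u, hu, (preimage_mono inter_subset_right).trans h⟩)
        (inter_subset_right.trans ·)
  -- coarse chain
  have hcn : FNice n (fun y => Filter.comap F (𝓝 y)) := by
    refine ⟨fun y S hS => ?_, fun y => hUV y⟩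
    obtain ⟨T, hT, hTS⟩ := Filter.mem_comap.1 hS
    filter_upwards [eventually_mem_nhds_iff.2 hT] with y' hy'
    exact Filter.mem_comap.2 ⟨T, hy', hTS⟩
  obtain ⟨Pc, hPcn, hPcg, hPcR⟩ := hcn.chain (P' := {p | IsOpen p.1 ∧
    (∀ y ∈ p.1, p.2 ∈ Filter.comap F (𝓝 y)) ∧ ∃ v ∈ 𝒱, p.1 ⊆ v ∧ p.2 ⊆ F ⁻¹' v}) (by
      refine ⟨fun p hp => ⟨hp.1, hp.2.1⟩, fun y => ?_⟩
      obtain ⟨v, hv, hy⟩ := h𝒱 y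
      exact ⟨(v, F ⁻¹' v), ⟨hv.1, fun y' hy' => Filter.preimage_mem_comap (hv.1.mem_nhds hy'), v, hv,
        Subset.rfl, Subset.rfl⟩, hy⟩)
  let 𝒰0 : Set (Set Y) := {u | IsOpen u ∧ ∃ c ∈ Pc 0, u ⊆ c.1 ∧ F ⁻¹' u ⊆ c.2}
  have h𝒰0 : IsOpenCover 𝒰0 := by
    refine ⟨fun u hu => hu.1, eq_univ_of_forall fun y => ?_⟩
    obtain ⟨c, hc, hy⟩ := (hPcg 0).2 y
    obtain ⟨T, hT, hTS⟩ := Filter.mem_comap.1 (((hPcg 0).1 c hc).2 y hy)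
    obtain ⟨V, h1, h2, h3⟩ := mem_nhds_iff.1 hT
    exact ⟨V ∩ c.1, ⟨h2.inter ((hPcg 0).1 c hc).1, c, hc, inter_subset_right,
      (preimage_mono (inter_subset_left.trans h1)).trans hTS⟩, h3, hy⟩
  obtain ⟨q, hqe, hqu⟩ := hq 𝒰0 h𝒰0
  obtain ⟨𝒱s, h𝒱s, hstar⟩ := star_cover {Γ : Set Y | IsOpen Γ ∧ ∀ z z', q z ∈ Γ → q z' ∈ Γ →
    dist z z' ≤ κ} ⟨fun Γ hΓ => hΓ.1, eq_univ_of_forall fun y =>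
      let ⟨O, h1, h2, h3⟩ := kg_of_closed hκ hqe y; ⟨O, ⟨h1, h3⟩, h2⟩⟩
  have hlψ : Continuous fun z => lam (ψ z) := hlc.comp ψ.continuous
  let E : Set Z := {z | lam (ψ z) ≠ 1/2}
  have hE : IsOpen E := isOpen_ne_fun hlψ continuous_const
  let D : Type := E
  have hv : Continuous fun d : D => d.1 := continuous_subtype_val
  let 𝒮 : D → Filter X' := fun d => if lam (ψ d.1) < 1/2 then Filter.comap F (𝓝 (q d.1)) else
    𝓝 (h d.1)
  have h𝒮1 : ∀ d : D, lam (ψ d.1) < 1/2 → 𝒮 d = Filter.comap F (𝓝 (q d.1)) := fun d hd =>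
    if_pos hd
  have h𝒮2 : ∀ d : D, 1/2 < lam (ψ d.1) → 𝒮 d = 𝓝 (h d.1) := fun d hd =>
    if_neg (not_lt.2 hd.le)
  have hDc : ∀ d : D, lam (ψ d.1) < 1/2 ∨ 1/2 < lam (ψ d.1) := fun d => lt_or_gt_of_ne d.2
  have ho1 : IsOpen {d : D | lam (ψ d.1) < 1/2} := isOpen_lt (hlψ.comp hv) continuous_const
  have ho2 : IsOpen {d : D | 1/2 < lam (ψ d.1)} := isOpen_lt continuous_const (hlψ.comp hv)
  have hqc : Continuous fun d : D => q d.1 := q.continuous.comp hv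
  have hhc : Continuous fun d : D => h d.1 := h.continuous.comp hv
  have hψc : Continuous fun d : D => ψ d.1 := ψ.continuous.comp hv
  have hfn : FNice n 𝒮 := by
    constructor
    · intro d S hS
      rcases hDc d with hd' | hd'
      · rw [h𝒮1 d hd'] at hS
        obtain ⟨T, hT, hTS⟩ := Filter.mem_comap.1 hS
        filter_upwards [ho1.mem_nhds hd', hqc.continuousAt.eventually
          (eventually_mem_nhds_iff.2 hT)] with d' h1 h2
        rw [h𝒮1 d' h1]
        exact Filter.mem_comap.2 ⟨T, h2, hTS⟩
      · rw [h𝒮2 d hd'] at hS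
        filter_upwards [ho2.mem_nhds hd', hhc.continuousAt.eventually
          (eventually_mem_nhds_iff.2 hS)] with d' h1 h2
        rwa [h𝒮2 d' h1]
    · intro d
      rcases hDc d with hd' | hd'
      · rw [h𝒮1 d hd']; exact hUV _
      · rw [h𝒮2 d hd']; exact hLC _
  have hnb : ∀ d, (𝒮 d).NeBot := by
    intro d
    rcases hDc d with hd' | hd'
    · rw [h𝒮1 d hd']; exact comap_neBot_of_dense hd _
    · rw [h𝒮2 d hd']; infer_instance
  obtain ⟨Pf, hPfn, hPfg, hPfR⟩ := hfn.chain (P' := {p | IsOpen p.1 ∧ (∀ d ∈ p.1, p.2 ∈ 𝒮 d) ∧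
    (∃ u ∈ 𝒰0, (∀ d ∈ p.1, ψ d.1 ∈ u) ∧ p.2 ⊆ F ⁻¹' u) ∧
    ∀ d ∈ p.1, (lam (ψ d.1) < 1/2 → ∃ v ∈ 𝒱s, q d.1 ∈ v ∧ p.2 ⊆ F ⁻¹' v) ∧
      (1/2 < lam (ψ d.1) → ∃ u ∈ 𝒰', h d.1 ∈ u ∧ p.2 ⊆ u)}) (by
      refine ⟨fun p hp => ⟨hp.1, hp.2.1⟩, fun d => ?_⟩
      rcases hDc d with hd' | hd'
      · obtain ⟨u, hu, h1, h2⟩ := hqu d.1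
        obtain ⟨v, hv, h3⟩ := h𝒱s.mem (q d.1)
        have hvo := h𝒱s.1 v hv
        refine ⟨({d | lam (ψ d.1) < 1/2} ∩ ((fun d : D => ψ d.1) ⁻¹' u ∩ (fun d : D => q d.1) ⁻¹' (u ∩ v)),
          F ⁻¹' (u ∩ v)), ⟨ho1.inter ((hu.1.preimage hψc).inter ((hu.1.inter hvo).preimage hqc)),
          fun d' h' => ?_, ⟨u, hu, fun d' h' => h'.2.1, preimage_mono inter_subset_left⟩,
          fun d' h' => ⟨fun _ => ⟨v, hv, h'.2.2.2, preimage_mono inter_subset_right⟩, fun h'' => ?_⟩⟩,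
          hd', ?_, h1, h3⟩
        · rw [h𝒮1 d' h'.1]
          exact Filter.preimage_mem_comap ((hu.1.inter hvo).mem_nhds h'.2.2)
        · exact absurd h'.1 (not_lt.2 h''.le)
        · change ψ d.1 ∈ u
          rw [hψ]; exact h2
      · obtain ⟨u, hu, h1⟩ := h𝒰0.mem (ψ d.1)
        obtain ⟨v, hv, h3⟩ := h𝒰'.mem (h d.1)
        have hvo := h𝒰'.1 v hv
        refine ⟨({d | 1/2 < lam (ψ d.1)} ∩ ((fun d : D => ψ d.1) ⁻¹' u ∩ (fun d : D => h d.1) ⁻¹' v),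
          F ⁻¹' u ∩ v), ⟨ho2.inter ((hu.1.preimage hψc).inter (hvo.preimage hhc)),
          fun d' h' => ?_, ⟨u, hu, fun d' h' => h'.2.1, inter_subset_left⟩,
          fun d' h' => ⟨fun h'' => ?_, fun _ => ⟨v, hv, h'.2.2, inter_subset_right⟩⟩⟩,
          hd', h1, h3⟩
        · rw [h𝒮2 d' h'.1]
          refine Filter.inter_mem ?_ (hvo.mem_nhds h'.2.2)
          have := h'.2.1
          change ψ d'.1 ∈ u at this
          rw [hψ] at this
          exact hF.continuousAt (hu.1.mem_nhds this)
        · exact absurd h'.1 (not_lt.2 h''.le))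
  let r1 : Z → D → Prop := fun z d => d.1 = z
  let r2 : Z → Y → Prop := fun z y => y = ψ z
  let M : Set Z := {z | lam (ψ z) ≤ 1/4} ∪ {z | 3/4 ≤ lam (ψ z)}
  have hM : IsClosed M := (isClosed_le hlψ continuous_const).union (isClosed_le continuous_const hlψ)
  obtain ⟨G, hG⟩ := skeletal hZ (fun i => mixP (trp r1 '' Pf i) (trp r2 '' Pc i) M) (by
      rintro _ (⟨p, hp, rfl⟩ | ⟨_, ⟨p, hp, rfl⟩, rfl⟩)
      · have : (trp r1 p).1 = (fun d : D => d.1) '' p.1 := by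
          ext z; rfl
        rw [this]
        exact hE.isOpenMap_subtype_val _ ((hPfg 0).1 p hp).1
      · have : (trp r2 p).1 = ψ ⁻¹' p.1 := by
          ext z
          exact ⟨fun ⟨y, hy, h⟩ => by rw [mem_preimage, ← (h : y = ψ z)]; exact hy,
            fun h => ⟨_, h, rfl⟩⟩
        change IsOpen ((trp r2 p).1 \ M)
        rw [this]
        exact (((hPcg 0).1 p hp).1.preimage ψ.continuous).sdiff hM) (by
      intro z
      by_cases hz : z ∈ E
      · obtain ⟨p, hp, hpz⟩ := (hPfg 0).2 ⟨z, hz⟩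
        exact ⟨_, Or.inl ⟨p, hp, rfl⟩, ⟨_, hpz, rfl⟩,
          (hnb _).nonempty_of_mem (((hPfg 0).1 p hp).2 _ hpz)⟩
      · obtain ⟨p, hp, hpz⟩ := (hPcg 0).2 (ψ z)
        have hz' : lam (ψ z) = 1/2 := not_not.1 hz
        refine ⟨_, Or.inr ⟨_, ⟨p, hp, rfl⟩, rfl⟩, ⟨⟨_, hpz, rfl⟩, ?_⟩,
          (comap_neBot_of_dense hd _).nonempty_of_mem (((hPcg 0).1 p hp).2 _ hpz)⟩
        rintro (h' | h')
        · have h' : lam (ψ z) ≤ 1/4 := h'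
          rw [hz'] at h'; norm_num at h'
        · have h' : 3/4 ≤ lam (ψ z) := h'
          rw [hz'] at h'; norm_num at h')
    (mix (fun i hi => (hPfR i hi).transfer r1 fun z d d' h1 h2 => Subtype.ext (h1.trans h2.symm))
      (fun i hi => (hPcR i hi).transfer r2 fun z d d' h1 h2 => h1.trans h2.symm) M (by
      rintro _ ⟨p, hp, rfl⟩
      rw [hPfn] at hp
      obtain ⟨-, -, ⟨u, ⟨hu, c, hc, hc1, hc2⟩, h1, h2⟩, -⟩ := hp
      refine ⟨_, ⟨c, hc, rfl⟩, ?_, h2.trans hc2⟩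
      rintro z ⟨d, hd, rfl⟩
      exact ⟨_, hc1 (h1 d hd), rfl⟩))
  have key1 : ∀ z, ∃ v ∈ 𝒱, F (G z) ∈ v ∧ ψ z ∈ v := by
    intro z
    have : ∃ c ∈ Pc n, ψ z ∈ c.1 ∧ G z ∈ c.2 := by
      obtain ⟨_, (⟨p, hp, rfl⟩ | ⟨_, ⟨p, hp, rfl⟩, rfl⟩), hz, hGz⟩ := hG z
      · rw [hPfn] at hp
        obtain ⟨-, -, ⟨u, ⟨hu, c, hc, hc1, hc2⟩, h1, h2⟩, -⟩ := hp
        obtain ⟨d, hd, rfl⟩ := hz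
        obtain ⟨c', hc', h3, h4⟩ := RR.refine_up hPcR n 0 (by omega) hc (hc1 (h1 d hd))
        rw [zero_add] at hc'
        exact ⟨c', hc', h3 (hc1 (h1 d hd)), h4 (hc2 (h2 hGz))⟩
      · obtain ⟨⟨y, hy, hyz⟩, -⟩ := hz
        have hyz : y = ψ z := hyz
        subst hyz
        exact ⟨p, hp, hy, hGz⟩
    obtain ⟨c, hc, h1, h2⟩ := this
    rw [hPcn] at hc
    obtain ⟨-, -, v, hv, h3, h4⟩ := hc
    exact ⟨v, hv, h4 h2, h3 h1⟩
  have key2 : ∀ z ∈ M, (lam (ψ z) < 1/2 → ∃ v ∈ 𝒱s, q z ∈ v ∧ F (G z) ∈ v) ∧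
      (1/2 < lam (ψ z) → ∃ u ∈ 𝒰', h z ∈ u ∧ G z ∈ u) := by
    intro z hzM
    obtain ⟨_, (⟨p, hp, rfl⟩ | ⟨_, ⟨p, hp, rfl⟩, rfl⟩), hz, hGz⟩ := hG z
    · rw [hPfn] at hp
      obtain ⟨-, -, -, h1⟩ := hp
      obtain ⟨d, hd, rfl⟩ := hz
      obtain ⟨h1, h2⟩ := h1 d hd
      exact ⟨fun h' => let ⟨v, hv, a, b⟩ := h1 h'; ⟨v, hv, a, b hGz⟩,
        fun h' => let ⟨v, hv, a, b⟩ := h2 h'; ⟨v, hv, a, b hGz⟩⟩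
    · exact absurd hzM hz.2
  refine ⟨G, fun z => ?_, fun y hy => ?_⟩
  · obtain ⟨v, ⟨-, -, hv⟩, h1, h2⟩ := key1 z
    rcases hv with ⟨u, hu, hvu⟩ | hv
    · rw [hψ] at h2
      exact ⟨u, hu, hvu h1, hvu h2⟩
    · have h3 : 3/4 < lam (ψ z) := hv h2
      obtain ⟨u, hu, a, b⟩ := (key2 z (Or.inr h3.le)).2 (by linarith)
      exact ⟨u, hu, b, a⟩
  · obtain ⟨O, hO, hyO, Γ, hΓ, hyΓ, hst⟩ := hstar y
    have hl : lam y = 0 := hl0 hy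
    have hz : ∀ z, F (G z) ∈ O ∩ {y | lam y < 1/8} → q z ∈ Γ := by
      intro z hz
      obtain ⟨v, ⟨-, hv, -⟩, h1, h2⟩ := key1 z
      have h3 : lam (F (G z)) < 1/8 := hz.2
      have h4 : lam (ψ z) < 1/4 := by
        rcases hv with hv | hv
        · exact hv h2
        · have h5 : 1/8 < lam (F (G z)) := hv h1
          linarith
      obtain ⟨w, hw, a, b⟩ := (key2 z (Or.inl h4.le)).1 (by linarith)
      exact hst w hw ⟨_, b, hz.1⟩ a
    refine ⟨O ∩ {y | lam y < 1/8}, hO.inter (isOpen_lt hlc continuous_const), ⟨hyO, ?_⟩,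
      fun z z' h1 h2 => hΓ.2 z z' (hz z h1) (hz z' h2)⟩
    change lam y < 1/8
    rw [hl]; norm_num

def Cl {P : Type} (𝒱 : Set (Set P)) (p p' : P) : Prop := ∃ v ∈ 𝒱, p ∈ v ∧ p' ∈ v

theorem Cl.symm {P : Type} {𝒱 : Set (Set P)} {p p' : P} (h : Cl 𝒱 p p') : Cl 𝒱 p' p :=
  let ⟨v, hv, a, b⟩ := h; ⟨v, hv, b, a⟩

theorem cover_inter {P : Type} [TopologicalSpace P] {𝒰 𝒱 : Set (Set P)} (h1 : IsOpenCover 𝒰)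
    (h2 : IsOpenCover 𝒱) : ∃ 𝒲 : Set (Set P), IsOpenCover 𝒲 ∧ ∀ p p', Cl 𝒲 p p' →
      Cl 𝒰 p p' ∧ Cl 𝒱 p p' := by
  refine ⟨image2 (· ∩ ·) 𝒰 𝒱, ⟨?_, eq_univ_of_forall fun p => ?_⟩, ?_⟩
  · rintro _ ⟨u, hu, v, hv, rfl⟩
    exact (h1.1 u hu).inter (h2.1 v hv)
  · obtain ⟨u, hu, a⟩ := h1.mem p
    obtain ⟨v, hv, b⟩ := h2.mem p
    exact ⟨_, ⟨u, hu, v, hv, rfl⟩, a, b⟩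
  · rintro p p' ⟨_, ⟨u, hu, v, hv, rfl⟩, a, b⟩
    exact ⟨⟨u, hu, a.1, b.1⟩, ⟨v, hv, a.2, b.2⟩⟩

theorem star2 {P : Type} [TopologicalSpace P] [TopologicalSpace.MetrizableSpace P]
    {𝒱 : Set (Set P)} (h : IsOpenCover 𝒱) : ∃ 𝒲 : Set (Set P), IsOpenCover 𝒲 ∧
      ∀ p p' p'', Cl 𝒲 p p' → Cl 𝒲 p' p'' → Cl 𝒱 p p'' := by
  obtain ⟨𝒲, h1, h2⟩ := star_cover 𝒱 h
  refine ⟨𝒲, h1, ?_⟩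
  rintro p p' p'' ⟨w, hw, a, b⟩ ⟨w', hw', a', b'⟩
  obtain ⟨O, hO, hpO, Γ, hΓ, -, hst⟩ := h2 p'
  exact ⟨Γ, hΓ, hst w hw ⟨p', b, hpO⟩ a, hst w' hw' ⟨p', a', hpO⟩ b'⟩

theorem kg_stab {Z P : Type} [MetricSpace Z] [TopologicalSpace P]
    [TopologicalSpace.MetrizableSpace P] {κ : ℝ} {h : Z → P} {S : Set P} (hS : IsClosed S)
    (hh : ∀ p ∈ S, KG κ h p) : ∃ 𝒱 : Set (Set P), IsOpenCover 𝒱 ∧ ∀ g : Z → P, UClose 𝒱 g h →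
      ∀ p ∈ S, KG κ g p := by
  obtain ⟨𝒱, h1, h2⟩ := star_cover ({Γ : Set P | IsOpen Γ ∧ ∀ z z', h z ∈ Γ → h z' ∈ Γ →
    dist z z' ≤ κ} ∪ {Sᶜ}) (by
      refine ⟨?_, eq_univ_of_forall fun p => ?_⟩
      · rintro Γ (hΓ | rfl)
        · exact hΓ.1
        · exact hS.isOpen_compl
      · by_cases hp : p ∈ S
        · obtain ⟨O, h1, h2, h3⟩ := hh p hp
          exact ⟨O, Or.inl ⟨h1, h3⟩, h2⟩
        · exact ⟨_, Or.inr rfl, hp⟩)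
  refine ⟨𝒱, h1, fun g hg p hp => ?_⟩
  obtain ⟨O, hO, hpO, Γ, hΓ, hpΓ, hst⟩ := h2 p
  have hz : ∀ z, g z ∈ O → h z ∈ Γ := fun z hz =>
    let ⟨v, hv, a, b⟩ := hg z; hst v hv ⟨_, a, hz⟩ b
  rcases hΓ with hΓ | rfl
  · exact ⟨O, hO, hpO, fun z z' a b => hΓ.2 z z' (hz z a) (hz z' b)⟩
  · exact absurd hp hpΓ

theorem limit_embed {P Z : Type} [TopologicalSpace P] [PolishSpace P] [MetricSpace Z]
    [CompleteSpace Z] (hstep : ∀ h : C(Z, P), ∀ 𝒰, IsOpenCover 𝒰 → ∀ κ > (0 : ℝ), ∃ h' : C(Z, P),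
      UClose 𝒰 h' h ∧ ∀ p, KG κ h' p) (h : C(Z, P)) (𝒰 : Set (Set P)) (h𝒰 : IsOpenCover 𝒰) :
    ∃ g : C(Z, P), IsClosedEmbedding g ∧ UClose 𝒰 g h := by
  classical
  let := TopologicalSpace.upgradeIsCompletelyMetrizable P
  have hmesh : ∀ ε > (0 : ℝ), ∃ 𝒱 : Set (Set P), IsOpenCover 𝒱 ∧ ∀ p p', Cl 𝒱 p p' →
      dist p p' ≤ ε := by
    intro ε hε
    refine ⟨range fun p => Metric.ball p (ε / 2), ⟨?_, eq_univ_of_forall fun p =>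
      ⟨_, ⟨p, rfl⟩, Metric.mem_ball_self (half_pos hε)⟩⟩, ?_⟩
    · rintro _ ⟨p, rfl⟩
      exact Metric.isOpen_ball
    · rintro p p' ⟨_, ⟨c, rfl⟩, a, b⟩
      have := dist_triangle_right p p' c
      rw [Metric.mem_ball] at a b
      linarith
  let St : Type := {s : C(Z, P) × Set (Set P) // IsOpenCover s.2}
  have hnext : ∀ (j : ℕ) (s : St), ∃ (s' : St) (𝒰 𝒲 : Set (Set P)), IsOpenCover 𝒰 ∧
      IsOpenCover 𝒲 ∧
      (∀ p p' p'', Cl 𝒲 p p' → Cl 𝒲 p' p'' → Cl 𝒰 p p'') ∧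
      (∀ p p' p'', Cl 𝒰 p p' → Cl 𝒰 p' p'' → Cl s.1.2 p p'') ∧ UClose 𝒲 s'.1.1 s.1.1 ∧
      (∀ p p', Cl s'.1.2 p p' → Cl 𝒲 p p') ∧ (∀ p p', Cl s'.1.2 p p' → dist p p' ≤ (1/2)^(j+1)) ∧
      ∀ g : Z → P, UClose s'.1.2 g s'.1.1 → ∀ p, KG ((1/2)^j) g p := by
    intro j s
    obtain ⟨𝒰, hU, hU'⟩ := star2 s.2
    obtain ⟨𝒲, hW, hW'⟩ := star2 hU
    obtain ⟨h', h1, h2⟩ := hstep s.1.1 𝒲 hW ((1/2)^j) (by positivity)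
    obtain ⟨𝒱1, a1, b1⟩ := kg_stab isClosed_univ fun p _ => h2 p
    obtain ⟨𝒱2, a2, b2⟩ := hmesh ((1/2)^(j+1)) (by positivity)
    obtain ⟨𝒱3, a3, b3⟩ := cover_inter a1 a2
    obtain ⟨𝒱4, a4, b4⟩ := cover_inter a3 hW
    refine ⟨⟨(h', 𝒱4), a4⟩, 𝒰, 𝒲, hU, hW, hW', hU', h1, fun p p' h => (b4 p p' h).2,
      fun p p' h => b2 p p' (b3 p p' (b4 p p' h).1).2,
      fun g hg p => b1 g (fun z => (b3 _ _ (b4 _ _ (hg z)).1).1) p trivial⟩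
  choose nx 𝒰' 𝒲 hUc hWc hWU hUV hcl hVW hVm hVK using hnext
  obtain ⟨𝒱1, a1, b1⟩ := hmesh 1 one_pos
  obtain ⟨𝒱0, a0, b0⟩ := cover_inter h𝒰 a1
  let s : ℕ → St := fun j => Nat.rec ⟨(h, 𝒱0), a0⟩ (fun j s => nx j s) j
  have hs : ∀ j, s (j + 1) = nx j (s j) := fun j => rfl
  have hm : ∀ j p p', Cl (s j).1.2 p p' → dist p p' ≤ (1/2)^j := by
    intro j
    cases j with
    | zero => exact fun p p' hp => by rw [pow_zero]; exact b1 p p' (b0 p p' hp).2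
    | succ j => exact hVm j (s j)
  have hUV1 : ∀ j p p', Cl (𝒰' j (s j)) p p' → Cl (s j).1.2 p p' := fun j p p' hp =>
    hUV j (s j) p p' p' hp (let ⟨u, hu, a⟩ := (hUc j (s j)).mem p'; ⟨u, hu, a, a⟩)
  have claim : ∀ k j z, Cl (𝒰' j (s j)) ((s (j + k)).1.1 z) ((s j).1.1 z) := by
    intro k
    induction k with
    | zero => exact fun j z => let ⟨u, hu, a⟩ := (hUc j (s j)).mem _; ⟨u, hu, a, a⟩
    | succ k ih =>
      intro j z
      have := ih (j + 1) z
      rw [show j + (k + 1) = j + 1 + k by omega]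
      exact hWU j (s j) _ _ _ (hVW j (s j) _ _ (hUV1 (j + 1) _ _ this)) (hcl j (s j) z)
  have hdist : ∀ z j, dist ((s j).1.1 z) ((s (j + 1)).1.1 z) ≤ 1 * (1/2)^j := by
    intro z j
    rw [one_mul, dist_comm]
    exact hm j _ _ (hUV1 j _ _ (claim 1 j z))
  choose g hg using fun z => cauchySeq_tendsto_of_complete
    (cauchySeq_of_le_geometric (1/2) 1 (by norm_num) (hdist z))
  have hgd : ∀ z j, dist ((s j).1.1 z) (g z) ≤ 1 * (1/2)^j / (1 - 1/2) := fun z j =>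
    dist_le_of_le_geometric_of_tendsto (1/2) 1 (by norm_num) (hdist z) (hg z) j
  have hgc : Continuous g := by
    have : TendstoUniformly (fun j z => (s j).1.1 z) g Filter.atTop := by
      rw [Metric.tendstoUniformly_iff]
      intro ε hε
      have ht : Filter.Tendsto (fun j : ℕ => 1 * (1/2 : ℝ)^j / (1 - 1/2)) Filter.atTop (𝓝 0) := by
        have := (tendsto_pow_atTop_nhds_zero_of_lt_one (r := (1/2 : ℝ)) (by norm_num)
          (by norm_num)).const_mul 1 |>.div_const (1 - 1/2)
        simpa using this
      filter_upwards [ht.eventually (gt_mem_nhds hε)] with j hj z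
      rw [dist_comm]
      exact (hgd z j).trans_lt hj
    exact this.continuous (Filter.Frequently.of_forall fun j => (s j).1.1.continuous)
  have hfin : ∀ j, UClose (s j).1.2 g (s j).1.1 := by
    intro j z
    obtain ⟨w, hw, hgw⟩ := (hUc j (s j)).mem (g z)
    obtain ⟨N, hN⟩ := Filter.eventually_atTop.1
      ((hg z).eventually (((hUc j (s j)).1 w hw).mem_nhds hgw))
    exact hUV j (s j) _ _ _ ⟨w, hw, hgw, hN (j + N) (by omega)⟩ (claim N j z)
  refine ⟨⟨g, hgc⟩, closed_of_kg hgc fun κ hκ p => ?_, fun z => (b0 _ _ (hfin 0 z)).1⟩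
  obtain ⟨j, hj⟩ := exists_pow_lt_of_lt_one hκ (show (1/2 : ℝ) < 1 by norm_num)
  obtain ⟨O, a, b, c⟩ := hVK j (s j) g (hfin (j + 1)) p
  exact ⟨O, a, b, fun z z' x y => (c z z' x y).trans hj.le⟩

theorem adj_step {X Y : Type} [TopologicalSpace X] [TopologicalSpace Y] {n : ℕ}
    (hX : IsNobeling n X) (hY : IsNobeling n Y) {f : X → Y} (hf : IsUVMap n f) {A : Set Y}
    (hA : IsZSet A) {Z : Type} [MetricSpace Z] [PolishSpace Z] (hZ : CovDimLE Z n)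
    (h : C(Z, AdjCarrier f A)) (𝒰 : Set (Set (AdjCarrier f A))) (h𝒰 : IsOpenCover 𝒰) (κ : ℝ)
    (hκ : 0 < κ) : ∃ h' : C(Z, AdjCarrier f A), UClose 𝒰 h' h ∧ ∀ p, KG κ h' p := by
  obtain ⟨hXp, hXd, hXe, hXs⟩ := hX
  obtain ⟨hYp, hYd, hYe, hYs⟩ := hY
  have hP := adj_polish hf.1 hA.1
  have hu := uvs_of_uv hf
  have hfd : DenseRange f := hf.2.1
  have huv := adj_uv hXe hYe hf.1 hfd hu hA
  obtain ⟨𝒰1, hU1, hU1'⟩ := star2 h𝒰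
  obtain ⟨G, hG, hGA⟩ := good_at_A hZ huv.1 huv.2.1 (uvs_of_uv huv)
    (lcn_of_ae (adj_ae hXe hYe hf.1 hfd hu hA)) hA.1
    (fun a ha => ⟨adjInr f A ⟨a, ha⟩, rfl, nhds_adjInr ⟨a, ha⟩⟩) h
    (fun 𝒰 h𝒰 => hYs Z hZ ⟨adjMap f A ∘ h, adjMap_cont.comp h.continuous⟩ 𝒰 h𝒰) hU1 hκ
  obtain ⟨𝒱s, a1, b1⟩ := kg_stab (κ := κ) (h := G) (adjInr_closed (f := f) hA.1).isClosed_range (by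
    rintro _ ⟨a, rfl⟩
    obtain ⟨O, h1, h2, h3⟩ := hGA a a.2
    exact ⟨_, h1.preimage adjMap_cont, h2, h3⟩)
  obtain ⟨𝒱, a2, b2⟩ := cover_inter a1 hU1
  obtain ⟨𝒲, a3, b3⟩ := star2 a2
  obtain ⟨G1, hG1⟩ := adj_push hXe hYe hf.1 hfd hu hA hZ G 𝒲 a3
  have hπ := adjPi_cont hf.1 hA.1
  obtain ⟨g, hge, hg⟩ := hXs Z hZ ⟨fun z => (G1 z).1, continuous_subtype_val.comp G1.continuous⟩
    ((adjPi f A ⁻¹' ·) '' 𝒲) ⟨by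
      rintro _ ⟨w, hw, rfl⟩; exact (a3.1 w hw).preimage hπ, eq_univ_of_forall fun x =>
        let ⟨w, hw, hx⟩ := a3.mem (adjPi f A x); ⟨_, ⟨w, hw, rfl⟩, hx⟩⟩
  have hclose : UClose 𝒱 (fun z => adjPi f A (g z)) G := by
    intro z
    obtain ⟨_, ⟨w, hw, rfl⟩, c1, c2⟩ := hg z
    have c3 : adjPi f A (G1 z).1 = adjInl f A (G1 z) := adjPi_inl (f := f) (A := A) (G1 z).2
    have c2 : adjPi f A (G1 z).1 ∈ w := c2
    rw [c3] at c2
    exact b3 _ _ _ ⟨w, hw, c1, c2⟩ (hG1 z)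
  refine ⟨⟨fun z => adjPi f A (g z), hπ.comp g.continuous⟩,
    fun z => hU1' _ _ _ (b2 _ _ (hclose z)).2 (hG z), fun p => ?_⟩
  obtain ⟨x, rfl⟩ | ⟨a, rfl⟩ := adj_cases p
  · obtain ⟨O, h1, h2, h3⟩ := kg_of_closed hκ hge x.1
    have key : ∀ z, adjPi f A (g z) ∈ adjInl f A '' (Subtype.val ⁻¹' O) → g z ∈ O := by
      rintro z ⟨x', hx', hxz⟩
      by_cases hz : f (g z) ∈ A
      · rw [adjPi_inr hz] at hxz; cases hxz
      · rw [adjPi_inl hz] at hxz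
        rw [adjInl_inj hxz] at hx'
        exact hx'
    exact ⟨_, (adjInl_open hf.1).isOpenMap _ (h1.preimage continuous_subtype_val), ⟨x, h2, rfl⟩,
      fun z z' c d => h3 z z' (key z c) (key z' d)⟩
  · exact b1 _ (fun z => (b2 _ _ (hclose z)).1) _ ⟨a, rfl⟩

/-- Proposition 2.4. -/
theorem adjunction_nobeling (n : ℕ) (X Y : Type) [TopologicalSpace X]
    [TopologicalSpace Y] (hX : IsNobeling n X) (hY : IsNobeling n Y)
    (f : X → Y) (hf : IsUVMap n f) (A : Set Y) (hA : IsZSet A) :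
    IsNobeling n (AdjCarrier f A) ∧
    IsZSet (range (adjInr f A)) ∧
    IsUVMap n (adjMap f A) := by
  have hXp : PolishSpace X := hX.1
  have hYp : PolishSpace Y := hY.1
  have hP := adj_polish hf.1 hA.1
  have hu := uvs_of_uv hf
  have hfd : DenseRange f := hf.2.1
  have hdim := adj_dim hf.1 hA.1 hX.2.1.1 hY.2.1.1
  have hsu : ∀ (Z : Type) [TopologicalSpace Z] [PolishSpace Z], CovDimLE Z n →
      ∀ h : C(Z, AdjCarrier f A), ∀ 𝒰 : Set (Set (AdjCarrier f A)), IsOpenCover 𝒰 →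
        ∃ g : C(Z, AdjCarrier f A), IsClosedEmbedding ⇑g ∧ UClose 𝒰 ⇑g ⇑h := by
    intro Z _ _ hZ h 𝒰 h𝒰
    let := TopologicalSpace.upgradeIsCompletelyMetrizable Z
    exact limit_embed (fun h 𝒰 h𝒰 κ hκ => adj_step hX hY hf hA hZ h 𝒰 h𝒰 κ hκ) h 𝒰 h𝒰
  refine ⟨⟨hP, ⟨hdim, fun m hm => hX.2.1.2 m ?_⟩, adj_ae hX.2.2.1 hY.2.2.1 hf.1 hfd hu hA, hsu⟩,
    adj_zset hX.2.2.1 hY.2.2.1 hf.1 hfd hu hA hdim, adj_uv hX.2.2.1 hY.2.2.1 hf.1 hfd hu hA⟩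
  obtain ⟨g, hg, -⟩ := hsu X hX.2.1.1 ⟨adjPi f A, adjPi_cont hf.1 hA.1⟩ {univ}
    ⟨by simp, by simp⟩
  exact (covDimLE_range hg.isEmbedding).1 (hm.closed hg.isClosed_range)

end NobelingPaper
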